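/- There exists an absolute constant C > 0 such that the following holds. Let p be a prime and let X ⊆ 𝔽_p² with |X| ≤ p^{4/3}. Let T*(X) := #{(x, y, z) ∈ X³ : ||x − y|| = ||x − z|| and ||y − z|| ≠ 0} denote the number of non-degenerate isosceles triangles in X. Then T*(X) ≤ |X|³/p + C · min{ p^{2/3} |X|^{5/3} + p^{1/4} |X|², |X|^{7/3} }. -/

import Mathlib

open Finset

/-- Dot product `x·y = x₁y₁ + ⋯ + xₙyₙ` on `𝔽_q^n`. -/
def dotP {F : Type*} [CommRing F] {n : ℕ} (x y : Fin n → F) : F := ∑ i, x i * y i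

/-- The "norm" `‖x‖ = x₁² + ⋯ + xₙ²` on `𝔽_q^n`. -/
def nrm {F : Type*} [CommRing F] {n : ℕ} (x : Fin n → F) : F := ∑ i, x i * x i

/-- The sphere `S_r = {x ∈ 𝔽_q^n : ‖x‖ = r}`. -/
def sph (F : Type*) [CommRing F] [Fintype F] [DecidableEq F] (n : ℕ) (r : F) :
    Finset (Fin n → F) := Finset.univ.filter fun x => nrm x = r

/-- The dot product set `∏(E) = {x·y : x, y ∈ E}`. -/
def prodSet {F : Type*} [CommRing F] [DecidableEq F] {n : ℕ} (E : Finset (Fin n → F)) :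
    Finset F := (E ×ˢ E).image fun p => dotP p.1 p.2

/-- Fourier transform of the indicator function of `X`:
`X̂(m) = q^{-n} ∑_{x ∈ X} χ(-x·m)`. -/
noncomputable def fourierCoef {F : Type*} [CommRing F] [Fintype F] {n : ℕ}
    (χ : AddChar F ℂ) (X : Finset (Fin n → F)) (m : Fin n → F) : ℂ :=
  ((Fintype.card F : ℂ) ^ n)⁻¹ * ∑ x ∈ X, χ (-(dotP x m))

section Bezout
open MvPolynomial

variable {K : Type*} [Field K]

/-- Evaluation at the line `x = w z + t`, `Y = y`. -/
noncomputable def blueEval (w t y : K) : MvPolynomial (Fin 3) K →ₐ[K] Polynomial K :=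
  aeval ![Polynomial.C w * Polynomial.X + Polynomial.C t, Polynomial.C y, Polynomial.X]

/-- Evaluation at the line `x = w Y + t`, `z = y`. -/
noncomputable def redEval (w t y : K) : MvPolynomial (Fin 3) K →ₐ[K] Polynomial K :=
  aeval ![Polynomial.C w * Polynomial.X + Polynomial.C t, Polynomial.X, Polynomial.C y]

theorem degreeOf_det_le {n : ℕ} {σ R : Type*} [CommRing R] (k : σ)
    (M : Matrix (Fin n) (Fin n) (MvPolynomial σ R)) (d : Fin n → ℕ)
    (h : ∀ i j, (M i j).degreeOf k ≤ d j) : M.det.degreeOf k ≤ ∑ j, d j := by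
  rw [Matrix.det_apply]
  refine (degreeOf_sum_le _ _ _).trans (Finset.sup_le fun τ _ => ?_)
  have h1 : degreeOf k (∏ i, M (τ i) i) ≤ ∑ j, d j :=
    (degreeOf_prod_le _ _ _).trans (Finset.sum_le_sum fun i _ => h _ _)
  rcases Int.units_eq_one_or (Equiv.Perm.sign τ) with h2 | h2
  · simpa [h2] using h1
  · simpa [h2, degreeOf_neg] using h1

theorem degreeOf_resultant_le (f g : Polynomial (MvPolynomial (Fin 2) K)) (b d m n : ℕ)
    (hf : ∀ i, (f.coeff i).degreeOf 0 ≤ b) (hg : ∀ i, (g.coeff i).degreeOf 0 ≤ d) :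
    (f.resultant g m n).degreeOf 0 ≤ m * d + n * b := by
  unfold Polynomial.resultant
  refine (degreeOf_det_le 0 _ (Fin.addCases (fun _ => d) (fun _ => b)) ?_).trans ?_
  · intro i j
    refine Fin.addCases (fun j => ?_) (fun j => ?_) j
    · simp only [Polynomial.sylvester, Matrix.of_apply, Fin.addCases_left]
      split_ifs
      · exact hg _
      · simp
    · simp only [Polynomial.sylvester, Matrix.of_apply, Fin.addCases_right]
      split_ifs
      · exact hf _
      · simp
  · rw [Fin.sum_univ_add]; simp

theorem blueEval_eq (w t y : K) (P : MvPolynomial (Fin 3) K) :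
    blueEval w t y P = (finSuccEquiv K 2 P).eval₂
      (aeval ![Polynomial.C y, Polynomial.X] : MvPolynomial (Fin 2) K →ₐ[K] Polynomial K).toRingHom
      (Polynomial.C w * Polynomial.X + Polynomial.C t) := by
  have : blueEval w t y = (AlgHom.comp (Polynomial.eval₂AlgHom
      (aeval ![Polynomial.C y, Polynomial.X] : MvPolynomial (Fin 2) K →ₐ[K] Polynomial K)
      (Polynomial.C w * Polynomial.X + Polynomial.C t) (fun _ => Commute.all _ _))
      (finSuccEquiv K 2).toAlgHom) := by
    apply MvPolynomial.algHom_ext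
    intro i
    fin_cases i
    · simp [blueEval, finSuccEquiv_X_zero]
    · have := finSuccEquiv_X_succ (R := K) (n := 2) (j := 0)
      simp at this
      simp [blueEval, this]
    · have := finSuccEquiv_X_succ (R := K) (n := 2) (j := 1)
      simp at this
      simp [blueEval, this]
  rw [this]; rfl

theorem card_roots_le {ι : Type*} (S : Finset ι) (z : ι → K) (hz : Set.InjOn z S)
    (R : MvPolynomial (Fin 2) K) (hR : R ≠ 0)
    (h : ∀ j ∈ S, aeval ![Polynomial.C (z j), (Polynomial.X : Polynomial K)] R = 0) :
    S.card ≤ R.degreeOf 0 := by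
  classical
  rw [← natDegree_finSuccEquiv]
  have hinj : Set.InjOn (fun j => (C (z j) : MvPolynomial (Fin 1) K)) S := by
    intro i hi j hj hij
    exact hz hi hj (C_injective _ _ hij)
  rw [← Finset.card_image_of_injOn hinj]
  have hR' : finSuccEquiv K 1 R ≠ 0 := by simpa using hR
  refine (Finset.card_le_card (t := (finSuccEquiv K 1 R).roots.toFinset) ?_).trans
    ((Multiset.toFinset_card_le _).trans (Polynomial.card_roots' _))
  intro r hr
  obtain ⟨j, hj, rfl⟩ := Finset.mem_image.1 hr
  rw [Multiset.mem_toFinset, Polynomial.mem_roots hR', Polynomial.IsRoot]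
  have key : (aeval ![Polynomial.C (z j), (Polynomial.X : Polynomial K)] :
      MvPolynomial (Fin 2) K →ₐ[K] Polynomial K) R =
      (aeval (fun _ => (Polynomial.X : Polynomial K)) : MvPolynomial (Fin 1) K →ₐ[K] Polynomial K)
      ((finSuccEquiv K 1 R).eval (C (z j))) := by
    have : (aeval ![Polynomial.C (z j), (Polynomial.X : Polynomial K)] :
      MvPolynomial (Fin 2) K →ₐ[K] Polynomial K) =
      (aeval (fun _ => (Polynomial.X : Polynomial K)) :
        MvPolynomial (Fin 1) K →ₐ[K] Polynomial K).comp
      ((Polynomial.eval₂AlgHom (AlgHom.id K (MvPolynomial (Fin 1) K))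
      (C (z j)) (fun _ => Commute.all _ _)).comp (finSuccEquiv K 1).toAlgHom) := by
      apply MvPolynomial.algHom_ext
      intro i
      fin_cases i
      · simp [finSuccEquiv_X_zero, Polynomial.algebraMap_eq]
      · have := finSuccEquiv_X_succ (R := K) (n := 1) (j := 0)
        simp at this
        simp [this]
    rw [this]; rfl
  have h0 := h j hj
  rw [key] at h0
  have hinj2 : Function.Injective (aeval (fun _ => (Polynomial.X : Polynomial K)) :
      MvPolynomial (Fin 1) K →ₐ[K] Polynomial K) := by
    exact (MvPolynomial.uniqueAlgEquiv K (Fin 1)).injective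
  exact hinj2 (h0.trans (map_zero _).symm)

theorem card_common_zero_le {ι : Type*} (S : Finset ι) (w t z : ι → K) (hz : Set.InjOn z S)
    (Q H : MvPolynomial (Fin 3) K) (hQ : Irreducible Q) (hQx : 0 < Q.degreeOf 0) (hQH : ¬ Q ∣ H)
    (h : ∀ j ∈ S, blueEval (w j) (t j) (z j) Q = 0 ∧ blueEval (w j) (t j) (z j) H = 0) :
    S.card ≤ Q.degreeOf 0 * H.degreeOf 1 + H.degreeOf 0 * Q.degreeOf 1 := by
  classical
  set f := finSuccEquiv K 2 Q with hf
  set g := finSuccEquiv K 2 H with hg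
  have hfi : Irreducible f := (MulEquiv.irreducible_iff (finSuccEquiv K 2)).2 hQ
  have hfg : ¬ f ∣ g := by
    rw [hf, hg, map_dvd_iff]; exact hQH
  have hfd : f.natDegree = Q.degreeOf 0 := natDegree_finSuccEquiv _
  have hgd : g.natDegree = H.degreeOf 0 := natDegree_finSuccEquiv _
  have hprim : f.IsPrimitive := hfi.isPrimitive (by omega)
  set L := FractionRing (MvPolynomial (Fin 2) K)
  have hfi' : Irreducible (f.map (algebraMap _ L)) :=
    hprim.irreducible_iff_irreducible_map_fraction_map.1 hfi
  have hfg' : ¬ f.map (algebraMap _ L) ∣ g.map (algebraMap _ L) := by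
    intro hd
    exact hfg (hprim.dvd_of_fraction_map_dvd_fraction_map hd)
  have hcop : IsCoprime (f.map (algebraMap _ L)) (g.map (algebraMap _ L)) :=
    (hfi'.coprime_iff_not_dvd).2 hfg'
  have hR : f.resultant g ≠ 0 := by
    intro h0
    have h1 : (f.map (algebraMap _ L)).resultant (g.map (algebraMap _ L)) = 0 := by
      rw [Polynomial.natDegree_map_eq_of_injective (IsFractionRing.injective _ _),
        Polynomial.natDegree_map_eq_of_injective (IsFractionRing.injective _ _),
        Polynomial.resultant_map_map, h0, map_zero]
    exact (Polynomial.resultant_eq_zero_iff.1 h1).2 hcop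
  obtain ⟨u, v, -, -, huv⟩ := Polynomial.exists_mul_add_mul_eq_C_resultant f g le_rfl le_rfl
    (Or.inl (by omega))
  have hdeg := degreeOf_resultant_le f g (Q.degreeOf 1) (H.degreeOf 1) f.natDegree g.natDegree
    (fun i => degreeOf_coeff_finSuccEquiv Q 0 i) (fun i => degreeOf_coeff_finSuccEquiv H 0 i)
  rw [hfd, hgd] at hdeg
  refine (card_roots_le S z hz _ hR fun j hj => ?_).trans ?_
  · obtain ⟨h1, h2⟩ := h j hj
    rw [blueEval_eq] at h1 h2
    have := congrArg (Polynomial.eval₂ (aeval ![Polynomial.C (z j), Polynomial.X] :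
      MvPolynomial (Fin 2) K →ₐ[K] Polynomial K).toRingHom
      (Polynomial.C (w j) * Polynomial.X + Polynomial.C (t j))) huv
    rw [Polynomial.eval₂_add, Polynomial.eval₂_mul, Polynomial.eval₂_mul, h1, h2,
      Polynomial.eval₂_C] at this
    simpa using this.symm
  · rw [hfd, hgd]; exact hdeg
theorem natDegree_aeval_le (g : Fin 3 → Polynomial K) (P : MvPolynomial (Fin 3) K) (d : Fin 3 → ℕ)
    (hg : ∀ i, (g i).natDegree ≤ d i) :
    (aeval g P).natDegree ≤
      P.degreeOf 0 * d 0 + P.degreeOf 1 * d 1 + P.degreeOf 2 * d 2 := by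
  rw [aeval_def, eval₂_eq']
  refine Polynomial.natDegree_sum_le_of_forall_le _ _ fun m hm => ?_
  refine (Polynomial.natDegree_C_mul_le _ _).trans ?_
  refine (Polynomial.natDegree_prod_le _ _).trans ?_
  rw [Fin.sum_univ_three]
  have h : ∀ i, (g i ^ m i).natDegree ≤ P.degreeOf i * d i := fun i =>
    Polynomial.natDegree_pow_le.trans
      (Nat.mul_le_mul (degreeOf_le_iff.1 le_rfl m hm) (hg i))
  have := h 0; have := h 1; have := h 2
  omega

theorem natDegree_linear_le (w t : K) :
    (Polynomial.C w * Polynomial.X + Polynomial.C t).natDegree ≤ 1 := by compute_degree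

theorem natDegree_blueEval_le (w t y : K) (P : MvPolynomial (Fin 3) K) :
    (blueEval w t y P).natDegree ≤ P.degreeOf 0 + P.degreeOf 2 := by
  refine (natDegree_aeval_le _ P ![1, 0, 1] ?_).trans (by simp)
  intro i
  fin_cases i
  · exact natDegree_linear_le w t
  · simp
  · simp

theorem natDegree_redEval_le (w t y : K) (P : MvPolynomial (Fin 3) K) :
    (redEval w t y P).natDegree ≤ P.degreeOf 0 + P.degreeOf 1 := by
  refine (natDegree_aeval_le _ P ![1, 1, 0] ?_).trans (by simp)
  intro i
  fin_cases i
  · exact natDegree_linear_le w t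
  · simp
  · simp

theorem exists_red_vanishing {ι : Type*} (I : Finset ι) (w t z : ι → K) (a c : ℕ)
    (h : I.card * (2 * a + 1) < (a + 1) * ((a + 1) * (c + 1))) :
    ∃ P : MvPolynomial (Fin 3) K, P ≠ 0 ∧ P.degreeOf 0 ≤ a ∧ P.degreeOf 1 ≤ a ∧ P.degreeOf 2 ≤ c ∧
      ∀ i ∈ I, redEval (w i) (t i) (z i) P = 0 := by
  classical
  let T := Fin (a + 1) × Fin (a + 1) × Fin (c + 1)
  let e : T → (Fin 3 →₀ ℕ) := fun s => Finsupp.equivFunOnFinite.symm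
    ![(s.1 : ℕ), (s.2.1 : ℕ), (s.2.2 : ℕ)]
  have he : Function.Injective e := by
    intro s s' hs
    have h0 := DFunLike.congr_fun hs 0
    have h1 := DFunLike.congr_fun hs 1
    have h2 := DFunLike.congr_fun hs 2
    simp only [e, Finsupp.equivFunOnFinite_symm_apply_apply, Matrix.cons_val] at h0 h1 h2
    exact Prod.ext (Fin.ext h0) (Prod.ext (Fin.ext h1) (Fin.ext h2))
  let b : T → MvPolynomial (Fin 3) K := fun s => monomial (e s) 1
  have hb : LinearIndependent K b := by
    have := (basisMonomials (Fin 3) K).linearIndependent.comp e he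
    have hb' : b = basisMonomials (Fin 3) K ∘ e := by
      ext1 s
      simp [b]
    rw [hb']
    exact this
  let Φ : (T → K) →ₗ[K] MvPolynomial (Fin 3) K := Fintype.linearCombination K b
  have hΦ : Function.Injective Φ := hb.fintypeLinearCombination_injective
  let Ψ : (T → K) →ₗ[K] (I × Fin (2 * a + 1) → K) :=
    LinearMap.pi fun s => (Polynomial.lcoeff K s.2).comp
      ((redEval (w s.1) (t s.1) (z s.1)).toLinearMap.comp Φ)
  have hker : LinearMap.ker Ψ ≠ ⊥ := by
    apply LinearMap.ker_ne_bot_of_finrank_lt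
    simp only [Module.finrank_fintype_fun_eq_card, Fintype.card_prod, Fintype.card_fin,
      Fintype.card_coe, T]
    exact h
  obtain ⟨g, hg, hg0⟩ := Submodule.exists_mem_ne_zero_of_ne_bot hker
  have hdeg : ∀ (k : Fin 3) (d : ℕ), (∀ s, e s k ≤ d) → (Φ g).degreeOf k ≤ d := by
    intro k d hd
    simp only [Φ, Fintype.linearCombination_apply]
    refine (degreeOf_sum_le _ _ _).trans (Finset.sup_le fun s _ => ?_)
    rw [MvPolynomial.smul_eq_C_mul]
    refine (degreeOf_C_mul_le _ _ _).trans ?_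
    exact (degreeOf_monomial_eq (e s) k (one_ne_zero (α := K))).le.trans (hd s)
  have d0 : (Φ g).degreeOf 0 ≤ a := hdeg 0 a fun s => by simp [e]; omega
  have d1 : (Φ g).degreeOf 1 ≤ a := hdeg 1 a fun s => by simp [e]; omega
  have d2 : (Φ g).degreeOf 2 ≤ c := hdeg 2 c fun s => by simp [e]; omega
  refine ⟨Φ g, fun h0 => hg0 (hΦ (h0.trans (map_zero Φ).symm)), d0, d1, d2, fun i hi => ?_⟩
  ext n
  by_cases hn : n < 2 * a + 1
  · have := congrFun (LinearMap.mem_ker.1 hg) (⟨i, hi⟩, ⟨n, hn⟩)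
    simpa [Ψ] using this
  · rw [Polynomial.coeff_zero]
    apply Polynomial.coeff_eq_zero_of_natDegree_lt
    have := natDegree_redEval_le (w i) (t i) (z i) (Φ g)
    omega

theorem blueEval_eval (w t y x : K) (P : MvPolynomial (Fin 3) K) :
    (blueEval w t y P).eval x = aeval ![w * x + t, y, x] P := by
  rw [blueEval, ← Polynomial.coe_aeval_eq_eval, ← AlgHom.comp_apply, comp_aeval]
  congr 1
  congr 1
  ext i
  fin_cases i <;> simp

theorem redEval_eval (w t y x : K) (P : MvPolynomial (Fin 3) K) :
    (redEval w t y P).eval x = aeval ![w * x + t, x, y] P := by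
  rw [redEval, ← Polynomial.coe_aeval_eq_eval, ← AlgHom.comp_apply, comp_aeval]
  congr 1
  congr 1
  ext i
  fin_cases i <;> simp
end Bezout

section

open Polynomial

variable {K : Type*} [Field K]

theorem eq_C_mul_of_derivative_mul_eq {p : ℕ} [CharP K p] {f g : Polynomial K} (hg : g ≠ 0)
    (hfp : f.natDegree < p) (hgp : g.natDegree < p)
    (h : Polynomial.derivative f * g = f * Polynomial.derivative g) :
    ∃ κ : K, f = C κ * g := by
  refine ⟨f.coeff g.natDegree / g.leadingCoeff, ?_⟩
  set κ := f.coeff g.natDegree / g.leadingCoeff with hκ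
  have hlg : g.leadingCoeff ≠ 0 := leadingCoeff_ne_zero.2 hg
  by_contra hne
  have hf1 : f - C κ * g ≠ 0 := sub_ne_zero.2 hne
  set F := f - C κ * g with hF
  have hFg : derivative F * g = F * derivative g := by
    rw [hF, derivative_sub, derivative_C_mul, sub_mul, h]; ring
  have hFp : F.natDegree < p := by
    refine (natDegree_sub_le _ _).trans_lt (max_lt hfp ((natDegree_C_mul_le _ _).trans_lt hgp))
  have hcoeff : F.coeff g.natDegree = 0 := by
    rw [hF, coeff_sub, coeff_C_mul, hκ, coeff_natDegree]
    field_simp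
    ring
  have hnd : F.natDegree ≠ g.natDegree := by
    intro he
    rw [← he] at hcoeff
    exact hf1 (leadingCoeff_eq_zero.1 hcoeff)
  have hX : ∀ q : K[X], (X * derivative q).natDegree ≤ q.natDegree := by
    intro q
    rw [natDegree_le_iff_coeff_eq_zero]
    intro n hn
    rcases n with _ | n
    · omega
    · rw [coeff_X_mul, coeff_derivative, coeff_eq_zero_of_natDegree_lt hn, zero_mul]
  have hXc : ∀ q : K[X], (X * derivative q).coeff q.natDegree = q.natDegree * q.leadingCoeff := by
    intro q
    rcases hn : q.natDegree with _ | n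
    · simp
    · rw [coeff_X_mul, coeff_derivative, leadingCoeff, hn]; push_cast; ring
  have e1 : (X * derivative F * g).coeff (F.natDegree + g.natDegree) =
      F.natDegree * F.leadingCoeff * g.leadingCoeff := by
    rw [coeff_mul_add_eq_of_natDegree_le (hX F) le_rfl, hXc, coeff_natDegree]
  have e2 : (F * (X * derivative g)).coeff (F.natDegree + g.natDegree) =
      F.leadingCoeff * (g.natDegree * g.leadingCoeff) := by
    rw [coeff_mul_add_eq_of_natDegree_le le_rfl (hX g), hXc, coeff_natDegree]
  have e3 : X * derivative F * g = F * (X * derivative g) := by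
    rw [mul_assoc, hFg]; ring
  rw [e3, e2] at e1
  have hlF : F.leadingCoeff ≠ 0 := leadingCoeff_ne_zero.2 hf1
  have e4 : (F.natDegree : K) = g.natDegree := by
    have : F.leadingCoeff * g.leadingCoeff * ((F.natDegree : K) - g.natDegree) = 0 := by
      linear_combination -e1
    rcases mul_eq_zero.1 this with h' | h'
    · exact absurd h' (mul_ne_zero hlF hlg)
    · exact sub_eq_zero.1 h'
  exact hnd (CharP.natCast_injOn_Iio K p hFp hgp e4)

theorem slope_linear {p : ℕ} [CharP K p] {u v ω : Polynomial K} (hu : u ≠ 0) (d : ℕ)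
    (hud : u.natDegree ≤ d) (hvd : v.natDegree ≤ d) (hd : 2 * d + 1 < p)
    (hv : u ^ 2 * Polynomial.derivative (Polynomial.derivative v) -
      2 * u * Polynomial.derivative u * Polynomial.derivative v = v * ω)
    (huu : u ^ 2 * Polynomial.derivative (Polynomial.derivative u) -
      2 * u * Polynomial.derivative u * Polynomial.derivative u = u * ω) :
    ∃ κ l : K, v = (C κ * X + C l) * u := by
  have hdu : (derivative u).natDegree ≤ d := (natDegree_derivative_le u).trans (by omega)
  have hdv : (derivative v).natDegree ≤ d := (natDegree_derivative_le v).trans (by omega)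
  have key : u ^ 2 * derivative (derivative v) - 2 * u * derivative u * derivative v
      - v * u * derivative (derivative u) + 2 * v * derivative u ^ 2 = 0 := by
    apply mul_left_cancel₀ hu
    linear_combination u * hv - v * huu
  obtain ⟨κ, hκ⟩ := eq_C_mul_of_derivative_mul_eq (p := p) (f := derivative v * u - v * derivative u)
    (g := u ^ 2) (pow_ne_zero 2 hu)
    (by
      refine (natDegree_sub_le _ _).trans_lt (max_lt ?_ ?_)
      · exact natDegree_mul_le.trans_lt (by omega)
      · exact natDegree_mul_le.trans_lt (by omega))
    (natDegree_pow_le.trans_lt (by omega))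
    (by
      rw [derivative_sub, derivative_mul, derivative_mul, derivative_pow]
      simp only [Nat.cast_ofNat, Nat.add_one_sub_one, pow_one]
      have : (C (2 : K) : K[X]) = 2 := map_ofNat C 2
      rw [this]
      linear_combination u * key)
  obtain ⟨l, hl⟩ := eq_C_mul_of_derivative_mul_eq (p := p) (f := v - C κ * X * u) (g := u) hu
    (by
      refine (natDegree_sub_le _ _).trans_lt (max_lt (by omega) ?_)
      have : (C κ * X * u).natDegree ≤ 1 + d := by
        refine natDegree_mul_le.trans (add_le_add ?_ hud)
        compute_degree
      omega)
    (by omega)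
    (by
      rw [derivative_sub, derivative_mul, derivative_mul, derivative_C, derivative_X]
      linear_combination hκ)
  exact ⟨κ, l, by linear_combination hl⟩

end

section

open MvPolynomial

variable {K : Type*} [Field K]

theorem pderiv_pderiv_comm {σ : Type*} (i j : σ) (P : MvPolynomial σ K) :
    pderiv i (pderiv j P) = pderiv j (pderiv i P) := by
  classical
  have h : ⁅pderiv (R := K) i, pderiv (R := K) j⁆ = (0 : Derivation K (MvPolynomial σ K) (MvPolynomial σ K)) := by
    apply MvPolynomial.derivation_ext
    intro k
    simp only [Derivation.commutator_apply, pderiv_X, Pi.single_apply, Derivation.zero_apply]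
    split_ifs <;> simp
  have := congrArg (fun D : Derivation K (MvPolynomial σ K) (MvPolynomial σ K) => D P) h
  simpa [Derivation.commutator_apply, sub_eq_zero] using this

theorem derivative_blueEval (w t y : K) (P : MvPolynomial (Fin 3) K) :
    Polynomial.derivative (blueEval w t y P) =
      blueEval w t y (pderiv 2 P) + Polynomial.C w * blueEval w t y (pderiv 0 P) := by
  induction P using MvPolynomial.induction_on with
  | C a => simp [blueEval, Polynomial.algebraMap_eq]
  | add P Q hP hQ => simp only [map_add, hP, hQ]; ring
  | mul_X P i hP =>
    rw [map_mul, Polynomial.derivative_mul, hP, pderiv_mul, pderiv_mul, map_add, map_add, map_mul,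
      map_mul, map_mul, map_mul]
    fin_cases i <;> simp [blueEval, pderiv_X] <;> ring

theorem derivative_redEval (w t y : K) (P : MvPolynomial (Fin 3) K) :
    Polynomial.derivative (redEval w t y P) =
      redEval w t y (pderiv 1 P) + Polynomial.C w * redEval w t y (pderiv 0 P) := by
  induction P using MvPolynomial.induction_on with
  | C a => simp [redEval, Polynomial.algebraMap_eq]
  | add P Q hP hQ => simp only [map_add, hP, hQ]; ring
  | mul_X P i hP =>
    rw [map_mul, Polynomial.derivative_mul, hP, pderiv_mul, pderiv_mul, map_add, map_add, map_mul,
      map_mul, map_mul, map_mul]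
    fin_cases i <;> simp [redEval, pderiv_X] <;> ring

/-- The second-order flecnode polynomial of the pencil of planes `Y = const`. -/
noncomputable def flec (Q : MvPolynomial (Fin 3) K) : MvPolynomial (Fin 3) K :=
  pderiv 2 Q ^ 2 * pderiv 0 (pderiv 0 Q) - 2 * pderiv 0 Q * pderiv 2 Q * pderiv 2 (pderiv 0 Q)
    + pderiv 0 Q ^ 2 * pderiv 2 (pderiv 2 Q)

theorem blueEval_second (w t y : K) (Q : MvPolynomial (Fin 3) K) :
    Polynomial.derivative (Polynomial.derivative (blueEval w t y Q)) =
      blueEval w t y (pderiv 2 (pderiv 2 Q)) +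
      2 * Polynomial.C w * blueEval w t y (pderiv 2 (pderiv 0 Q)) +
      Polynomial.C w ^ 2 * blueEval w t y (pderiv 0 (pderiv 0 Q)) := by
  rw [derivative_blueEval, Polynomial.derivative_add, Polynomial.derivative_C_mul,
    derivative_blueEval, derivative_blueEval, pderiv_pderiv_comm 0 2]
  ring

theorem blueEval_flec (w t y : K) (Q : MvPolynomial (Fin 3) K) (h : blueEval w t y Q = 0) :
    blueEval w t y (flec Q) = 0 := by
  have h1 := derivative_blueEval w t y Q
  have h2 := blueEval_second w t y Q
  rw [h] at h1 h2
  simp only [Polynomial.derivative_zero] at h1 h2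
  have h3 : blueEval w t y (pderiv 2 Q) = - Polynomial.C w * blueEval w t y (pderiv 0 Q) := by
    linear_combination -h1
  simp only [flec, map_add, map_sub, map_mul, map_pow, h3]
  have h4 : blueEval w t y (2 : MvPolynomial (Fin 3) K) = 2 := map_ofNat _ 2
  rw [h4]
  linear_combination (-(blueEval w t y (pderiv 0 Q)) ^ 2) * h2

theorem blueEval_pderiv_flec (k : Fin 3) (w t y : K) (Q : MvPolynomial (Fin 3) K)
    (h : blueEval w t y Q = 0) :
    blueEval w t y (pderiv k (flec Q)) =
      blueEval w t y (pderiv 0 Q) ^ 2 *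
        Polynomial.derivative (Polynomial.derivative (blueEval w t y (pderiv k Q))) -
      2 * blueEval w t y (pderiv 0 Q) * Polynomial.derivative (blueEval w t y (pderiv 0 Q)) *
        Polynomial.derivative (blueEval w t y (pderiv k Q)) := by
  have h1 := derivative_blueEval w t y Q
  have h2 := blueEval_second w t y Q
  rw [h] at h1 h2
  simp only [Polynomial.derivative_zero] at h1 h2
  have h3 : blueEval w t y (pderiv 2 Q) = - Polynomial.C w * blueEval w t y (pderiv 0 Q) := by
    linear_combination -h1
  have h4 : blueEval w t y (pderiv 2 (pderiv 2 Q)) =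
      - (2 * Polynomial.C w * blueEval w t y (pderiv 2 (pderiv 0 Q)) +
      Polynomial.C w ^ 2 * blueEval w t y (pderiv 0 (pderiv 0 Q))) := by
    linear_combination -h2
  rw [blueEval_second, derivative_blueEval w t y (pderiv 0 Q),
    derivative_blueEval w t y (pderiv k Q)]
  have c2 : pderiv k (2 : MvPolynomial (Fin 3) K) = 0 := by
    have : (2 : MvPolynomial (Fin 3) K) = C 2 := (map_ofNat C 2).symm
    rw [this, pderiv_C]
  have e2 : blueEval w t y (2 : MvPolynomial (Fin 3) K) = 2 := map_ofNat _ 2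
  have e1 : ∀ i j, pderiv k (pderiv i (pderiv j Q)) = pderiv i (pderiv j (pderiv k Q)) := by
    intro i j
    rw [pderiv_pderiv_comm k i, pderiv_pderiv_comm k j]
  simp only [flec, pow_two, map_add, map_sub, pderiv_mul, c2, e1, pderiv_pderiv_comm k 0 Q,
    pderiv_pderiv_comm k 2 Q, map_mul, h3, h4, e2, zero_mul, map_zero]
  ring

end

section

open MvPolynomial

variable {K : Type*} [Field K]

theorem degreeOf_le_of_dvd {σ : Type*} (i : σ) {P Q : MvPolynomial σ K} (h : P ∣ Q) (hQ : Q ≠ 0) :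
    P.degreeOf i ≤ Q.degreeOf i := by
  obtain ⟨R, rfl⟩ := h
  rw [degreeOf_mul_eq (left_ne_zero_of_mul hQ) (right_ne_zero_of_mul hQ)]
  omega

theorem degreeOf_pderiv_le {σ : Type*} (i j : σ) (P : MvPolynomial σ K) :
    (pderiv i P).degreeOf j ≤ P.degreeOf j := by
  rw [degreeOf_le_iff]
  intro m hm
  rw [mem_support_iff, coeff_pderiv] at hm
  have : m + Finsupp.single i 1 ∈ P.support := mem_support_iff.2 (left_ne_zero_of_mul hm)
  have := degreeOf_le_iff.1 (le_refl (P.degreeOf j)) _ this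
  simp only [Finsupp.add_apply] at this
  omega

theorem degreeOf_pderiv_self_lt {σ : Type*} (i : σ) (P : MvPolynomial σ K) (hP : 0 < P.degreeOf i) :
    (pderiv i P).degreeOf i < P.degreeOf i := by
  rw [degreeOf_lt_iff hP]
  intro m hm
  rw [mem_support_iff, coeff_pderiv] at hm
  have : m + Finsupp.single i 1 ∈ P.support := mem_support_iff.2 (left_ne_zero_of_mul hm)
  have := degreeOf_le_iff.1 (le_refl (P.degreeOf i)) _ this
  simp only [Finsupp.add_apply, Finsupp.single_eq_same] at this
  omega

theorem pderiv_ne_zero {p : ℕ} [CharP K p] {σ : Type*} (i : σ) (P : MvPolynomial σ K)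
    (hP : 0 < P.degreeOf i) (hp : P.degreeOf i < p) : pderiv i P ≠ 0 := by
  classical
  have hP0 : P ≠ 0 := by rintro rfl; simp at hP
  obtain ⟨m, hm, hmi⟩ := Finset.exists_mem_eq_sup P.support (support_nonempty.2 hP0) (fun m => m i)
  rw [← degreeOf_eq_sup] at hmi
  intro h0
  have h1 := congrArg (coeff (m - Finsupp.single i 1)) h0
  have h2 : m - Finsupp.single i 1 + Finsupp.single i 1 = m := by
    ext k
    by_cases hk : k = i
    · subst hk; simp; omega
    · simp [Ne.symm hk]
  rw [coeff_pderiv, h2, coeff_zero] at h1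
  have h3 : (((m - Finsupp.single i 1 : σ →₀ ℕ) i : ℕ) : K) + 1 = (m i : K) := by
    have : m i = (m - Finsupp.single i 1 : σ →₀ ℕ) i + 1 := by simp; omega
    rw [this]; push_cast; rfl
  rw [h3] at h1
  rcases mul_eq_zero.1 h1 with h4 | h4
  · exact mem_support_iff.1 hm h4
  · have := (CharP.cast_eq_zero_iff K p _).1 h4
    exact absurd (Nat.le_of_dvd (by omega) this) (by omega)

theorem degreeOf_flec_le (i : Fin 3) (Q : MvPolynomial (Fin 3) K) :
    (flec Q).degreeOf i ≤ 3 * Q.degreeOf i := by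
  have h1 : ∀ k, (pderiv k Q).degreeOf i ≤ Q.degreeOf i := fun k => degreeOf_pderiv_le k i Q
  have h2 : ∀ k l, (pderiv k (pderiv l Q)).degreeOf i ≤ Q.degreeOf i := fun k l =>
    (degreeOf_pderiv_le k i _).trans (h1 l)
  have hm : ∀ A B D : MvPolynomial (Fin 3) K, A.degreeOf i ≤ Q.degreeOf i →
      B.degreeOf i ≤ Q.degreeOf i → D.degreeOf i ≤ Q.degreeOf i →
      (A * B * D).degreeOf i ≤ 3 * Q.degreeOf i := by
    intro A B D hA hB hD
    have e1 := degreeOf_mul_le i (A * B) D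
    have e2 := degreeOf_mul_le i A B
    omega
  have e : flec Q = pderiv 2 Q * pderiv 2 Q * pderiv 0 (pderiv 0 Q)
      + C (-2) * (pderiv 0 Q * pderiv 2 Q * pderiv 2 (pderiv 0 Q))
      + pderiv 0 Q * pderiv 0 Q * pderiv 2 (pderiv 2 Q) := by
    have : (C (-2) : MvPolynomial (Fin 3) K) = -2 := by rw [map_neg, map_ofNat C 2]
    rw [flec, this]; ring
  rw [e]
  refine (degreeOf_add_le _ _ _).trans (max_le ((degreeOf_add_le _ _ _).trans (max_le ?_ ?_)) ?_)
  · exact hm _ _ _ (h1 _) (h1 _) (h2 _ _)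
  · exact (degreeOf_C_mul_le _ _ _).trans (hm _ _ _ (h1 _) (h1 _) (h2 _ _))
  · exact hm _ _ _ (h1 _) (h1 _) (h2 _ _)

open Classical in
theorem card_zero_le_of_irreducible {ι : Type*} (I : Finset ι) (w t z : ι → K) (M : ℕ)
    (P : MvPolynomial (Fin 3) K) (hP : P ≠ 0)
    (h : ∀ Q, Irreducible Q → Q ∣ P →
      #{j ∈ I | blueEval (w j) (t j) (z j) Q = 0} ≤ M * (Q.degreeOf 0 + Q.degreeOf 1)) :
    #{j ∈ I | blueEval (w j) (t j) (z j) P = 0} ≤ M * (P.degreeOf 0 + P.degreeOf 1) := by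
  induction P using WfDvdMonoid.induction_on_irreducible with
  | zero => exact absurd rfl hP
  | unit u hu =>
    rw [Finset.card_eq_zero.2]
    · exact Nat.zero_le _
    · refine Finset.filter_eq_empty_iff.2 fun j _ h0 => ?_
      have := hu.map (blueEval (w j) (t j) (z j))
      rw [h0] at this
      exact not_isUnit_zero this
  | mul P Q hP0 hQ ih =>
    have h1 := ih hP0 fun R hR hRP => h R hR (hRP.mul_left Q)
    have h2 := h Q hQ (dvd_mul_right Q P)
    rw [degreeOf_mul_eq hQ.ne_zero hP0, degreeOf_mul_eq hQ.ne_zero hP0]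
    have h3 : {j ∈ I | blueEval (w j) (t j) (z j) (Q * P) = 0} ⊆
        {j ∈ I | blueEval (w j) (t j) (z j) Q = 0} ∪ {j ∈ I | blueEval (w j) (t j) (z j) P = 0} := by
      intro j hj
      simp only [mem_filter, mem_union, map_mul, mul_eq_zero] at hj ⊢
      tauto
    have h4 := (Finset.card_le_card h3).trans (Finset.card_union_le _ _)
    nlinarith

theorem card_zero_le_of_degreeOf_eq_zero {ι : Type*} (S : Finset ι) (w t z : ι → K)
    (hz : Set.InjOn z S) (Q : MvPolynomial (Fin 3) K) (hQ : Q ≠ 0) (hQx : Q.degreeOf 0 = 0)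
    (h : ∀ j ∈ S, blueEval (w j) (t j) (z j) Q = 0) : S.card ≤ Q.degreeOf 1 := by
  have h0 : (finSuccEquiv K 2 Q).natDegree = 0 := by rw [natDegree_finSuccEquiv, hQx]
  have h1 := Polynomial.eq_C_of_natDegree_eq_zero h0
  set R := (finSuccEquiv K 2 Q).coeff 0
  have hR : R ≠ 0 := by
    intro hR
    rw [hR, map_zero] at h1
    exact hQ (by simpa using h1)
  refine (card_roots_le S z hz R hR fun j hj => ?_).trans (degreeOf_coeff_finSuccEquiv Q 0 0)
  have := h j hj
  rw [blueEval_eq, h1, Polynomial.eval₂_C] at this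
  exact this

theorem exists_ruled_component {ι : Type*} {p : ℕ} [CharP K p] (I : Finset ι) (w t z : ι → K)
    (hz : Set.InjOn z I) (P : MvPolynomial (Fin 3) K) (hP : P ≠ 0) (a c : ℕ) (ha : 1 ≤ a)
    (d0 : P.degreeOf 0 ≤ a) (d1 : P.degreeOf 1 ≤ a) (d2 : P.degreeOf 2 ≤ c)
    (hI : 6 * a ^ 2 < I.card) (hp : 2 * (a + c) + 1 < p)
    (h : ∀ j ∈ I, blueEval (w j) (t j) (z j) P = 0) :
    ∃ (Q P' : MvPolynomial (Fin 3) K) (n : ℕ), P = Q ^ n * P' ∧ Q ∣ P ∧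
      ∃ j ∈ I, ∃ κ l : K, blueEval (w j) (t j) (z j) (pderiv 0 Q) ≠ 0 ∧
        blueEval (w j) (t j) (z j) P' ≠ 0 ∧
        blueEval (w j) (t j) (z j) (pderiv 1 Q) =
          (Polynomial.C κ * Polynomial.X + Polynomial.C l) *
            blueEval (w j) (t j) (z j) (pderiv 0 Q) := by
  classical
  obtain ⟨Q, hQ, hQP, hn⟩ : ∃ Q, Irreducible Q ∧ Q ∣ P ∧ 3 * a * (Q.degreeOf 0 + Q.degreeOf 1) <
      #{j ∈ I | blueEval (w j) (t j) (z j) Q = 0} := by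
    by_contra! hcon
    have h1 := card_zero_le_of_irreducible I w t z (3 * a) P hP hcon
    rw [Finset.filter_true_of_mem h] at h1
    nlinarith
  set S : Finset ι := {j ∈ I | blueEval (w j) (t j) (z j) Q = 0} with hS
  have hSI : ∀ j ∈ S, j ∈ I ∧ blueEval (w j) (t j) (z j) Q = 0 := fun j hj => by
    simpa [hS] using hj
  have hzS : Set.InjOn z S := hz.mono fun j hj => (hSI j hj).1
  have q0 : Q.degreeOf 0 ≤ a := (degreeOf_le_of_dvd 0 hQP hP).trans d0
  have q1 : Q.degreeOf 1 ≤ a := (degreeOf_le_of_dvd 1 hQP hP).trans d1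
  have q2 : Q.degreeOf 2 ≤ c := (degreeOf_le_of_dvd 2 hQP hP).trans d2
  have hQx : 0 < Q.degreeOf 0 := by
    by_contra hcon
    have h0 : Q.degreeOf 0 = 0 := by omega
    have := card_zero_le_of_degreeOf_eq_zero S w t z hzS Q hQ.ne_zero h0 fun j hj => (hSI j hj).2
    nlinarith
  have hflec : Q ∣ flec Q := by
    by_contra hcon
    have h1 := card_common_zero_le S w t z hzS Q _ hQ hQx hcon fun j hj =>
      ⟨(hSI j hj).2, blueEval_flec _ _ _ _ (hSI j hj).2⟩
    have h2 := degreeOf_flec_le 0 Q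
    have h3 := degreeOf_flec_le 1 Q
    have h4 := Nat.mul_le_mul_left (Q.degreeOf 0) h3
    have h5 := Nat.mul_le_mul_right (Q.degreeOf 1) h2
    nlinarith
  have hQd : ¬ Q ∣ pderiv 0 Q := by
    intro hd
    have h1 := degreeOf_le_of_dvd 0 hd (pderiv_ne_zero (p := p) 0 Q hQx (by omega))
    have h2 := degreeOf_pderiv_self_lt 0 Q hQx
    omega
  obtain ⟨n, P', hQP', hPe⟩ := WfDvdMonoid.max_power_factor hP hQ
  have hP'P : P' ∣ P := ⟨Q ^ n, by rw [hPe]; ring⟩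
  have p0 : P'.degreeOf 0 ≤ a := (degreeOf_le_of_dvd 0 hP'P hP).trans d0
  have p1 : P'.degreeOf 1 ≤ a := (degreeOf_le_of_dvd 1 hP'P hP).trans d1
  set S1 : Finset ι := {j ∈ S | blueEval (w j) (t j) (z j) (pderiv 0 Q) = 0} with hS1
  set S2 : Finset ι := {j ∈ S | blueEval (w j) (t j) (z j) P' = 0} with hS2
  have c1 : #S1 ≤ Q.degreeOf 0 * Q.degreeOf 1 + Q.degreeOf 0 * Q.degreeOf 1 := by
    have h1 := card_common_zero_le S1 w t z (hzS.mono (Finset.filter_subset _ _)) Q _ hQ hQx hQd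
      fun j hj => ⟨(hSI j (Finset.mem_filter.1 hj).1).2, (Finset.mem_filter.1 hj).2⟩
    have h2 := Nat.mul_le_mul_left (Q.degreeOf 0) (degreeOf_pderiv_le 0 1 Q)
    have h3 := Nat.mul_le_mul_right (Q.degreeOf 1) (degreeOf_pderiv_le 0 0 Q)
    omega
  have c2 : #S2 ≤ Q.degreeOf 0 * a + a * Q.degreeOf 1 := by
    have h1 := card_common_zero_le S2 w t z (hzS.mono (Finset.filter_subset _ _)) Q _ hQ hQx hQP'
      fun j hj => ⟨(hSI j (Finset.mem_filter.1 hj).1).2, (Finset.mem_filter.1 hj).2⟩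
    have h2 := Nat.mul_le_mul_left (Q.degreeOf 0) p1
    have h3 := Nat.mul_le_mul_right (Q.degreeOf 1) p0
    omega
  obtain ⟨j, hjS, hj⟩ : ∃ j ∈ S, j ∉ S1 ∪ S2 := by
    by_contra! hcon
    have h1 := (Finset.card_le_card hcon).trans (Finset.card_union_le _ _)
    have h2 := Nat.mul_le_mul_left (Q.degreeOf 0) q1
    have h3 := Nat.mul_le_mul_right (Q.degreeOf 1) q0
    nlinarith
  simp only [hS1, hS2, mem_union, mem_filter, hjS, true_and, not_or] at hj
  obtain ⟨hjI, hjQ⟩ := hSI j hjS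
  obtain ⟨W, hW⟩ := hflec
  have hu1 : (blueEval (w j) (t j) (z j) (pderiv 0 Q)).natDegree ≤ a + c := by
    have h1 := natDegree_blueEval_le (w j) (t j) (z j) (pderiv 0 Q)
    have h2 := degreeOf_pderiv_le 0 0 Q
    have h3 := degreeOf_pderiv_le 0 2 Q
    omega
  have hv1 : (blueEval (w j) (t j) (z j) (pderiv 1 Q)).natDegree ≤ a + c := by
    have h1 := natDegree_blueEval_le (w j) (t j) (z j) (pderiv 1 Q)
    have h2 := degreeOf_pderiv_le 1 0 Q
    have h3 := degreeOf_pderiv_le 1 2 Q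
    omega
  have hk : ∀ k, blueEval (w j) (t j) (z j) (pderiv k (flec Q)) =
      blueEval (w j) (t j) (z j) (pderiv k Q) * blueEval (w j) (t j) (z j) W := by
    intro k
    rw [hW, pderiv_mul, map_add, map_mul, map_mul, hjQ, zero_mul, add_zero]
  obtain ⟨κ, l, hκ⟩ := slope_linear (p := p) hj.1 (a + c) hu1 hv1 hp
    ((blueEval_pderiv_flec 1 _ _ _ Q hjQ).symm.trans (hk 1))
    ((blueEval_pderiv_flec 0 _ _ _ Q hjQ).symm.trans (hk 0))
  exact ⟨Q, P', n, hPe, hQP, j, hjI, κ, l, hj.1, hj.2, hκ⟩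
theorem card_eval_zero_le {ι : Type*} (S : Finset ι) (z : ι → K) (hz : Set.InjOn z S)
    (q : Polynomial K) (hq : q ≠ 0) (h : ∀ i ∈ S, q.eval (z i) = 0) : S.card ≤ q.natDegree := by
  classical
  rw [← Finset.card_image_of_injOn hz]
  refine (Finset.card_le_card (t := q.roots.toFinset) ?_).trans
    ((Multiset.toFinset_card_le _).trans (Polynomial.card_roots' _))
  intro r hr
  obtain ⟨j, hj, rfl⟩ := Finset.mem_image.1 hr
  rw [Multiset.mem_toFinset, Polynomial.mem_roots hq]
  exact h j hj

open Classical in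
/-- In a configuration of pairwise skew "red" and "blue" lines whose intersections form a
graph with few neighbours on a common regulus section, some vertex has low degree. -/
theorem exists_low_degree {ι : Type*} {p : ℕ} [CharP K p] (I : Finset ι) (w t z : ι → K)
    (hz : Set.InjOn z I) (adj : ι → ι → Prop)
    (hadj : ∀ i ∈ I, ∀ j ∈ I, adj i j → w i * z j + t i = w j * z i + t j) (k a c : ℕ)
    (hk : ∀ j ∈ I, ∀ κ l : K, #{i ∈ I | adj i j ∧ w i = κ * z i + l} ≤ k)
    (ha : 1 ≤ a) (hI : 6 * a ^ 2 < #I)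
    (hcard : #I * (2 * a + 1) < (a + 1) * ((a + 1) * (c + 1))) (hp : 2 * (a + c) + 1 < p) :
    ∃ j ∈ I, #{i ∈ I | adj i j} ≤ 2 * (a + c) + k := by
  by_contra! hcon
  obtain ⟨P, hP, d0, d1, d2, hred⟩ := exists_red_vanishing I w t z a c hcard
  have heval : ∀ i ∈ I, ∀ j ∈ I, adj i j → ∀ R : MvPolynomial (Fin 3) K,
      (redEval (w i) (t i) (z i) R).eval (z j) = (blueEval (w j) (t j) (z j) R).eval (z i) := by
    intro i hi j hj hij R
    rw [redEval_eval, blueEval_eval, hadj i hi j hj hij]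
  have hblue : ∀ j ∈ I, blueEval (w j) (t j) (z j) P = 0 := by
    intro j hj
    by_contra hne
    have h1 := card_eval_zero_le {i ∈ I | adj i j} z (hz.mono (Finset.filter_subset _ _)) _ hne
      fun i hi => by
        rw [Finset.mem_filter] at hi
        rw [← heval i hi.1 j hj hi.2, hred i hi.1, Polynomial.eval_zero]
    have h2 := natDegree_blueEval_le (w j) (t j) (z j) P
    have h3 := hcon j hj
    omega
  obtain ⟨Q, P', n, hPe, hQP, j, hj, κ, l, hu, hP', hv⟩ :=
    exists_ruled_component (p := p) I w t z hz P hP a c ha d0 d1 d2 hI hp hblue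
  have hP'P : P' ∣ P := ⟨Q ^ n, by rw [hPe]; ring⟩
  have b1 := card_eval_zero_le {i ∈ I | (blueEval (w j) (t j) (z j) (pderiv 0 Q)).eval (z i) = 0} z
    (hz.mono (Finset.filter_subset _ _)) _ hu fun i hi => (Finset.mem_filter.1 hi).2
  have b2 := card_eval_zero_le {i ∈ I | (blueEval (w j) (t j) (z j) P').eval (z i) = 0} z
    (hz.mono (Finset.filter_subset _ _)) _ hP' fun i hi => (Finset.mem_filter.1 hi).2
  have b3 := hk j hj (-κ) (-l)
  have e1 := natDegree_blueEval_le (w j) (t j) (z j) (pderiv 0 Q)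
  have e2 := natDegree_blueEval_le (w j) (t j) (z j) P'
  have f1 := degreeOf_pderiv_le 0 0 Q
  have f2 := degreeOf_pderiv_le 0 2 Q
  have f3 := degreeOf_le_of_dvd 0 hQP hP
  have f4 := degreeOf_le_of_dvd 2 hQP hP
  have f5 := degreeOf_le_of_dvd 0 hP'P hP
  have f6 := degreeOf_le_of_dvd 2 hP'P hP
  have hsub : {i ∈ I | adj i j} ⊆
      {i ∈ I | (blueEval (w j) (t j) (z j) (pderiv 0 Q)).eval (z i) = 0} ∪
      {i ∈ I | (blueEval (w j) (t j) (z j) P').eval (z i) = 0} ∪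
      {i ∈ I | adj i j ∧ w i = -κ * z i + -l} := by
    intro i hi
    rw [Finset.mem_filter] at hi
    obtain ⟨hi, hij⟩ := hi
    simp only [mem_union, mem_filter, hi, hij, true_and]
    by_contra! hne
    obtain ⟨⟨h1, h2⟩, h3⟩ := hne
    have hr : redEval (w i) (t i) (z i) Q ^ n * redEval (w i) (t i) (z i) P' = 0 := by
      rw [← map_pow, ← map_mul, ← hPe, hred i hi]
    rcases mul_eq_zero.1 hr with h4 | h4
    · have h5 : redEval (w i) (t i) (z i) Q = 0 := by
        exact eq_zero_of_pow_eq_zero h4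
      have h6 := derivative_redEval (w i) (t i) (z i) Q
      rw [h5, Polynomial.derivative_zero] at h6
      have h7 := congrArg (Polynomial.eval (z j)) h6
      rw [Polynomial.eval_add, Polynomial.eval_mul, Polynomial.eval_C, Polynomial.eval_zero,
        heval i hi j hj hij, heval i hi j hj hij, hv] at h7
      simp only [Polynomial.eval_mul, Polynomial.eval_add, Polynomial.eval_C,
        Polynomial.eval_X] at h7
      apply h3
      apply mul_right_cancel₀ h1
      linear_combination -h7
    · apply h2
      rw [← heval i hi j hj hij, h4, Polynomial.eval_zero]
  have h1 := hcon j hj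
  have h2 := (Finset.card_le_card hsub).trans ((Finset.card_union_le _ _).trans
    (Nat.add_le_add_right (Finset.card_union_le _ _) _))
  omega

end

section

variable {K : Type*} [Field K]

open Classical in
theorem card_adj_le_of_low_degree {ι : Type*} (I : Finset ι) (adj : ι → ι → Prop)
    (hsymm : ∀ i j, adj i j → adj j i) (M D : ℕ)
    (hlow : ∀ S ⊆ I, S.Nonempty → #S ≤ M → ∃ j ∈ S, #{i ∈ S | adj i j} ≤ D) :
    ∀ S ⊆ I, #S ≤ M → #{x ∈ S ×ˢ S | adj x.1 x.2} ≤ 2 * D * #S := by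
  intro S
  induction S using Finset.strongInduction with
  | H S ih =>
    intro hSI hSM
    rcases S.eq_empty_or_nonempty with rfl | hne
    · simp
    obtain ⟨j, hj, hd⟩ := hlow S hSI hne hSM
    have h1 := ih (S.erase j) (Finset.erase_ssubset hj) ((Finset.erase_subset _ _).trans hSI)
      ((Finset.card_le_card (Finset.erase_subset _ _)).trans hSM)
    have hsub : {x ∈ S ×ˢ S | adj x.1 x.2} ⊆ {x ∈ S.erase j ×ˢ S.erase j | adj x.1 x.2} ∪
        ({i ∈ S | adj i j}.image (fun i => (i, j)) ∪ {i ∈ S | adj i j}.image (fun i => (j, i))) := by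
      rintro ⟨x, y⟩ hxy
      simp only [mem_filter, mem_product, mem_union, mem_image, mem_erase, Prod.mk.injEq] at hxy ⊢
      by_cases hx : x = j
      · subst hx
        exact Or.inr (Or.inr ⟨y, ⟨hxy.1.2, hsymm _ _ hxy.2⟩, rfl, rfl⟩)
      · by_cases hy : y = j
        · subst hy
          exact Or.inr (Or.inl ⟨x, ⟨hxy.1.1, hxy.2⟩, rfl, rfl⟩)
        · exact Or.inl ⟨⟨⟨hx, hxy.1.1⟩, ⟨hy, hxy.1.2⟩⟩, hxy.2⟩
    have h2 := (Finset.card_le_card hsub).trans ((Finset.card_union_le _ _).trans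
      (Nat.add_le_add_left (Finset.card_union_le _ _) _))
    have h3 := Finset.card_image_le (s := {i ∈ S | adj i j}) (f := fun i => (i, j))
    have h4 := Finset.card_image_le (s := {i ∈ S | adj i j}) (f := fun i => (j, i))
    have h5 : #S = #(S.erase j) + 1 := (Finset.card_erase_add_one hj).symm
    rw [h5]
    nlinarith

open Classical in
theorem exists_degree_le_sqrt {ι : Type*} {p : ℕ} [CharP K p] (I : Finset ι) (w t z : ι → K)
    (hz : Set.InjOn z I) (adj : ι → ι → Prop)
    (hadj : ∀ i ∈ I, ∀ j ∈ I, adj i j → w i * z j + t i = w j * z i + t j) (k : ℕ)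
    (hk : ∀ j ∈ I, ∀ κ l : K, #{i ∈ I | adj i j ∧ w i = κ * z i + l} ≤ k)
    (hI : I.Nonempty) (hp : 25 * Nat.sqrt #I < p) :
    ∃ j ∈ I, #{i ∈ I | adj i j} ≤ 24 * Nat.sqrt #I + k := by
  have hpos : 0 < #I := hI.card_pos
  have hs : 1 ≤ Nat.sqrt #I := Nat.sqrt_pos.2 hpos
  by_cases h9 : #I < 9
  · obtain ⟨j, hj⟩ := hI
    refine ⟨j, hj, (Finset.card_filter_le _ _).trans ?_⟩
    omega
  · have hs3 : 3 ≤ Nat.sqrt #I := Nat.le_sqrt.2 (by omega)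
    have hle := Nat.sqrt_le (#I)
    have hlt := Nat.lt_succ_sqrt (#I)
    set s := Nat.sqrt #I
    have ha3 : 3 * (s / 3) ≤ s := Nat.mul_div_le s 3
    have ha4 : s + 1 ≤ 3 * (s / 3 + 1) := by omega
    obtain ⟨j, hj, hd⟩ := exists_low_degree (p := p) I w t z hz adj hadj k (s / 3) (6 * s + 5) hk
      (by omega) (by nlinarith) (by
        have e1 : #I < (s + 1) * (s + 1) := hlt
        have e2 : 2 * ((s + 1) * (s + 1)) ≤ (s / 3 + 1) * (6 * s + 5 + 1) := by nlinarith
        have e3 : 2 * #I ≤ (s / 3 + 1) * (6 * s + 5 + 1) := by omega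
        calc #I * (2 * (s / 3) + 1) < (s / 3 + 1) * (2 * #I) := by nlinarith
          _ ≤ _ := Nat.mul_le_mul_left _ e3) (by omega)
    exact ⟨j, hj, hd.trans (by omega)⟩

open Classical in
theorem card_adj_le {ι : Type*} {p : ℕ} [CharP K p] (I : Finset ι) (w t z : ι → K)
    (hz : Set.InjOn z I) (adj : ι → ι → Prop) (hsymm : ∀ i j, adj i j → adj j i)
    (hadj : ∀ i ∈ I, ∀ j ∈ I, adj i j → w i * z j + t i = w j * z i + t j) (k : ℕ)
    (hk : ∀ j ∈ I, ∀ κ l : K, #{i ∈ I | adj i j ∧ w i = κ * z i + l} ≤ k)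
    (hp : #I ≤ 3 * p ^ 2) :
    #{x ∈ I ×ˢ I | adj x.1 x.2} ≤ 1536000 * #I * (Nat.sqrt #I + k) := by
  rcases Nat.eq_zero_or_pos (#I) with h0 | hpos
  · rw [Finset.card_eq_zero] at h0; subst h0; simp
  have hs : 1 ≤ Nat.sqrt #I := Nat.sqrt_pos.2 hpos
  by_cases hsmall : #I < 8000
  · refine (Finset.card_filter_le _ _).trans ?_
    rw [Finset.card_product]
    nlinarith [Nat.zero_le (#I * k)]
  push Not at hsmall
  have hlow : ∀ S ⊆ I, S.Nonempty → #S ≤ #I / 2000 →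
      ∃ j ∈ S, #{i ∈ S | adj i j} ≤ 24 * Nat.sqrt #I + k := by
    intro S hSI hne hS
    have hle := Nat.sqrt_le (#S)
    obtain ⟨j, hj, hd⟩ := exists_degree_le_sqrt (p := p) S w t z (hz.mono hSI) adj
      (fun i hi j hj => hadj i (hSI hi) j (hSI hj)) k
      (fun j hj κ l => (Finset.card_le_card (Finset.filter_subset_filter _ hSI)).trans
        (hk j (hSI hj) κ l)) hne (by
        have h1 : 2000 * #S ≤ 3 * p ^ 2 := by omega
        have h2 : 1 ≤ #S := hne.card_pos
        by_contra! hcon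
        have h3 : p ^ 2 ≤ (25 * Nat.sqrt #S) ^ 2 := Nat.pow_le_pow_left hcon 2
        nlinarith)
    refine ⟨j, hj, hd.trans ?_⟩
    have := Nat.sqrt_le_sqrt (Finset.card_le_card hSI)
    omega
  have hmain := card_adj_le_of_low_degree I adj hsymm _ _ hlow
  obtain ⟨P, hP, hPn⟩ := Finpartition.exists_equipartition_card_eq I (n := 8000) (by norm_num) hsmall
  have hpart : ∀ A ∈ P.parts, #A ≤ #I / 8000 + 1 := fun A hA => by
    have := hP.card_part_le_average_add_one hA
    rwa [hPn] at this
  have hcover : {x ∈ I ×ˢ I | adj x.1 x.2} ⊆ (P.parts ×ˢ P.parts).biUnion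
      (fun q => {x ∈ (q.1 ∪ q.2) ×ˢ (q.1 ∪ q.2) | adj x.1 x.2}) := by
    rintro ⟨x, y⟩ hxy
    simp only [mem_filter, mem_product, mem_biUnion, mem_union] at hxy ⊢
    obtain ⟨A, hA, hxA⟩ := P.exists_mem hxy.1.1
    obtain ⟨B, hB, hyB⟩ := P.exists_mem hxy.1.2
    exact ⟨(A, B), ⟨hA, hB⟩, ⟨Or.inl hxA, Or.inr hyB⟩, hxy.2⟩
  refine (Finset.card_le_card hcover).trans (Finset.card_biUnion_le.trans ?_)
  have hterm : ∀ q ∈ P.parts ×ˢ P.parts, #{x ∈ (q.1 ∪ q.2) ×ˢ (q.1 ∪ q.2) | adj x.1 x.2} ≤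
      2 * (24 * Nat.sqrt #I + k) * (#I / 2000) := by
    rintro ⟨A, B⟩ hq
    rw [Finset.mem_product] at hq
    have h1 := hpart A hq.1
    have h2 := hpart B hq.2
    have h3 := Finset.card_union_le A B
    have h4 : #(A ∪ B) ≤ #I / 2000 := by omega
    exact (hmain (A ∪ B) (Finset.union_subset (P.le hq.1) (P.le hq.2)) h4).trans
      (Nat.mul_le_mul_left _ h4)
  refine (Finset.sum_le_sum hterm).trans ?_
  rw [Finset.sum_const, Finset.card_product, hPn, smul_eq_mul]
  have h5 : 2000 * (#I / 2000) ≤ #I := Nat.mul_div_le _ _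
  have h6 : 8000 * 8000 * (2 * (24 * Nat.sqrt #I + k) * (#I / 2000)) =
    64000 * (24 * Nat.sqrt #I + k) * (2000 * (#I / 2000)) := by ring
  rw [h6]
  refine (Nat.mul_le_mul_left _ h5).trans ?_
  nlinarith [Nat.zero_le (#I * k)]

/-- Two points that differ in both (isotropic) coordinates. -/
def Noniso (y z : K × K) : Prop := y.1 ≠ z.1 ∧ y.2 ≠ z.2

/-- Slope and intercept of the perpendicular bisector of `y` and `z`, for the form
`(x.1 - y.1) * (x.2 - y.2)`. -/
noncomputable def bis (y z : K × K) : K × K :=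
  (-(y.1 - z.1) / (y.2 - z.2), (y.1 * y.2 - z.1 * z.2) / (y.2 - z.2))

/-- The quadratic form `(x.1 - y.1) * (x.2 - y.2)`. -/
def sep (x y : K × K) : K := (x.1 - y.1) * (x.2 - y.2)

theorem Noniso.symm {y z : K × K} (h : Noniso y z) : Noniso z y := ⟨h.1.symm, h.2.symm⟩

theorem sep_comm (x y : K × K) : sep x y = sep y x := by simp only [sep]; ring

theorem sep_ne_zero_iff (x y : K × K) : sep x y ≠ 0 ↔ Noniso x y := by
  simp [sep, Noniso, sub_eq_zero]

theorem sep_eq_iff_mem_bis {y z : K × K} (h : Noniso y z) (x : K × K) :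
    sep x y = sep x z ↔ x.1 = (bis y z).1 * x.2 + (bis y z).2 := by
  have h2 : y.2 - z.2 ≠ 0 := sub_ne_zero.2 h.2
  simp only [bis, sep]
  rw [div_mul_eq_mul_div, ← add_div, eq_div_iff h2]
  constructor <;> intro h <;> linear_combination -h

theorem bis_comm (y z : K × K) : bis y z = bis z y := by
  simp only [bis]
  have h1 : -(y.1 - z.1) / (y.2 - z.2) = -(z.1 - y.1) / (z.2 - y.2) := by
    rw [← neg_sub z.2, div_neg, ← neg_div]; ring
  have h2 : (y.1 * y.2 - z.1 * z.2) / (y.2 - z.2) = (z.1 * z.2 - y.1 * y.2) / (z.2 - y.2) := by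
    rw [← neg_sub z.2, div_neg, ← neg_div]; ring
  rw [h1, h2]

theorem bis_fst_ne_zero {y z : K × K} (h : Noniso y z) : (bis y z).1 ≠ 0 := by
  simp only [bis]
  exact div_ne_zero (neg_ne_zero.2 (sub_ne_zero.2 h.1)) (sub_ne_zero.2 h.2)

theorem fst_eq_bis {y z : K × K} (h : Noniso y z) : y.1 = (bis y z).1 * z.2 + (bis y z).2 := by
  have h2 : y.2 - z.2 ≠ 0 := sub_ne_zero.2 h.2
  simp only [bis]
  rw [div_mul_eq_mul_div, ← add_div, eq_div_iff h2]
  ring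

theorem fst_eq_bis' {y z : K × K} (h : Noniso y z) : z.1 = (bis y z).1 * y.2 + (bis y z).2 := by
  rw [bis_comm]; exact fst_eq_bis h.symm

/-- A point is determined by its mirror image and the axis. -/
theorem eq_of_bis_eq {y y' z : K × K} (h : Noniso y z) (h' : Noniso y' z)
    (hb : bis y z = bis y' z) : y = y' := by
  have h1 := fst_eq_bis h
  have h2 := fst_eq_bis h'
  have h3 := fst_eq_bis' h
  have h4 := fst_eq_bis' h'
  rw [← hb] at h2 h4
  refine Prod.ext (h1.trans h2.symm) ?_
  have h0 := bis_fst_ne_zero h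
  apply mul_left_cancel₀ h0
  linear_combination h4 - h3

theorem segment_relation {y z y' z' : K × K} (h : Noniso y z) (h' : Noniso y' z')
    (hb : bis y z = bis y' z') :
    sep y' y * (y.1 - z.1) + (y'.1 - y.1) * (z'.1 - z.1) * (y.2 - z.2) = 0 := by
  have h1 := fst_eq_bis h
  have h2 := fst_eq_bis h'
  have h3 := fst_eq_bis' h
  have h4 := fst_eq_bis' h'
  rw [← hb] at h2 h4
  simp only [sep]
  rw [h1, h2, h3, h4]; ring

theorem sep_eq_of_bis_eq {y z y' z' : K × K} (h : Noniso y z) (h' : Noniso y' z')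
    (hb : bis y z = bis y' z') : sep y' y = sep z' z := by
  have h1 := fst_eq_bis h
  have h2 := fst_eq_bis h'
  have h3 := fst_eq_bis' h
  have h4 := fst_eq_bis' h'
  rw [← hb] at h2 h4
  simp only [sep]
  rw [h1, h2, h3, h4]; ring

/-- The curve `A ab + B a + C b + D = 0`. -/
def OnCurve (A B C D : K) (x : K × K) : Prop := A * (x.1 * x.2) + B * x.1 + C * x.2 + D = 0

open Classical in
/-- Pairs of points which are not isotropic and do not lie on a common nondegenerate
`(1,1)`-curve with more than `k` points of `X`. -/
structure GoodRel (X : Finset (K × K)) (k : ℕ) (good : K × K → K × K → Prop) : Prop where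
  symm : ∀ y z, good y z → good z y
  noniso : ∀ y z, good y z → Noniso y z
  curve : ∀ y ∈ X, ∀ z ∈ X, good y z → ∀ A B C D : K, A * D ≠ B * C → OnCurve A B C D y →
    OnCurve A B C D z → #{x ∈ X | OnCurve A B C D x} ≤ k

open Classical in
theorem GoodRel.dichotomy {X : Finset (K × K)} {k : ℕ} {good : K × K → K × K → Prop}
    (hg : GoodRel X k good) {z : K × K} (hz : z ∈ X) (T : Finset (K × K)) (hT : T ⊆ X)
    (hTg : ∀ y ∈ T, good y z) (A B C D : K) (h0 : ¬ (A = 0 ∧ B = 0 ∧ C = 0))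
    (hTc : ∀ y ∈ T, OnCurve A B C D y) (hzc : OnCurve A B C D z) :
    #T ≤ k ∨ (∃ b, ∀ y ∈ T, y.2 = b) ∨ ∃ a, ∀ y ∈ T, y.1 = a := by
  rcases T.eq_empty_or_nonempty with rfl | ⟨y0, hy0⟩
  · simp
  by_cases hdeg : A * D = B * C
  · right
    have hn : ∀ y ∈ T, y.1 - z.1 ≠ 0 ∧ y.2 - z.2 ≠ 0 := fun y hy =>
      ⟨sub_ne_zero.2 (hg.noniso _ _ (hTg y hy)).1, sub_ne_zero.2 (hg.noniso _ _ (hTg y hy)).2⟩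
    simp only [OnCurve] at hTc hzc
    by_cases hA : A = 0
    · subst hA
      have hBC : B * C = 0 := by rw [← hdeg]; ring
      rcases mul_eq_zero.1 hBC with hB | hC
      · subst hB
        have hC : C ≠ 0 := fun hC => h0 ⟨rfl, rfl, hC⟩
        refine absurd ?_ (hn y0 hy0).2
        apply (mul_eq_zero.1 (_ : C * (y0.2 - z.2) = 0)).resolve_left hC
        linear_combination hTc y0 hy0 - hzc
      · subst hC
        have hB : B ≠ 0 := fun hB => h0 ⟨rfl, hB, rfl⟩
        refine absurd ?_ (hn y0 hy0).1
        apply (mul_eq_zero.1 (_ : B * (y0.1 - z.1) = 0)).resolve_left hB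
        linear_combination hTc y0 hy0 - hzc
    · have hz' : (A * z.1 + C) * (A * z.2 + B) = 0 := by linear_combination A * hzc - hdeg
      have hy' : ∀ y ∈ T, (A * y.1 + C) * (A * y.2 + B) = 0 := fun y hy => by
        linear_combination A * hTc y hy - hdeg
      rcases mul_eq_zero.1 hz' with hz1 | hz2
      · left
        refine ⟨-B / A, fun y hy => ?_⟩
        rcases mul_eq_zero.1 (hy' y hy) with h1 | h1
        · exfalso
          apply (hn y hy).1
          apply mul_left_cancel₀ hA
          linear_combination h1 - hz1
        · field_simp
          linear_combination h1
      · right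
        refine ⟨-C / A, fun y hy => ?_⟩
        rcases mul_eq_zero.1 (hy' y hy) with h1 | h1
        · field_simp
          linear_combination h1
        · exfalso
          apply (hn y hy).2
          apply mul_left_cancel₀ hA
          linear_combination h1 - hz2
  · left
    refine (Finset.card_le_card fun y hy => ?_).trans
      (hg.curve y0 (hT hy0) z hz (hTg y0 hy0) A B C D hdeg (hTc y0 hy0) hzc)
    exact Finset.mem_filter.2 ⟨hT hy, hTc y hy⟩

/-- Two segments interchanged by a reflection, in general position. -/
def SegAdj (good : K × K → K × K → Prop) (i j : (K × K) × (K × K)) : Prop :=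
  good i.1 j.1 ∧ good i.2 j.2 ∧ bis i.1 j.1 = bis i.2 j.2 ∧ Noniso i.2 j.1 ∧ Noniso j.2 i.1

theorem GoodRel.segAdj_symm {X : Finset (K × K)} {k : ℕ} {good : K × K → K × K → Prop}
    (hg : GoodRel X k good) (i j : (K × K) × (K × K)) (h : SegAdj good i j) : SegAdj good j i := by
  obtain ⟨h1, h2, h3, h4, h5⟩ := h
  exact ⟨hg.symm _ _ h1, hg.symm _ _ h2, by rw [bis_comm, h3, bis_comm], h5, h4⟩

open Classical in
theorem GoodRel.card_segAdj_le {X : Finset (K × K)} {k : ℕ} (hk1 : 1 ≤ k)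
    {good : K × K → K × K → Prop} (hg : GoodRel X k good) (r : K) (hr : r ≠ 0)
    (j : (K × K) × (K × K)) (hj1 : j.1 ∈ X) (hj2 : j.2 ∈ X) (hjr : sep j.2 j.1 = r)
    (s v κ l : K) (hv : v ≠ j.1.1) (S : Finset ((K × K) × (K × K))) (hS : S ⊆ X ×ˢ X)
    (hSr : ∀ i ∈ S, sep i.2 i.1 = r) (hSj : ∀ i ∈ S, SegAdj good i j)
    (hSc : ∀ i ∈ S, (i.2.1 - i.1.1) * (1 - κ * (i.1.2 - s)) = l * (i.1.1 - v)) : #S ≤ k := by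
  obtain ⟨⟨a', b'⟩, ⟨c', d'⟩⟩ := j
  simp only at hj1 hj2 hv
  have hr' : (c' - a') * (d' - b') = r := hjr
  have hα' : c' - a' ≠ 0 := by rintro h; rw [h, zero_mul] at hr'; exact hr hr'.symm
  have hrel : ∀ i ∈ S, r * (i.1.1 - a') + (i.2.1 - i.1.1) * (c' - a') * (i.1.2 - b') = 0 := by
    intro i hi
    obtain ⟨h1, h2, h3, -, -⟩ := hSj i hi
    have := segment_relation (hg.noniso _ _ h1) (hg.noniso _ _ h2) h3
    rw [hSr i hi] at this
    exact this
  have hrel2 : ∀ i ∈ S, r * (i.2.1 - c') + (i.2.1 - i.1.1) * (c' - a') * (i.2.2 - d') = 0 := by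
    intro i hi
    obtain ⟨h1, h2, h3, -, -⟩ := hSj i hi
    have := segment_relation (hg.noniso _ _ h2) (hg.noniso _ _ h1) h3.symm
    rw [sep_comm, hSr i hi] at this
    simp only at this
    linear_combination this
  have hsep : ∀ i ∈ S, (i.2.1 - i.1.1) * (i.2.2 - i.1.2) = r := hSr
  have hα : ∀ i ∈ S, i.2.1 - i.1.1 ≠ 0 := fun i hi h => by
    have := hsep i hi; rw [h, zero_mul] at this; exact hr this.symm
  have inj1 : Set.InjOn Prod.fst (S : Set ((K × K) × (K × K))) := by
    intro i hi i' hi' h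
    obtain ⟨h1, h2, h3, -, -⟩ := hSj i hi
    obtain ⟨h1', h2', h3', -, -⟩ := hSj i' hi'
    refine Prod.ext h (eq_of_bis_eq (hg.noniso _ _ h2) (hg.noniso _ _ h2') ?_)
    rw [← h3, ← h3', h]
  have inj2 : Set.InjOn Prod.snd (S : Set ((K × K) × (K × K))) := by
    intro i hi i' hi' h
    obtain ⟨h1, h2, h3, -, -⟩ := hSj i hi
    obtain ⟨h1', h2', h3', -, -⟩ := hSj i' hi'
    refine Prod.ext (eq_of_bis_eq (hg.noniso _ _ h1) (hg.noniso _ _ h1') ?_) h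
    rw [h3, h3', h]
  have D1 := hg.dichotomy hj1 (S.image Prod.fst)
    (fun y hy => by
      obtain ⟨i, hi, rfl⟩ := Finset.mem_image.1 hy
      exact (Finset.mem_product.1 (hS hi)).1)
    (fun y hy => by
      obtain ⟨i, hi, rfl⟩ := Finset.mem_image.1 hy
      exact (hSj i hi).1)
    (r * κ - l * (c' - a')) (-r * (1 + κ * s) + l * (c' - a') * b')
    (-r * a' * κ + l * v * (c' - a')) (r * a' * (1 + κ * s) - l * v * (c' - a') * b')
    (by
      rintro ⟨h1, h2, h3⟩
      have e1 : r * κ * (v - a') = 0 := by linear_combination h3 + v * h1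
      rcases mul_eq_zero.1 e1 with e2 | e2
      · have hκ : κ = 0 := (mul_eq_zero.1 e2).resolve_left hr
        subst hκ
        apply hr
        linear_combination -h2 - b' * h1
      · exact hv (sub_eq_zero.1 e2))
    (fun y hy => by
      obtain ⟨i, hi, rfl⟩ := Finset.mem_image.1 hy
      have e1 := hrel i hi
      have e2 := hSc i hi
      simp only [OnCurve]
      linear_combination -(c' - a') * (i.1.2 - b') * e2 * (-1) - (1 - κ * (i.1.2 - s)) * e1)
    (by simp only [OnCurve]; ring)
  have D2 := hg.dichotomy hj2 (S.image Prod.snd)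
    (fun y hy => by
      obtain ⟨i, hi, rfl⟩ := Finset.mem_image.1 hy
      exact (Finset.mem_product.1 (hS hi)).2)
    (fun y hy => by
      obtain ⟨i, hi, rfl⟩ := Finset.mem_image.1 hy
      exact (hSj i hi).2.1)
    (r * κ - l * (c' - a')) (-r * (1 + l + κ * s) + l * (c' - a') * d')
    (-r * c' * κ + (l * v + κ * r) * (c' - a'))
    (r * c' * (1 + l + κ * s) - (l * v + κ * r) * (c' - a') * d')
    (by
      rintro ⟨h1, h2, h3⟩
      have e1 : r * κ * (v - a') = 0 := by linear_combination h3 + v * h1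
      rcases mul_eq_zero.1 e1 with e2 | e2
      · have hκ : κ = 0 := (mul_eq_zero.1 e2).resolve_left hr
        subst hκ
        have hl : l = 0 := by
          apply (mul_eq_zero.1 (_ : l * (c' - a') = 0)).resolve_right hα'
          linear_combination -h1
        subst hl
        apply hr
        linear_combination -h2
      · exact hv (sub_eq_zero.1 e2))
    (fun y hy => by
      obtain ⟨i, hi, rfl⟩ := Finset.mem_image.1 hy
      have e1 := hrel2 i hi
      have e2 := hSc i hi
      have e3 := hsep i hi
      have e4 : (i.2.1 - i.1.1) * (1 + l - κ * (i.2.2 - s)) = l * (i.2.1 - v) - κ * r := by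
        linear_combination e2 - κ * e3
      simp only [OnCurve]
      linear_combination (c' - a') * (i.2.2 - d') * e4 - (1 + l - κ * (i.2.2 - s)) * e1)
    (by simp only [OnCurve]; ring)
  rw [Finset.card_image_of_injOn inj1] at D1
  rw [Finset.card_image_of_injOn inj2] at D2
  have key : (∀ i ∈ S, ∀ i' ∈ S, i.1.1 = i'.1.1 ∧ i.1.2 = i'.1.2) → #S ≤ k := fun h =>
    (Finset.card_le_one.2 fun i hi i' hi' =>
      inj1 hi hi' (Prod.ext (h i hi i' hi').1 (h i hi i' hi').2)).trans hk1
  rcases D1 with D1 | ⟨b, hb⟩ | ⟨a, ha⟩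
  · exact D1
  · have hb' : ∀ i ∈ S, i.1.2 = b := fun i hi => hb _ (Finset.mem_image_of_mem _ hi)
    rcases D2 with D2 | ⟨d, hd⟩ | ⟨c, hc⟩
    · exact D2
    · have hd' : ∀ i ∈ S, i.2.2 = d := fun i hi => hd _ (Finset.mem_image_of_mem _ hi)
      refine key fun i hi i' hi' => ⟨?_, (hb' i hi).trans (hb' i' hi').symm⟩
      have e1 := hrel i hi
      have e2 := hrel i' hi'
      have e3 := hsep i hi
      have e4 := hsep i' hi'
      rw [hb' i hi] at e1
      rw [hb' i' hi'] at e2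
      rw [hb' i hi, hd' i hi] at e3
      rw [hb' i' hi', hd' i' hi'] at e4
      have hdb : d - b ≠ 0 := by intro h; rw [h, mul_zero] at e3; exact hr e3.symm
      have e5 : i.2.1 - i.1.1 = i'.2.1 - i'.1.1 := by
        apply mul_right_cancel₀ hdb; rw [e3, e4]
      apply mul_left_cancel₀ hr
      linear_combination e1 - e2 - (c' - a') * (b - b') * e5
    · have hc' : ∀ i ∈ S, i.2.1 = c := fun i hi => hc _ (Finset.mem_image_of_mem _ hi)
      refine key fun i hi i' hi' => ⟨?_, (hb' i hi).trans (hb' i' hi').symm⟩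
      have e1 := hrel i hi
      have e2 := hrel i' hi'
      rw [hb' i hi, hc' i hi] at e1
      rw [hb' i' hi', hc' i' hi'] at e2
      by_cases hz : r - (c' - a') * (b - b') = 0
      · exfalso
        have hn := (hSj i hi).2.2.2.1.1
        rw [hc' i hi] at hn
        apply hn
        apply mul_left_cancel₀ hr
        simp only
        linear_combination e1 + (c - i.1.1) * hz
      · apply mul_left_cancel₀ hz
        linear_combination e1 - e2
  · have ha' : ∀ i ∈ S, i.1.1 = a := fun i hi => ha _ (Finset.mem_image_of_mem _ hi)
    rcases D2 with D2 | ⟨d, hd⟩ | ⟨c, hc⟩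
    · exact D2
    · have hd' : ∀ i ∈ S, i.2.2 = d := fun i hi => hd _ (Finset.mem_image_of_mem _ hi)
      refine key fun i hi i' hi' => ⟨(ha' i hi).trans (ha' i' hi').symm, ?_⟩
      have lin : ∀ i ∈ S, (a - a') * (d - i.1.2) + (c' - a') * (i.1.2 - b') = 0 := by
        intro i hi
        have e1 := hrel i hi
        have e3 := hsep i hi
        rw [ha' i hi] at e1 e3
        rw [hd' i hi] at e3
        have h0 := hα i hi
        rw [ha' i hi] at h0
        apply (mul_eq_zero.1 (_ : (i.2.1 - a) * _ = 0)).resolve_left h0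
        linear_combination e1 + (a - a') * e3
      have e1 := lin i hi
      have e2 := lin i' hi'
      by_cases hz : (c' - a') - (a - a') = 0
      · exfalso
        have hn := (hSj i hi).2.2.2.1.2
        rw [hd' i hi] at hn
        apply hn
        apply mul_left_cancel₀ hα'
        simp only
        linear_combination e1 + (d - i.1.2) * hz
      · apply mul_left_cancel₀ hz
        linear_combination e1 - e2
    · have hc' : ∀ i ∈ S, i.2.1 = c := fun i hi => hc _ (Finset.mem_image_of_mem _ hi)
      refine key fun i hi i' hi' => ⟨(ha' i hi).trans (ha' i' hi').symm, ?_⟩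
      have e1 := hrel i hi
      have e2 := hrel i' hi'
      have h0 := hα i hi
      rw [ha' i hi, hc' i hi] at e1 h0
      rw [ha' i' hi', hc' i' hi'] at e2
      apply mul_left_cancel₀ (mul_ne_zero h0 hα')
      linear_combination e1 - e2

open Classical in
theorem GoodRel.card_segAdj_pairs_le [Infinite K] {p : ℕ} [CharP K p] {X : Finset (K × K)} {k : ℕ}
    (hk1 : 1 ≤ k) {good : K × K → K × K → Prop} (hg : GoodRel X k good) (r : K) (hr : r ≠ 0)
    (I : Finset ((K × K) × (K × K))) (hI : I ⊆ X ×ˢ X) (hIr : ∀ i ∈ I, sep i.2 i.1 = r)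
    (hp : #I ≤ 3 * p ^ 2) :
    #{x ∈ I ×ˢ I | SegAdj good x.1 x.2} ≤ 1536000 * #I * (Nat.sqrt #I + k) := by
  obtain ⟨v, hv⟩ := Infinite.exists_notMem_finset
    (I.image (fun i => i.1.1) ∪ (I ×ˢ I).image (fun q =>
      ((q.1.2.1 - q.1.1.1) * q.2.1.1 - (q.2.2.1 - q.2.1.1) * q.1.1.1) /
        ((q.1.2.1 - q.1.1.1) - (q.2.2.1 - q.2.1.1))))
  obtain ⟨s, hs⟩ := Infinite.exists_notMem_finset
    ((I ×ˢ I).image (fun q =>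
      ((q.1.2.1 - q.1.1.1) * q.1.1.2 * (q.2.1.1 - v) -
        (q.2.2.1 - q.2.1.1) * q.2.1.2 * (q.1.1.1 - v)) /
        ((q.1.2.1 - q.1.1.1) * (q.2.1.1 - v) - (q.2.2.1 - q.2.1.1) * (q.1.1.1 - v))))
  rw [Finset.mem_union, not_or] at hv
  have hv1 : ∀ i ∈ I, i.1.1 - v ≠ 0 := fun i hi h =>
    hv.1 (Finset.mem_image.2 ⟨i, hi, sub_eq_zero.1 h⟩)
  have hα : ∀ i ∈ I, i.2.1 - i.1.1 ≠ 0 := fun i hi h => by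
    have := hIr i hi
    rw [sep, h, zero_mul] at this
    exact hr this.symm
  refine card_adj_le I (fun i => (i.2.1 - i.1.1) / (i.1.1 - v)) (fun i => r / (i.1.1 - v))
    (fun i => (i.2.1 - i.1.1) * (i.1.2 - s) / (i.1.1 - v)) ?_ (SegAdj good) hg.segAdj_symm ?_ k ?_ hp
  · intro i hi j hj h
    have hi : i ∈ I := hi
    have hj : j ∈ I := hj
    have hq : (i, j) ∈ I ×ˢ I := Finset.mem_product.2 ⟨hi, hj⟩
    have hvi := hv1 i hi
    have hvj := hv1 j hj
    simp only at h
    rw [div_eq_div_iff hvi hvj] at h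
    by_cases hD : (i.2.1 - i.1.1) * (j.1.1 - v) - (j.2.1 - j.1.1) * (i.1.1 - v) = 0
    · by_cases hαα : (i.2.1 - i.1.1) - (j.2.1 - j.1.1) = 0
      · have h1 : i.1.1 = j.1.1 := by
          apply mul_left_cancel₀ (hα i hi)
          linear_combination (v - i.1.1) * hαα - hD + (i.1.1 - v) * hαα - (v - i.1.1) * hαα
        have h2 : i.1.2 = j.1.2 := by
          apply mul_right_cancel₀ hvi
          apply mul_left_cancel₀ (hα i hi)
          rw [← h1] at h hαα
          linear_combination h - (j.1.2 - s) * (i.1.1 - v) * hαα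
        have h3 : i.2.1 = j.2.1 := by linear_combination hαα + h1
        have e1 : (i.2.1 - i.1.1) * (i.2.2 - i.1.2) = r := hIr i hi
        have e2 : (j.2.1 - j.1.1) * (j.2.2 - j.1.2) = r := hIr j hj
        have h4 : i.2.2 = j.2.2 := by
          apply mul_left_cancel₀ (hα i hi)
          rw [← h1, ← h2, ← h3] at e2
          linear_combination e1 - e2
        exact Prod.ext (Prod.ext h1 h2) (Prod.ext h3 h4)
      · exfalso
        refine hv.2 (Finset.mem_image.2 ⟨(i, j), hq, ?_⟩)
        simp only
        rw [div_eq_iff hαα]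
        linear_combination hD
    · exfalso
      refine hs (Finset.mem_image.2 ⟨(i, j), hq, ?_⟩)
      simp only
      rw [div_eq_iff hD]
      linear_combination h
  · intro i hi j hj hij
    obtain ⟨h1, h2, h3, -, -⟩ := hij
    have e := segment_relation (hg.noniso _ _ h1) (hg.noniso _ _ h2) h3
    rw [hIr i hi] at e
    have hvi := hv1 i hi
    have hvj := hv1 j hj
    rw [div_mul_div_comm, div_mul_div_comm, div_add_div _ _ (mul_ne_zero hvi hvj) hvi,
      div_add_div _ _ (mul_ne_zero hvj hvi) hvj, div_eq_div_iff (by simp [hvi, hvj]) (by simp [hvi, hvj])]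
    linear_combination (-(i.1.1 - v) ^ 2 * (j.1.1 - v) ^ 2) * e
  · intro j hj κ l
    have hjX := Finset.mem_product.1 (hI hj)
    refine hg.card_segAdj_le hk1 r hr j hjX.1 hjX.2 (hIr j hj) s v κ l
      (sub_ne_zero.1 (hv1 j hj)).symm _ ((Finset.filter_subset _ _).trans hI)
      (fun i hi => hIr i (Finset.mem_filter.1 hi).1) (fun i hi => (Finset.mem_filter.1 hi).2.1) ?_
    intro i hi
    have hi' := Finset.mem_filter.1 hi
    have hvi := hv1 i hi'.1
    have e := hi'.2.2
    field_simp at e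
    linear_combination e

theorem sq_sum_card_le {α β : Type*} [DecidableEq α] [DecidableEq β] (R : Finset β) (f : β → Finset α) (X : Finset α)
    (hf : ∀ b ∈ R, f b ⊆ X) (c : ℕ) (hc : ∀ b ∈ R, ∀ b' ∈ R, b ≠ b' → #(f b ∩ f b') ≤ c) :
    (∑ b ∈ R, #(f b)) ^ 2 ≤ #X * (∑ b ∈ R, #(f b) + c * #R ^ 2) := by
  have h1 : ∑ b ∈ R, #(f b) = ∑ x ∈ X, #{b ∈ R | x ∈ f b} := by
    simp only [Finset.card_filter]
    rw [Finset.sum_comm]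
    refine Finset.sum_congr rfl fun b hb => ?_
    rw [← Finset.card_filter, Finset.filter_mem_eq_inter, Finset.inter_eq_right.2 (hf b hb)]
  have h2 : ∑ x ∈ X, #{b ∈ R | x ∈ f b} ^ 2 ≤ ∑ q ∈ R ×ˢ R, #(f q.1 ∩ f q.2) := by
    have : ∀ x, #{b ∈ R | x ∈ f b} ^ 2 = #{q ∈ R ×ˢ R | x ∈ f q.1 ∩ f q.2} := fun x => by
      rw [sq, ← Finset.card_product, ← Finset.filter_product]
      simp only [Finset.mem_inter]
    rw [Finset.sum_congr rfl fun x _ => this x]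
    simp only [Finset.card_filter]
    rw [Finset.sum_comm]
    refine Finset.sum_le_sum fun q _ => ?_
    rw [← Finset.card_filter]
    exact Finset.card_le_card fun x hx => (Finset.mem_filter.1 hx).2
  have h3 : ∑ q ∈ R ×ˢ R, #(f q.1 ∩ f q.2) ≤ ∑ b ∈ R, #(f b) + c * #R ^ 2 := by
    have : ∀ q ∈ R ×ˢ R, #(f q.1 ∩ f q.2) ≤ (if q.1 = q.2 then #(f q.1) else 0) + c := by
      intro q hq
      rw [Finset.mem_product] at hq
      split_ifs with h
      · rw [h, Finset.inter_self]; omega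
      · simpa using hc _ hq.1 _ hq.2 h
    refine (Finset.sum_le_sum this).trans ?_
    rw [Finset.sum_add_distrib, Finset.sum_product]
    simp [Finset.card_product, sq, mul_comm]
  calc (∑ b ∈ R, #(f b)) ^ 2 = (∑ x ∈ X, #{b ∈ R | x ∈ f b}) ^ 2 := by rw [h1]
    _ ≤ #X * ∑ x ∈ X, #{b ∈ R | x ∈ f b} ^ 2 := sq_sum_le_card_mul_sum_sq
    _ ≤ _ := Nat.mul_le_mul_left _ (h2.trans h3)

theorem OnCurve.denom_ne_zero {A B C D : K} (h : A * D ≠ B * C) {x : K × K}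
    (hx : OnCurve A B C D x) : A * x.2 + B ≠ 0 := by
  intro h0
  have e : OnCurve A B C D x := hx
  simp only [OnCurve] at e
  have e1 : C * x.2 + D = 0 := by linear_combination e - x.1 * h0
  by_cases hA : A = 0
  · subst hA
    apply h
    have : B = 0 := by linear_combination h0
    rw [this]; ring
  · apply h
    apply mul_left_cancel₀ hA
    linear_combination A * A * e1 - A * C * h0

theorem OnCurve.eq_of_snd_eq {A B C D : K} (h : A * D ≠ B * C) {x y : K × K}
    (hx : OnCurve A B C D x) (hy : OnCurve A B C D y) (hxy : x.2 = y.2) : x = y := by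
  refine Prod.ext ?_ hxy
  have h0 := hx.denom_ne_zero h
  apply mul_right_cancel₀ h0
  simp only [OnCurve] at hx hy
  rw [← hxy] at hy
  linear_combination hx - hy

theorem onCurve_swap {A B C D : K} {x : K × K} :
    OnCurve A B C D x ↔ OnCurve A C B D x.swap := by
  simp only [OnCurve, Prod.fst_swap, Prod.snd_swap]
  constructor <;> intro h <;> linear_combination h

theorem OnCurve.eq_of_fst_eq {A B C D : K} (h : A * D ≠ B * C) {x y : K × K}
    (hx : OnCurve A B C D x) (hy : OnCurve A B C D y) (hxy : x.1 = y.1) : x = y :=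
  Prod.swap_injective (OnCurve.eq_of_snd_eq (by rwa [mul_comm C B])
    (onCurve_swap.1 hx) (onCurve_swap.1 hy) hxy)

theorem quadratic_eq_zero {a b c x y z : K} (hxy : x ≠ y) (hxz : x ≠ z) (hyz : y ≠ z)
    (hx : a * x ^ 2 + b * x + c = 0) (hy : a * y ^ 2 + b * y + c = 0)
    (hz : a * z ^ 2 + b * z + c = 0) : a = 0 ∧ b = 0 ∧ c = 0 := by
  have e1 : a * (x + y) + b = 0 := by
    apply mul_left_cancel₀ (sub_ne_zero.2 hxy); linear_combination hx - hy
  have e2 : a * (x + z) + b = 0 := by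
    apply mul_left_cancel₀ (sub_ne_zero.2 hxz); linear_combination hx - hz
  have ha : a = 0 := by
    apply mul_left_cancel₀ (sub_ne_zero.2 hyz); linear_combination e1 - e2
  subst ha
  have hb : b = 0 := by linear_combination e1
  subst hb
  exact ⟨rfl, rfl, by linear_combination hx⟩

/-- Two nondegenerate curves with three common points have proportional equations. -/
theorem curve_rigid {A B C D A' B' C' D' : K} (h : A * D ≠ B * C) (T : Finset (K × K))
    (hT : 2 < #T) (h1 : ∀ x ∈ T, OnCurve A B C D x) (h2 : ∀ x ∈ T, OnCurve A' B' C' D' x) :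
    C * A' = C' * A ∧ C * B' + D * A' = C' * B + D' * A ∧ D * B' = D' * B := by
  obtain ⟨x, y, z, hx, hy, hz, hxy, hxz, hyz⟩ := Finset.two_lt_card_iff.1 hT
  have key : ∀ x ∈ T, (C * A' - C' * A) * x.2 ^ 2 + (C * B' + D * A' - C' * B - D' * A) * x.2 +
      (D * B' - D' * B) = 0 := by
    intro x hx
    have e1 := h1 x hx
    have e2 := h2 x hx
    simp only [OnCurve] at e1 e2
    linear_combination (A' * x.2 + B') * e1 - (A * x.2 + B) * e2
  obtain ⟨e1, e2, e3⟩ := quadratic_eq_zero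
    (fun e => hxy ((h1 x hx).eq_of_snd_eq h (h1 y hy) e))
    (fun e => hxz ((h1 x hx).eq_of_snd_eq h (h1 z hz) e))
    (fun e => hyz ((h1 y hy).eq_of_snd_eq h (h1 z hz) e)) (key x hx) (key y hy) (key z hz)
  exact ⟨by linear_combination e1, by linear_combination e2, by linear_combination e3⟩

theorem OnCurve.of_common {A B C D A' B' C' D' : K} (h : A * D ≠ B * C) (T : Finset (K × K))
    (hT : 2 < #T) (h1 : ∀ x ∈ T, OnCurve A B C D x) (h2 : ∀ x ∈ T, OnCurve A' B' C' D' x)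
    {x : K × K} (hx : OnCurve A B C D x) : OnCurve A' B' C' D' x := by
  obtain ⟨e1, e2, e3⟩ := curve_rigid h T hT h1 h2
  have h0 := hx.denom_ne_zero h
  simp only [OnCurve] at hx ⊢
  apply mul_left_cancel₀ h0
  linear_combination (A' * x.2 + B') * hx - x.2 ^ 2 * e1 - x.2 * e2 - e3

theorem sep_eq_iff_onCurve (x y : K × K) (r : K) :
    sep x y = r ↔ OnCurve 1 (-x.2) (-x.1) (x.1 * x.2 - r) y := by
  simp only [sep, OnCurve]
  constructor <;> intro h <;> linear_combination h

theorem circle_nondeg {x : K × K} {r : K} (hr : r ≠ 0) :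
    1 * (x.1 * x.2 - r) ≠ (-x.2) * (-x.1) := by
  intro h; apply hr; linear_combination -h

/-- A circle of nonzero radius is determined by three of its points. -/
theorem center_unique {x x' : K × K} {r r' : K} (hr : r ≠ 0) (hr' : r' ≠ 0) (T : Finset (K × K))
    (hT : 2 < #T) (h1 : ∀ y ∈ T, sep x y = r) (h2 : ∀ y ∈ T, sep x' y = r') : x = x' := by
  obtain ⟨e1, e2, e3⟩ := curve_rigid (circle_nondeg hr) T hT
    (fun y hy => (sep_eq_iff_onCurve x y r).1 (h1 y hy))
    (fun y hy => (sep_eq_iff_onCurve x' y r').1 (h2 y hy))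
  have f1 : x.1 = x'.1 := by linear_combination -e1
  refine Prod.ext f1 ?_
  rw [← f1] at e2 e3
  have : (x'.2 - x.2) * r' = 0 := by linear_combination e3 + x'.2 * e2
  have := (mul_eq_zero.1 this).resolve_right hr'
  linear_combination -this

open Classical in
/-- The number of pairs of points at a given nonzero distance. -/
theorem card_sep_eq_sq_le (X : Finset (K × K)) {r : K} (hr : r ≠ 0) :
    #{i ∈ X ×ˢ X | sep i.2 i.1 = r} ^ 2 ≤ 5 * #X ^ 3 := by
  have h0 : #{i ∈ X ×ˢ X | sep i.2 i.1 = r} = ∑ y ∈ X, #{z ∈ X | sep y z = r} := by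
    rw [Finset.card_filter, Finset.sum_product_right]
    simp only [← Finset.card_filter]
  have h := sq_sum_card_le X (fun y => {z ∈ X | sep y z = r}) X
    (fun y _ => Finset.filter_subset _ _) 2 (fun y _ z _ hyz => by
      by_contra! hlt
      refine hyz (center_unique hr hr _ hlt (fun w hw => ?_) fun w hw => ?_)
      · exact (Finset.mem_filter.1 (Finset.mem_inter.1 hw).1).2
      · exact (Finset.mem_filter.1 (Finset.mem_inter.1 hw).2).2)
  rw [← h0] at h
  set m := #{i ∈ X ×ˢ X | sep i.2 i.1 = r}
  have h2 : 2 * (#X * m) ≤ #X ^ 2 + m ^ 2 := by nlinarith [two_mul_le_add_sq (#X) m]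
  have h3 : #X ^ 2 ≤ #X ^ 3 := by
    rcases Nat.eq_zero_or_pos #X with h | h
    · rw [h]; norm_num
    · exact Nat.pow_le_pow_right h (by norm_num)
  nlinarith

open Classical in
/-- The intersections of `X` with nondegenerate curves that have more than `k` points. -/
noncomputable def richSets (X : Finset (K × K)) (k : ℕ) : Finset (Finset (K × K)) :=
  {S ∈ X.powerset | k < #S ∧ ∃ A B C D : K, A * D ≠ B * C ∧ S = {x ∈ X | OnCurve A B C D x}}

theorem mem_richSets {X : Finset (K × K)} {k : ℕ} {S : Finset (K × K)} (hS : S ∈ richSets X k) :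
    S ⊆ X ∧ k < #S ∧ ∃ A B C D : K, A * D ≠ B * C ∧ (∀ x ∈ S, OnCurve A B C D x) ∧
      ∀ x ∈ X, OnCurve A B C D x → x ∈ S := by
  classical
  simp only [richSets, Finset.mem_filter, Finset.mem_powerset] at hS
  obtain ⟨h1, h2, A, B, C, D, h3, h4⟩ := hS
  refine ⟨h1, h2, A, B, C, D, h3, fun x hx => ?_, fun x hx hc => ?_⟩
  · rw [h4] at hx
    exact (Finset.mem_filter.1 hx).2
  · rw [h4]
    exact Finset.mem_filter.2 ⟨hx, hc⟩

theorem richSets_eq {X : Finset (K × K)} {k : ℕ} {S S' T : Finset (K × K)}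
    (hS : S ∈ richSets X k) (hS' : S' ∈ richSets X k) (hT : 2 < #T) (h : T ⊆ S) (h' : T ⊆ S') :
    S = S' := by
  obtain ⟨h1, -, A, B, C, D, h3, h4, h5⟩ := mem_richSets hS
  obtain ⟨h1', -, A', B', C', D', h3', h4', h5'⟩ := mem_richSets hS'
  refine Finset.Subset.antisymm (fun x hx => ?_) fun x hx => ?_
  · exact h5' x (h1 hx) ((h4 x hx).of_common h3 T hT (fun y hy => h4 y (h hy))
      fun y hy => h4' y (h' hy))
  · exact h5 x (h1' hx) ((h4' x hx).of_common h3' T hT (fun y hy => h4' y (h' hy))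
      fun y hy => h4 y (h hy))

theorem sum_card_richSets_le (X : Finset (K × K)) {k : ℕ} (hk : 4 * #X ≤ k ^ 2) :
    ∑ S ∈ richSets X k, #S ≤ 2 * #X := by
  classical
  have h := sq_sum_card_le (richSets X k) id X (fun S hS => (mem_richSets hS).1) 2
    (fun S hS S' hS' hne => by
      by_contra! hlt
      exact hne (richSets_eq hS hS' hlt Finset.inter_subset_left Finset.inter_subset_right))
  have h2 : k * #(richSets X k) ≤ ∑ S ∈ richSets X k, #S := by
    rw [mul_comm, ← smul_eq_mul]
    exact Finset.card_nsmul_le_sum _ _ _ fun S hS => (mem_richSets hS).2.1.le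
  simp only [id] at h
  set t := ∑ S ∈ richSets X k, #S
  set M := #(richSets X k)
  have h3 : (k * M) ^ 2 ≤ t ^ 2 := Nat.pow_le_pow_left h2 2
  have h4 : 4 * #X * M ^ 2 ≤ k ^ 2 * M ^ 2 := Nat.mul_le_mul_right _ hk
  have h5 : t * t ≤ 2 * #X * t := by nlinarith
  rcases Nat.eq_zero_or_pos t with h0 | h0
  · rw [h0]; exact Nat.zero_le _
  · exact Nat.le_of_mul_le_mul_right h5 h0

/-- The points `y` and `z` lie on a common rich curve. -/
def RichPair (X : Finset (K × K)) (k : ℕ) (y z : K × K) : Prop :=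
  ∃ S ∈ richSets X k, y ∈ S ∧ z ∈ S

theorem goodRel_not_richPair (X : Finset (K × K)) (k : ℕ) :
    GoodRel X k fun y z => Noniso y z ∧ ¬ RichPair X k y z where
  symm := fun y z h => ⟨h.1.symm, fun ⟨S, hS, h1, h2⟩ => h.2 ⟨S, hS, h2, h1⟩⟩
  noniso := fun y z h => h.1
  curve := fun y hy z hz hg A B C D h hcy hcz => by
    classical
    by_contra! hlt
    refine hg.2 ⟨{x ∈ X | OnCurve A B C D x}, ?_, Finset.mem_filter.2 ⟨hy, hcy⟩,
      Finset.mem_filter.2 ⟨hz, hcz⟩⟩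
    simp only [richSets, Finset.mem_filter, Finset.mem_powerset]
    refine ⟨Finset.filter_subset _ _, ?_, A, B, C, D, h, ?_⟩
    · convert hlt
    · congr

open Classical in
theorem card_isosceles_richSet_apex_le {X : Finset (K × K)} {k : ℕ} {S : Finset (K × K)}
    (hS : S ∈ richSets X k) (x : K × K)
    (hx : ¬ ∃ r : K, r ≠ 0 ∧ ∀ w ∈ S, sep x w = r) :
    #{q ∈ S ×ˢ S | Noniso q.1 q.2 ∧ sep x q.1 = sep x q.2} ≤ 2 * #S := by
  obtain ⟨h1, -, A, B, C, D, h3, h4, h5⟩ := mem_richSets hS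
  rw [Finset.card_filter, Finset.sum_product, mul_comm, ← smul_eq_mul]
  refine Finset.sum_le_card_nsmul _ _ _ fun y hy => ?_
  simp only
  rw [← Finset.card_filter]
  by_cases hr : sep x y = 0
  · have : {z ∈ S | Noniso y z ∧ sep x y = sep x z} ⊆
        {z ∈ S | z.1 = x.1} ∪ {z ∈ S | z.2 = x.2} := by
      intro z hz
      obtain ⟨hzS, -, hz⟩ := Finset.mem_filter.1 hz
      rw [hr, eq_comm, sep, mul_eq_zero, sub_eq_zero, sub_eq_zero] at hz
      simp only [Finset.mem_union, Finset.mem_filter]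
      rcases hz with hz | hz
      · exact Or.inl ⟨hzS, hz.symm⟩
      · exact Or.inr ⟨hzS, hz.symm⟩
    refine (Finset.card_le_card this).trans ((Finset.card_union_le _ _).trans ?_)
    have e1 : #{z ∈ S | z.1 = x.1} ≤ 1 := Finset.card_le_one.2 fun z hz z' hz' => by
      rw [Finset.mem_filter] at hz hz'
      exact (h4 z hz.1).eq_of_fst_eq h3 (h4 z' hz'.1) (hz.2.trans hz'.2.symm)
    have e2 : #{z ∈ S | z.2 = x.2} ≤ 1 := Finset.card_le_one.2 fun z hz z' hz' => by
      rw [Finset.mem_filter] at hz hz'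
      exact (h4 z hz.1).eq_of_snd_eq h3 (h4 z' hz'.1) (hz.2.trans hz'.2.symm)
    omega
  · by_contra! hlt
    refine hx ⟨_, hr, fun w hw => ?_⟩
    refine (sep_eq_iff_onCurve _ _ _).2 ((h4 w hw).of_common h3 _ hlt (fun z hz => ?_) fun z hz => ?_)
    · exact h4 z (Finset.mem_filter.1 hz).1
    · exact (sep_eq_iff_onCurve _ _ _).1 (Finset.mem_filter.1 hz).2.2.symm

open Classical in
theorem card_isosceles_richSet_le {X : Finset (K × K)} {k : ℕ} (hk : 2 ≤ k)
    {S : Finset (K × K)} (hS : S ∈ richSets X k) :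
    #{t ∈ X ×ˢ S ×ˢ S | Noniso t.2.1 t.2.2 ∧ sep t.1 t.2.1 = sep t.1 t.2.2} ≤ 3 * #X * #S := by
  have hS' := mem_richSets hS
  rw [Finset.card_filter, Finset.sum_product]
  have h1 : ∀ x ∈ X, (∑ q ∈ S ×ˢ S, if Noniso q.1 q.2 ∧ sep x q.1 = sep x q.2 then 1 else 0) ≤
      2 * #S + if ∃ r : K, r ≠ 0 ∧ ∀ w ∈ S, sep x w = r then #S ^ 2 else 0 := by
    intro x _
    rw [← Finset.card_filter]
    split_ifs with h
    · refine (Finset.card_filter_le _ _).trans ?_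
      rw [Finset.card_product, sq]
      omega
    · exact card_isosceles_richSet_apex_le hS x h
  refine (Finset.sum_le_sum h1).trans ?_
  rw [Finset.sum_add_distrib, ← Finset.sum_filter]
  simp only [Finset.sum_const, smul_eq_mul]
  have h2 : #{x ∈ X | ∃ r : K, r ≠ 0 ∧ ∀ w ∈ S, sep x w = r} ≤ 1 :=
    Finset.card_le_one.2 fun x hx x' hx' => by
      obtain ⟨-, r, hr, h⟩ := Finset.mem_filter.1 hx
      obtain ⟨-, r', hr', h'⟩ := Finset.mem_filter.1 hx'
      exact center_unique hr hr' S (lt_of_le_of_lt hk hS'.2.1) h h'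
  have h3 : #S ≤ #X := Finset.card_le_card hS'.1
  nlinarith [Nat.mul_le_mul_right (#S ^ 2) h2, Nat.mul_le_mul_right #S h3]

open Classical in
/-- Few isosceles triangles have their base on a rich curve. -/
theorem card_isosceles_richPair_le (X : Finset (K × K)) {k : ℕ} (hk2 : 2 ≤ k)
    (hk : 4 * #X ≤ k ^ 2) :
    #{t ∈ X ×ˢ X ×ˢ X | RichPair X k t.2.1 t.2.2 ∧ Noniso t.2.1 t.2.2 ∧
      sep t.1 t.2.1 = sep t.1 t.2.2} ≤ 6 * #X ^ 2 := by
  have h : {t ∈ X ×ˢ X ×ˢ X | RichPair X k t.2.1 t.2.2 ∧ Noniso t.2.1 t.2.2 ∧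
      sep t.1 t.2.1 = sep t.1 t.2.2} ⊆ (richSets X k).biUnion fun S =>
        {t ∈ X ×ˢ S ×ˢ S | Noniso t.2.1 t.2.2 ∧ sep t.1 t.2.1 = sep t.1 t.2.2} := by
    intro t ht
    obtain ⟨ht, ⟨S, hS, h1, h2⟩, h3⟩ := Finset.mem_filter.1 ht
    rw [Finset.mem_product] at ht
    exact Finset.mem_biUnion.2 ⟨S, hS, Finset.mem_filter.2 ⟨Finset.mem_product.2
      ⟨ht.1, Finset.mem_product.2 ⟨h1, h2⟩⟩, h3⟩⟩
  refine (Finset.card_le_card h).trans (Finset.card_biUnion_le.trans ?_)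
  refine (Finset.sum_le_sum fun S hS => card_isosceles_richSet_le hk2 hS).trans ?_
  rw [← Finset.mul_sum]
  have := sum_card_richSets_le X hk
  nlinarith [Nat.mul_le_mul_left (3 * #X) this]

open Classical in
/-- Isosceles triangles `(x, y, z)` with apex `x` whose base is not isotropic. -/
noncomputable def triangles (X : Finset (K × K)) : Finset ((K × K) × (K × K) × (K × K)) :=
  {t ∈ X ×ˢ X ×ˢ X | Noniso t.2.1 t.2.2 ∧ sep t.1 t.2.1 = sep t.1 t.2.2}

open Classical in
theorem sum_card_sep_sq_le (X : Finset (K × K)) (R : Finset K) (hR : ∀ r ∈ R, r ≠ 0) :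
    ∑ r ∈ R, #{i ∈ X ×ˢ X | sep i.2 i.1 = r} ^ 2 ≤ #X * (#(triangles X) + #X ^ 2) := by
  have h1 : ∀ r ∈ R, #{i ∈ X ×ˢ X | sep i.2 i.1 = r} ^ 2 ≤
      #X * #{t ∈ X ×ˢ X ×ˢ X | sep t.1 t.2.1 = r ∧ sep t.1 t.2.2 = r} := by
    intro r _
    have h0 : #{i ∈ X ×ˢ X | sep i.2 i.1 = r} = ∑ y ∈ X, #{z ∈ X | sep y z = r} := by
      rw [Finset.card_filter, Finset.sum_product_right]
      simp only [← Finset.card_filter]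
    have h2 : #{t ∈ X ×ˢ X ×ˢ X | sep t.1 t.2.1 = r ∧ sep t.1 t.2.2 = r} =
        ∑ y ∈ X, #{z ∈ X | sep y z = r} ^ 2 := by
      rw [Finset.card_filter, Finset.sum_product]
      refine Finset.sum_congr rfl fun y _ => ?_
      rw [sq, ← Finset.card_product, ← Finset.filter_product, Finset.card_filter]
    rw [h0, h2]
    exact sq_sum_le_card_mul_sum_sq
  refine (Finset.sum_le_sum h1).trans ?_
  rw [← Finset.mul_sum]
  refine Nat.mul_le_mul_left _ ?_
  rw [← Finset.card_biUnion]
  · have : (R.biUnion fun r => {t ∈ X ×ˢ X ×ˢ X | sep t.1 t.2.1 = r ∧ sep t.1 t.2.2 = r}) ⊆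
        triangles X ∪ (X ×ˢ X).image fun q => (q.1, q.2, q.2) := by
      intro t ht
      obtain ⟨r, hr, ht⟩ := Finset.mem_biUnion.1 ht
      obtain ⟨ht, h1, h2⟩ := Finset.mem_filter.1 ht
      obtain ⟨x, y, z⟩ := t
      simp only at h1 h2
      by_cases hyz : y = z
      · subst hyz
        simp only [Finset.mem_product] at ht
        exact Finset.mem_union_right _ (Finset.mem_image.2
          ⟨(x, y), Finset.mem_product.2 ⟨ht.1, ht.2.1⟩, rfl⟩)
      · refine Finset.mem_union_left _ (Finset.mem_filter.2 ⟨ht, ⟨fun h => hyz ?_, fun h => hyz ?_⟩,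
          h1.trans h2.symm⟩)
        · refine Prod.ext h ?_
          simp only at h
          have h0 : x.1 - y.1 ≠ 0 := fun h0 => hR r hr (by rw [← h1, sep, h0, zero_mul])
          apply mul_left_cancel₀ h0
          simp only [sep] at h1 h2
          rw [← h] at h2
          linear_combination h2 - h1
        · refine Prod.ext ?_ h
          simp only at h
          have h0 : x.2 - y.2 ≠ 0 := fun h0 => hR r hr (by rw [← h1, sep, h0, mul_zero])
          apply mul_right_cancel₀ h0
          simp only [sep] at h1 h2
          rw [← h] at h2
          linear_combination h2 - h1
    refine (Finset.card_le_card this).trans ((Finset.card_union_le _ _).trans ?_)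
    refine Nat.add_le_add_left (Finset.card_image_le.trans ?_) _
    rw [Finset.card_product, sq]
  · intro r _ r' _ hne
    rw [Function.onFun, Finset.disjoint_left]
    intro t ht ht'
    exact hne ((Finset.mem_filter.1 ht).2.1.symm.trans (Finset.mem_filter.1 ht').2.1)

open Classical in
/-- The number of pairs of segments in general position interchanged by a reflection. -/
theorem GoodRel.card_segAdj_total_le [Infinite K] {p : ℕ} [CharP K p] {X : Finset (K × K)} {k : ℕ}
    (hk1 : 1 ≤ k) {good : K × K → K × K → Prop} (hg : GoodRel X k good)
    (hp : #X ^ 3 ≤ p ^ 4) :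
    (#{q ∈ (X ×ˢ X) ×ˢ (X ×ˢ X) | SegAdj good q.1 q.2 ∧ sep q.1.2 q.1.1 ≠ 0} : ℝ) ≤
      1536000 * (√((#X : ℝ) ^ 3 * (#(triangles X) + (#X : ℝ) ^ 2)) + k * (#X : ℝ) ^ 2) := by
  set R : Finset K := ((X ×ˢ X).image fun i => sep i.2 i.1).erase 0 with hRdef
  have hR : ∀ r ∈ R, r ≠ 0 := fun r hr => (Finset.mem_erase.1 hr).1
  set I : K → Finset ((K × K) × (K × K)) := fun r => {i ∈ X ×ˢ X | sep i.2 i.1 = r} with hI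
  have hsub : {q ∈ (X ×ˢ X) ×ˢ (X ×ˢ X) | SegAdj good q.1 q.2 ∧ sep q.1.2 q.1.1 ≠ 0} ⊆
      R.biUnion fun r => {x ∈ I r ×ˢ I r | SegAdj good x.1 x.2} := by
    intro q hq
    obtain ⟨hq, h1, h2⟩ := Finset.mem_filter.1 hq
    obtain ⟨hq1, hq2⟩ := Finset.mem_product.1 hq
    refine Finset.mem_biUnion.2 ⟨sep q.1.2 q.1.1, ?_, ?_⟩
    · rw [hRdef, Finset.mem_erase]
      exact ⟨h2, Finset.mem_image.2 ⟨q.1, hq1, rfl⟩⟩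
    · refine Finset.mem_filter.2 ⟨Finset.mem_product.2 ⟨Finset.mem_filter.2 ⟨hq1, rfl⟩,
        Finset.mem_filter.2 ⟨hq2, ?_⟩⟩, h1⟩
      exact (sep_eq_of_bis_eq (hg.noniso _ _ h1.1) (hg.noniso _ _ h1.2.1) h1.2.2.1).symm
  have hcard : ∀ r ∈ R, #{x ∈ I r ×ˢ I r | SegAdj good x.1 x.2} ≤
      1536000 * #(I r) * (Nat.sqrt #(I r) + k) := by
    intro r hr
    refine hg.card_segAdj_pairs_le (p := p) hk1 r (hR r hr) (I r) (Finset.filter_subset _ _)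
      (fun i hi => (Finset.mem_filter.1 hi).2) ?_
    have := card_sep_eq_sq_le X (hR r hr)
    refine (Nat.pow_le_pow_iff_left two_ne_zero).1 ?_
    calc #(I r) ^ 2 ≤ 5 * #X ^ 3 := this
      _ ≤ 5 * p ^ 4 := Nat.mul_le_mul_left _ hp
      _ ≤ (3 * p ^ 2) ^ 2 := by
        have : (3 * p ^ 2) ^ 2 = 9 * p ^ 4 := by ring
        omega
  have hsum : ∑ r ∈ R, #(I r) ≤ #X ^ 2 := by
    rw [← Finset.card_biUnion]
    · calc _ ≤ #(X ×ˢ X) := Finset.card_le_card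
            (Finset.biUnion_subset.2 fun r _ => Finset.filter_subset _ _)
        _ = #X ^ 2 := by rw [Finset.card_product, sq]
    · intro r _ r' _ hne
      rw [Function.onFun, Finset.disjoint_left]
      intro t ht ht'
      exact hne ((Finset.mem_filter.1 ht).2.symm.trans (Finset.mem_filter.1 ht').2)
  have hsq := sum_card_sep_sq_le X R hR
  have h1 : (#{q ∈ (X ×ˢ X) ×ˢ (X ×ˢ X) | SegAdj good q.1 q.2 ∧ sep q.1.2 q.1.1 ≠ 0} : ℝ) ≤
      1536000 * (∑ r ∈ R, (#(I r) : ℝ) * √(#(I r)) + k * ∑ r ∈ R, (#(I r) : ℝ)) := by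
    have := (Finset.card_le_card hsub).trans (Finset.card_biUnion_le.trans (Finset.sum_le_sum hcard))
    have h2 : (#{q ∈ (X ×ˢ X) ×ˢ (X ×ˢ X) | SegAdj good q.1 q.2 ∧ sep q.1.2 q.1.1 ≠ 0} : ℝ) ≤
        ∑ r ∈ R, (1536000 * (#(I r) : ℝ) * ((Nat.sqrt #(I r) : ℕ) + k)) := by exact_mod_cast this
    refine h2.trans ?_
    rw [Finset.mul_sum, ← Finset.sum_add_distrib, Finset.mul_sum]
    refine Finset.sum_le_sum fun r _ => ?_
    have h3 : ((Nat.sqrt #(I r) : ℕ) : ℝ) ≤ √(#(I r)) := Real.nat_sqrt_le_real_sqrt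
    nlinarith [mul_le_mul_of_nonneg_left h3 (Nat.cast_nonneg (α := ℝ) #(I r))]
  refine h1.trans (mul_le_mul_of_nonneg_left (add_le_add ?_ ?_) (by norm_num))
  · apply Real.le_sqrt_of_sq_le
    have hcs := Finset.sum_mul_sq_le_sq_mul_sq R (fun r => √(#(I r) : ℝ)) (fun r => (#(I r) : ℝ))
    have e1 : ∑ r ∈ R, √(#(I r) : ℝ) ^ 2 = ((∑ r ∈ R, #(I r) : ℕ) : ℝ) := by
      push_cast
      exact Finset.sum_congr rfl fun r _ => Real.sq_sqrt (Nat.cast_nonneg _)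
    have e2 : ∑ r ∈ R, (#(I r) : ℝ) ^ 2 = ((∑ r ∈ R, #(I r) ^ 2 : ℕ) : ℝ) := by push_cast; rfl
    rw [e1, e2] at hcs
    have e3 : ∑ r ∈ R, (#(I r) : ℝ) * √(#(I r)) = ∑ r ∈ R, √(#(I r) : ℝ) * #(I r) :=
      Finset.sum_congr rfl fun r _ => mul_comm _ _
    rw [e3]
    refine hcs.trans ?_
    have := Nat.mul_le_mul hsum hsq
    calc ((∑ r ∈ R, #(I r) : ℕ) : ℝ) * ((∑ r ∈ R, #(I r) ^ 2 : ℕ) : ℝ)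
        ≤ ((#X ^ 2 * (#X * (#(triangles X) + #X ^ 2)) : ℕ) : ℝ) := by exact_mod_cast this
      _ = _ := by push_cast; ring
  · refine mul_le_mul_of_nonneg_left ?_ (Nat.cast_nonneg _)
    exact_mod_cast hsum

open Classical in
/-- Nonisotropic pairs of points of `X` that do not lie on a common rich curve. -/
noncomputable def goodPairs (X : Finset (K × K)) (k : ℕ) : Finset ((K × K) × (K × K)) :=
  {π ∈ X ×ˢ X | Noniso π.1 π.2 ∧ ¬ RichPair X k π.1 π.2}

/-- A vertex of the isotropic rectangle with diagonal `π`. -/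
def corner (π : (K × K) × (K × K)) : K × K := (π.2.1, π.1.2)

/-- The isotropic rectangles spanned by `π` and `π'` have a common vertex off the diagonals. -/
def CornerAdj (π π' : (K × K) × (K × K)) : Prop :=
  corner π = corner π' ∨ corner π = corner π'.swap ∨ corner π.swap = corner π' ∨
    corner π.swap = corner π'.swap

theorem segAdj_of_not_cornerAdj {X : Finset (K × K)} {k : ℕ} {good : K × K → K × K → Prop}
    (hg : GoodRel X k good) {π π' : (K × K) × (K × K)} (h : good π.1 π.2) (h' : good π'.1 π'.2)
    (hb : bis π.1 π.2 = bis π'.1 π'.2) (hc : ¬ CornerAdj π π') :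
    SegAdj good (π.1, π'.1) (π.2, π'.2) ∧ sep π'.1 π.1 ≠ 0 := by
  have hn := hg.noniso _ _ h
  have hn' := hg.noniso _ _ h'
  have e1 := fst_eq_bis hn
  have e2 := fst_eq_bis' hn
  have e1' := fst_eq_bis hn'
  have e2' := fst_eq_bis' hn'
  rw [← hb] at e1' e2'
  have h0 := bis_fst_ne_zero hn
  set m := (bis π.1 π.2).1
  set c := (bis π.1 π.2).2
  have key : ∀ {u v : K}, m * u + c = m * v + c → u = v := fun h =>
    mul_left_cancel₀ h0 (add_right_cancel h)
  simp only [CornerAdj, corner, Prod.mk.injEq, Prod.fst_swap, Prod.snd_swap, not_or, not_and] at hc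
  obtain ⟨c1, c2, c3, c4⟩ := hc
  refine ⟨⟨h, h', hb, ⟨fun e => ?_, fun e => ?_⟩, ⟨fun e => ?_, fun e => ?_⟩⟩,
    (sep_ne_zero_iff _ _).2 ⟨fun e => ?_, fun e => ?_⟩⟩
  · simp only at e
    exact c2 e.symm (key (by rw [← e2, ← e1', e]))
  · simp only at e
    exact c3 (by rw [e1, e2', e]) e.symm
  · simp only at e
    exact c3 e.symm (key (by rw [← e1, ← e2', e]))
  · simp only at e
    exact c2 (by rw [e2, e1', e]) e.symm
  · exact c4 e.symm (key (by rw [← e1, ← e1', e]))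
  · exact c1 (by rw [e2, e2', e]) e.symm

open Classical in
theorem card_bis_eq_not_cornerAdj_le (X : Finset (K × K)) (k : ℕ) :
    #{q ∈ goodPairs X k ×ˢ goodPairs X k | bis q.1.1 q.1.2 = bis q.2.1 q.2.2 ∧
      ¬ CornerAdj q.1 q.2} ≤
    #{q ∈ (X ×ˢ X) ×ˢ (X ×ˢ X) | SegAdj (fun y z => Noniso y z ∧ ¬ RichPair X k y z) q.1 q.2 ∧
      sep q.1.2 q.1.1 ≠ 0} := by
  refine Finset.card_le_card_of_injOn (fun q => ((q.1.1, q.2.1), (q.1.2, q.2.2))) ?_ ?_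
  · intro q hq
    simp only [Finset.coe_filter, Set.mem_ofPred_eq, goodPairs, Finset.mem_product,
      Finset.mem_filter] at hq ⊢
    obtain ⟨⟨⟨h1, h2⟩, ⟨h3, h4⟩⟩, h5, h6⟩ := hq
    exact ⟨⟨⟨h1.1, h3.1⟩, ⟨h1.2, h3.2⟩⟩,
      segAdj_of_not_cornerAdj (goodRel_not_richPair X k) h2 h4 h5 h6⟩
  · rintro ⟨⟨a, b⟩, ⟨c, d⟩⟩ - ⟨⟨a', b'⟩, ⟨c', d'⟩⟩ - h
    simp only [Prod.mk.injEq] at h ⊢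
    tauto

open Classical in
theorem card_bis_eq_cornerAdj_le (X : Finset (K × K)) (k K₀ : ℕ)
    (h1 : ∀ a, #{x ∈ X | x.1 = a} ≤ K₀) (h2 : ∀ b, #{x ∈ X | x.2 = b} ≤ K₀) :
    #{q ∈ goodPairs X k ×ˢ goodPairs X k | bis q.1.1 q.1.2 = bis q.2.1 q.2.2 ∧
      CornerAdj q.1 q.2} ≤ 4 * K₀ * #X ^ 2 := by
  rw [Finset.card_filter, Finset.sum_product]
  have hP : #(goodPairs X k) ≤ #X ^ 2 := by
    rw [sq, ← Finset.card_product]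
    exact Finset.card_filter_le _ _
  have : ∀ π ∈ goodPairs X k, (∑ π' ∈ goodPairs X k,
      if bis π.1 π.2 = bis π'.1 π'.2 ∧ CornerAdj π π' then 1 else 0) ≤ 4 * K₀ := by
    intro π hπ
    rw [← Finset.card_filter]
    have hle : #{π' ∈ goodPairs X k | bis π.1 π.2 = bis π'.1 π'.2 ∧ CornerAdj π π'} ≤
        #({y ∈ X | y.2 = π.1.2} ∪ {y ∈ X | y.1 = π.2.1} ∪
          ({y ∈ X | y.2 = π.2.2} ∪ {y ∈ X | y.1 = π.1.1})) := by
      refine Finset.card_le_card_of_injOn Prod.fst ?_ ?_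
      · intro π' hπ'
        simp only [Finset.coe_filter, Set.mem_ofPred_eq, goodPairs, Finset.mem_product,
          Finset.mem_filter, CornerAdj, corner, Prod.mk.injEq, Prod.fst_swap,
          Prod.snd_swap] at hπ'
        simp only [Finset.coe_union, Finset.coe_filter, Set.mem_union, Set.mem_ofPred_eq]
        obtain ⟨⟨⟨h1, -⟩, -⟩, -, h⟩ := hπ'
        rcases h with h | h | h | h
        · exact Or.inl (Or.inl ⟨h1, h.2.symm⟩)
        · exact Or.inl (Or.inr ⟨h1, h.1.symm⟩)
        · exact Or.inr (Or.inl ⟨h1, h.2.symm⟩)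
        · exact Or.inr (Or.inr ⟨h1, h.1.symm⟩)
      · intro π' hπ' π'' hπ'' h
        simp only [Finset.coe_filter, Set.mem_ofPred_eq, goodPairs, Finset.mem_product,
          Finset.mem_filter] at hπ' hπ''
        refine Prod.ext h (eq_of_bis_eq (z := π'.1) hπ'.1.2.1.symm ?_ ?_)
        · rw [h]; exact hπ''.1.2.1.symm
        · rw [bis_comm, ← hπ'.2.1, hπ''.2.1, h, bis_comm]
    refine hle.trans ((Finset.card_union_le _ _).trans ?_)
    have u1 := Finset.card_union_le {y ∈ X | y.2 = π.1.2} {y ∈ X | y.1 = π.2.1}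
    have u2 := Finset.card_union_le {y ∈ X | y.2 = π.2.2} {y ∈ X | y.1 = π.1.1}
    have := h1 π.2.1
    have := h1 π.1.1
    have := h2 π.2.2
    have := h2 π.1.2
    omega
  refine (Finset.sum_le_card_nsmul _ _ _ this).trans ?_
  rw [smul_eq_mul, mul_comm]
  exact Nat.mul_le_mul_left _ hP

open Classical in
theorem card_triangles_le_rich_add (X : Finset (K × K)) {k : ℕ} (hk2 : 2 ≤ k)
    (hk : 4 * #X ≤ k ^ 2) :
    #(triangles X) ≤ 6 * #X ^ 2 + ∑ π ∈ goodPairs X k, #{x ∈ X | sep x π.1 = sep x π.2} := by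
  have h : triangles X ⊆ {t ∈ X ×ˢ X ×ˢ X | RichPair X k t.2.1 t.2.2 ∧ Noniso t.2.1 t.2.2 ∧
      sep t.1 t.2.1 = sep t.1 t.2.2} ∪ {t ∈ X ×ˢ goodPairs X k | sep t.1 t.2.1 = sep t.1 t.2.2} := by
    intro t ht
    simp only [triangles, goodPairs, Finset.mem_union, Finset.mem_filter, Finset.mem_product] at ht ⊢
    tauto
  refine (Finset.card_le_card h).trans ((Finset.card_union_le _ _).trans
    (Nat.add_le_add (card_isosceles_richPair_le X hk2 hk) ?_))
  rw [Finset.card_filter, Finset.sum_product_right]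
  simp only [Finset.card_filter]
  exact le_rfl

/-- The points of `X` on the line with slope and intercept `l`. -/
noncomputable def onLine [DecidableEq K] (X : Finset (K × K)) (l : K × K) : Finset (K × K) :=
  {x ∈ X | x.1 = l.1 * x.2 + l.2}

open Classical in
theorem sum_card_onLine_sq_le (X : Finset (K × K)) (L : Finset (K × K))
    (hL : ∀ l ∈ L, 2 ≤ #(onLine X l)) : ∑ l ∈ L, #(onLine X l) ^ 2 ≤ 2 * #X ^ 2 := by
  have h1 : ∀ l ∈ L, #(onLine X l) ^ 2 ≤ 2 * #(onLine X l).offDiag := by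
    intro l hl
    have := hL l hl
    rw [Finset.offDiag_card]
    zify [Nat.le_mul_self #(onLine X l)]
    nlinarith
  refine (Finset.sum_le_sum h1).trans ?_
  rw [← Finset.mul_sum, ← Finset.card_biUnion]
  · refine Nat.mul_le_mul_left _ ?_
    rw [sq, ← Finset.card_product]
    refine Finset.card_le_card (Finset.biUnion_subset.2 fun l _ q hq => ?_)
    obtain ⟨h1, h2, -⟩ := Finset.mem_offDiag.1 hq
    exact Finset.mem_product.2 ⟨(Finset.mem_filter.1 h1).1, (Finset.mem_filter.1 h2).1⟩
  · intro l _ l' _ hne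
    rw [Function.onFun, Finset.disjoint_left]
    intro q hq hq'
    obtain ⟨h1, h2, h3⟩ := Finset.mem_offDiag.1 hq
    obtain ⟨h1', h2', -⟩ := Finset.mem_offDiag.1 hq'
    have e1 := (Finset.mem_filter.1 h1).2
    have e2 := (Finset.mem_filter.1 h2).2
    have e1' := (Finset.mem_filter.1 h1').2
    have e2' := (Finset.mem_filter.1 h2').2
    have hq2 : q.1.2 - q.2.2 ≠ 0 := by
      intro h
      have h' := sub_eq_zero.1 h
      exact h3 (Prod.ext (by rw [e1, e2, h']) h')
    have e3 : l.1 = l'.1 := by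
      apply mul_right_cancel₀ hq2
      linear_combination e1' - e2' - e1 + e2
    refine hne (Prod.ext e3 ?_)
    rw [e3] at e1
    linear_combination e1' - e1

open Classical in
theorem card_triangles_le (X : Finset (K × K)) {k K₀ : ℕ} (hk2 : 2 ≤ k) (hk : 4 * #X ≤ k ^ 2)
    (h1 : ∀ a, #{x ∈ X | x.1 = a} ≤ K₀) (h2 : ∀ b, #{x ∈ X | x.2 = b} ≤ K₀) :
    (#(triangles X) : ℝ) ≤ 7 * (#X : ℝ) ^ 2 + √(2 * (#X : ℝ) ^ 2 * (4 * K₀ * (#X : ℝ) ^ 2 +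
      #{q ∈ (X ×ˢ X) ×ˢ (X ×ˢ X) | SegAdj (fun y z => Noniso y z ∧ ¬ RichPair X k y z) q.1 q.2 ∧
      sep q.1.2 q.1.1 ≠ 0})) := by
  set P := goodPairs X k with hP
  set G := #{q ∈ (X ×ˢ X) ×ˢ (X ×ˢ X) |
    SegAdj (fun y z => Noniso y z ∧ ¬ RichPair X k y z) q.1 q.2 ∧ sep q.1.2 q.1.1 ≠ 0}
  set b : (K × K) × (K × K) → K × K := fun π => bis π.1 π.2 with hb
  set L : Finset (K × K) := {l ∈ P.image b | 2 ≤ #(onLine X l)} with hL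
  have hPN : ∀ π ∈ P, Noniso π.1 π.2 := fun π hπ => (Finset.mem_filter.1 hπ).2.1
  have hPc : #P ≤ #X ^ 2 := by
    rw [sq, ← Finset.card_product]
    exact Finset.card_filter_le _ _
  have hB : #{q ∈ P ×ˢ P | b q.1 = b q.2} ≤ 4 * K₀ * #X ^ 2 + G := by
    have : {q ∈ P ×ˢ P | b q.1 = b q.2} ⊆ {q ∈ P ×ˢ P | b q.1 = b q.2 ∧ CornerAdj q.1 q.2} ∪
        {q ∈ P ×ˢ P | b q.1 = b q.2 ∧ ¬ CornerAdj q.1 q.2} := by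
      intro q hq
      simp only [Finset.mem_union, Finset.mem_filter] at hq ⊢
      tauto
    exact (Finset.card_le_card this).trans ((Finset.card_union_le _ _).trans (Nat.add_le_add
      (card_bis_eq_cornerAdj_le X k K₀ h1 h2) (card_bis_eq_not_cornerAdj_le X k)))
  have hn : ∑ l ∈ L, #{π ∈ P | b π = l} ^ 2 ≤ #{q ∈ P ×ˢ P | b q.1 = b q.2} := by
    have : ∀ l ∈ L, #{π ∈ P | b π = l} ^ 2 = #{q ∈ P ×ˢ P | b q.1 = l ∧ b q.2 = l} := by
      intro l _
      rw [sq, ← Finset.card_product, ← Finset.filter_product]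
    rw [Finset.sum_congr rfl this, ← Finset.card_biUnion]
    · refine Finset.card_le_card (Finset.biUnion_subset.2 fun l _ q hq => ?_)
      rw [Finset.mem_filter] at hq ⊢
      exact ⟨hq.1, hq.2.1.trans hq.2.2.symm⟩
    · intro l _ l' _ hne
      rw [Function.onFun, Finset.disjoint_left]
      intro q hq hq'
      exact hne ((Finset.mem_filter.1 hq).2.1.symm.trans (Finset.mem_filter.1 hq').2.1)
  have hsum : ∑ π ∈ P, #{x ∈ X | sep x π.1 = sep x π.2} ≤
      #X ^ 2 + ∑ l ∈ L, #(onLine X l) * #{π ∈ P | b π = l} := by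
    have e : ∀ π ∈ P, #{x ∈ X | sep x π.1 = sep x π.2} ≤
        1 + ∑ l ∈ L, if b π = l then #(onLine X l) else 0 := by
      intro π hπ
      have e1 : {x ∈ X | sep x π.1 = sep x π.2} = onLine X (b π) :=
        Finset.filter_congr fun x _ => sep_eq_iff_mem_bis (hPN π hπ) x
      rw [e1, Finset.sum_ite_eq]
      split_ifs with h
      · omega
      · have : b π ∈ P.image b := Finset.mem_image_of_mem _ hπ
        rw [hL, Finset.mem_filter, not_and] at h
        have := h this
        omega
    refine (Finset.sum_le_sum e).trans ?_
    rw [Finset.sum_add_distrib, Finset.sum_comm, Finset.sum_const, smul_eq_mul, mul_one]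
    refine Nat.add_le_add hPc (Finset.sum_le_sum fun l _ => ?_)
    rw [← Finset.sum_filter, Finset.sum_const, smul_eq_mul, mul_comm]
  have hcs := Finset.sum_mul_sq_le_sq_mul_sq L (fun l => (#(onLine X l) : ℝ))
    (fun l => (#{π ∈ P | b π = l} : ℝ))
  have hi := sum_card_onLine_sq_le X L fun l hl => (Finset.mem_filter.1 hl).2
  have hT := card_triangles_le_rich_add X hk2 hk
  rw [← hP] at hT
  have hfin : ((∑ l ∈ L, #(onLine X l) * #{π ∈ P | b π = l} : ℕ) : ℝ) ≤
      √(2 * (#X : ℝ) ^ 2 * (4 * K₀ * (#X : ℝ) ^ 2 + G)) := by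
    apply Real.le_sqrt_of_sq_le
    push_cast
    refine hcs.trans ?_
    have := Nat.mul_le_mul hi (hn.trans hB)
    exact_mod_cast this
  have h3 : #(triangles X) ≤ 7 * #X ^ 2 + ∑ l ∈ L, #(onLine X l) * #{π ∈ P | b π = l} := by omega
  calc (#(triangles X) : ℝ)
      ≤ ((7 * #X ^ 2 + ∑ l ∈ L, #(onLine X l) * #{π ∈ P | b π = l} : ℕ) : ℝ) := by exact_mod_cast h3
    _ = 7 * (#X : ℝ) ^ 2 + ((∑ l ∈ L, #(onLine X l) * #{π ∈ P | b π = l} : ℕ) : ℝ) := by push_cast; ring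
    _ ≤ _ := by gcongr

theorem mem_triangles {X : Finset (K × K)} {t : (K × K) × (K × K) × (K × K)} :
    t ∈ triangles X ↔ (t.1 ∈ X ∧ t.2.1 ∈ X ∧ t.2.2 ∈ X) ∧ Noniso t.2.1 t.2.2 ∧
      sep t.1 t.2.1 = sep t.1 t.2.2 := by
  classical
  simp only [triangles, Finset.mem_filter, Finset.mem_product]

open Classical in
theorem card_triangles_fst_le (X : Finset (K × K)) (a : K) :
    #{t ∈ triangles X | t.1.1 = a ∨ t.2.1.1 = a ∨ t.2.2.1 = a} ≤ 3 * #X ^ 2 := by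
  have hsub : {t ∈ triangles X | t.1.1 = a ∨ t.2.1.1 = a ∨ t.2.2.1 = a} ⊆
      {t ∈ triangles X | t.1.1 = a} ∪ ({t ∈ triangles X | t.2.1.1 = a ∧ t.1.1 ≠ a} ∪
        {t ∈ triangles X | t.2.2.1 = a ∧ t.1.1 ≠ a}) := by
    intro t ht
    simp only [Finset.mem_union, Finset.mem_filter] at ht ⊢
    tauto
  have e1 : #{t ∈ triangles X | t.1.1 = a} ≤ #(X ×ˢ X) := by
    refine Finset.card_le_card_of_injOn (fun t => t.2) (fun t ht => ?_) fun t ht t' ht' h => ?_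
    · have := mem_triangles.1 (Finset.mem_filter.1 ht).1
      exact Finset.mem_product.2 this.1.2
    · obtain ⟨ht, hta⟩ := Finset.mem_filter.1 ht
      obtain ⟨ht', hta'⟩ := Finset.mem_filter.1 ht'
      have h1 := mem_triangles.1 ht
      have h2 := mem_triangles.1 ht'
      simp only at h
      rw [← h] at h2
      refine Prod.ext (Prod.ext (hta.trans hta'.symm) ?_) h
      have f1 := (sep_eq_iff_mem_bis h1.2.1 _).1 h1.2.2
      have f2 := (sep_eq_iff_mem_bis h1.2.1 _).1 h2.2.2
      apply mul_left_cancel₀ (bis_fst_ne_zero h1.2.1)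
      linear_combination hta - hta' - f1 + f2
  have key : ∀ {x y y' z z' : K × K}, y.1 = y'.1 → x.1 ≠ y.1 → sep x y = sep x z →
      sep x y' = sep x z' → z = z' → y = y' := by
    intro x y y' z z' h1 h2 h3 h4 h5
    subst h5
    rw [← h4] at h3
    refine Prod.ext h1 ?_
    simp only [sep] at h3
    apply mul_left_cancel₀ (sub_ne_zero.2 h2)
    rw [← h1] at h3
    linear_combination -h3
  have e2 : #{t ∈ triangles X | t.2.1.1 = a ∧ t.1.1 ≠ a} ≤ #(X ×ˢ X) := by
    refine Finset.card_le_card_of_injOn (fun t => (t.1, t.2.2)) (fun t ht => ?_)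
      fun t ht t' ht' h => ?_
    · have := mem_triangles.1 (Finset.mem_filter.1 ht).1
      exact Finset.mem_product.2 ⟨this.1.1, this.1.2.2⟩
    · obtain ⟨ht, hta, htb⟩ := Finset.mem_filter.1 ht
      obtain ⟨ht', hta', -⟩ := Finset.mem_filter.1 ht'
      have h1 := (mem_triangles.1 ht).2.2
      have h2 := (mem_triangles.1 ht').2.2
      simp only [Prod.mk.injEq] at h
      rw [← h.1] at h2
      exact Prod.ext h.1 (Prod.ext
        (key (hta.trans hta'.symm) (by rwa [hta]) h1 h2 h.2) h.2)
  have e3 : #{t ∈ triangles X | t.2.2.1 = a ∧ t.1.1 ≠ a} ≤ #(X ×ˢ X) := by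
    refine Finset.card_le_card_of_injOn (fun t => (t.1, t.2.1)) (fun t ht => ?_)
      fun t ht t' ht' h => ?_
    · have := mem_triangles.1 (Finset.mem_filter.1 ht).1
      exact Finset.mem_product.2 ⟨this.1.1, this.1.2.1⟩
    · obtain ⟨ht, hta, htb⟩ := Finset.mem_filter.1 ht
      obtain ⟨ht', hta', -⟩ := Finset.mem_filter.1 ht'
      have h1 := (mem_triangles.1 ht).2.2
      have h2 := (mem_triangles.1 ht').2.2
      simp only [Prod.mk.injEq] at h
      rw [← h.1] at h2
      exact Prod.ext h.1 (Prod.ext h.2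
        (key (hta.trans hta'.symm) (by rwa [hta]) h1.symm h2.symm h.2))
  rw [Finset.card_product, ← sq] at e1 e2 e3
  refine (Finset.card_le_card hsub).trans ((Finset.card_union_le _ _).trans ?_)
  have := Finset.card_union_le {t ∈ triangles X | t.2.1.1 = a ∧ t.1.1 ≠ a}
        {t ∈ triangles X | t.2.2.1 = a ∧ t.1.1 ≠ a}
  omega

theorem sep_swap (x y : K × K) : sep x.swap y.swap = sep x y := by
  simp only [sep, Prod.fst_swap, Prod.snd_swap]; ring

open Classical in
theorem card_triangles_snd_le (X : Finset (K × K)) (b : K) :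
    #{t ∈ triangles X | t.1.2 = b ∨ t.2.1.2 = b ∨ t.2.2.2 = b} ≤ 3 * #X ^ 2 := by
  have h := card_triangles_fst_le (X.image Prod.swap) b
  rw [Finset.card_image_of_injective _ Prod.swap_injective] at h
  refine le_trans (Finset.card_le_card_of_injOn
    (fun t => (t.1.swap, t.2.1.swap, t.2.2.swap)) ?_ ?_) h
  · intro t ht
    obtain ⟨ht, hb⟩ := Finset.mem_filter.1 ht
    obtain ⟨⟨h1, h2, h3⟩, h4, h5⟩ := mem_triangles.1 ht
    exact Finset.mem_filter.2 ⟨mem_triangles.2 ⟨⟨Finset.mem_image_of_mem _ h1,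
      Finset.mem_image_of_mem _ h2, Finset.mem_image_of_mem _ h3⟩, ⟨h4.2, h4.1⟩,
      by rw [sep_swap, sep_swap, h5]⟩, hb⟩
  · intro t _ t' _ h
    simp only [Prod.mk.injEq] at h
    exact Prod.ext (Prod.swap_injective h.1) (Prod.ext (Prod.swap_injective h.2.1)
      (Prod.swap_injective h.2.2))

open Classical in
theorem card_heavy_mul_le {α β : Type*} (X : Finset α) (f : α → β) (K₀ : ℕ) :
    #{a ∈ X.image f | K₀ < #{x ∈ X | f x = a}} * K₀ ≤ #X := by
  rw [Finset.card_eq_sum_card_image f X, ← smul_eq_mul]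
  refine (Finset.card_nsmul_le_sum _ (fun a => #{x ∈ X | f x = a}) _ fun a ha =>
    (Finset.mem_filter.1 ha).2.le).trans ?_
  exact Finset.sum_le_sum_of_subset (Finset.filter_subset _ _)

open Classical in
/-- Removing the points on isotropic lines with many points. -/
theorem exists_prune (X : Finset (K × K)) (K₀ : ℕ) :
    ∃ X' ⊆ X, (∀ a, #{x ∈ X' | x.1 = a} ≤ K₀) ∧ (∀ b, #{x ∈ X' | x.2 = b} ≤ K₀) ∧
      K₀ * #(triangles X) ≤ K₀ * #(triangles X') + 6 * #X ^ 3 := by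
  set A := {a ∈ X.image Prod.fst | K₀ < #{x ∈ X | x.1 = a}} with hA
  set B := {b ∈ X.image Prod.snd | K₀ < #{x ∈ X | x.2 = b}} with hB
  have hAc : #A * K₀ ≤ #X := card_heavy_mul_le X Prod.fst K₀
  have hBc : #B * K₀ ≤ #X := card_heavy_mul_le X Prod.snd K₀
  refine ⟨{x ∈ X | x.1 ∉ A ∧ x.2 ∉ B}, Finset.filter_subset _ _, fun a => ?_, fun b => ?_, ?_⟩
  · rcases Finset.eq_empty_or_nonempty {x ∈ {x ∈ X | x.1 ∉ A ∧ x.2 ∉ B} | x.1 = a} with h | ⟨x, hxa⟩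
    · rw [h]; exact Nat.zero_le _
    · obtain ⟨hx, rfl⟩ := Finset.mem_filter.1 hxa
      obtain ⟨hxX, hx1⟩ := Finset.mem_filter.1 hx
      refine (Finset.card_le_card (Finset.filter_subset_filter _ (Finset.filter_subset _ _))).trans ?_
      by_contra! hlt
      exact hx1.1 (Finset.mem_filter.2 ⟨Finset.mem_image_of_mem _ hxX, hlt⟩)
  · rcases Finset.eq_empty_or_nonempty {x ∈ {x ∈ X | x.1 ∉ A ∧ x.2 ∉ B} | x.2 = b} with h | ⟨x, hxa⟩
    · rw [h]; exact Nat.zero_le _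
    · obtain ⟨hx, rfl⟩ := Finset.mem_filter.1 hxa
      obtain ⟨hxX, hx1⟩ := Finset.mem_filter.1 hx
      refine (Finset.card_le_card (Finset.filter_subset_filter _ (Finset.filter_subset _ _))).trans ?_
      by_contra! hlt
      exact hx1.2 (Finset.mem_filter.2 ⟨Finset.mem_image_of_mem _ hxX, hlt⟩)
  · set X' := {x ∈ X | x.1 ∉ A ∧ x.2 ∉ B} with hX'
    have hsub : triangles X ⊆ triangles X' ∪
        (A.biUnion (fun a => {t ∈ triangles X | t.1.1 = a ∨ t.2.1.1 = a ∨ t.2.2.1 = a}) ∪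
        B.biUnion fun b => {t ∈ triangles X | t.1.2 = b ∨ t.2.1.2 = b ∨ t.2.2.2 = b}) := by
      intro t ht
      have ht' := mem_triangles.1 ht
      by_contra h
      simp only [Finset.mem_union, Finset.mem_biUnion, Finset.mem_filter, not_or, not_exists,
        not_and] at h
      obtain ⟨h1, h2, h3⟩ := h
      have h2' : ∀ a ∈ A, t.1.1 ≠ a ∧ t.2.1.1 ≠ a ∧ t.2.2.1 ≠ a := fun a ha =>
        have := h2 a ha ht
        ⟨fun h => this.1 h, fun h => this.2.1 h, fun h => this.2.2 h⟩
      have h3' : ∀ b ∈ B, t.1.2 ≠ b ∧ t.2.1.2 ≠ b ∧ t.2.2.2 ≠ b := fun b hb =>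
        have := h3 b hb ht
        ⟨fun h => this.1 h, fun h => this.2.1 h, fun h => this.2.2 h⟩
      refine h1 (mem_triangles.2 ⟨⟨?_, ?_, ?_⟩, ht'.2⟩)
      · exact Finset.mem_filter.2 ⟨ht'.1.1, fun h => (h2' _ h).1 rfl, fun h => (h3' _ h).1 rfl⟩
      · exact Finset.mem_filter.2 ⟨ht'.1.2.1, fun h => (h2' _ h).2.1 rfl, fun h => (h3' _ h).2.1 rfl⟩
      · exact Finset.mem_filter.2 ⟨ht'.1.2.2, fun h => (h2' _ h).2.2 rfl, fun h => (h3' _ h).2.2 rfl⟩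
    have hc := (Finset.card_le_card hsub).trans ((Finset.card_union_le _ _).trans
      (Nat.add_le_add_left (Finset.card_union_le _ _) _))
    have c1 := Finset.card_biUnion_le_card_mul A _ _ fun a _ => card_triangles_fst_le X a
    have c2 := Finset.card_biUnion_le_card_mul B _ _ fun b _ => card_triangles_snd_le X b
    have hfin : #(triangles X) ≤ #(triangles X') + (#A * (3 * #X ^ 2) + #B * (3 * #X ^ 2)) :=
      hc.trans (Nat.add_le_add_left (Nat.add_le_add c1 c2) _)
    calc K₀ * #(triangles X)
        ≤ K₀ * (#(triangles X') + (#A * (3 * #X ^ 2) + #B * (3 * #X ^ 2))) :=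
          Nat.mul_le_mul_left _ hfin
      _ = K₀ * #(triangles X') + (#A * K₀ + #B * K₀) * (3 * #X ^ 2) := by ring
      _ ≤ K₀ * #(triangles X') + (#X + #X) * (3 * #X ^ 2) := by gcongr
      _ = K₀ * #(triangles X') + 6 * #X ^ 3 := by ring

theorem le_of_isosceles_recursion {u T G K₀ k : ℝ} (hu : 1 ≤ u) (hT0 : 0 ≤ T)
    (hT : T ≤ 7 * (u ^ 12) ^ 2 + √(2 * (u ^ 12) ^ 2 * (4 * K₀ * (u ^ 12) ^ 2 + G)))
    (hG : G ≤ 1536000 * (√((u ^ 12) ^ 3 * (T + (u ^ 12) ^ 2)) + k * (u ^ 12) ^ 2))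
    (hk : k ≤ 4 * u ^ 6) (hK : K₀ ≤ 2 * u ^ 8) : T ≤ 10 ^ 7 * u ^ 28 := by
  have hu0 : 0 ≤ u := by linarith
  have h24 : u ^ 24 ≤ u ^ 28 := pow_le_pow_right₀ hu (by norm_num)
  have h30 : u ^ 30 ≤ u ^ 32 := pow_le_pow_right₀ hu (by norm_num)
  have h28 : 0 ≤ u ^ 28 := by positivity
  have hsq : √((u ^ 12) ^ 3 * (T + (u ^ 12) ^ 2)) ≤ u ^ 4 * (T + u ^ 28) := by
    apply Real.sqrt_le_iff.2 ⟨by positivity, ?_⟩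
    calc (u ^ 12) ^ 3 * (T + (u ^ 12) ^ 2) ≤ u ^ 36 * (T + u ^ 28) := by
          rw [← pow_mul, ← pow_mul]; gcongr
      _ = u ^ 8 * u ^ 28 * (T + u ^ 28) := by ring
      _ ≤ u ^ 8 * (T + u ^ 28) * (T + u ^ 28) := by gcongr; linarith
      _ = (u ^ 4 * (T + u ^ 28)) ^ 2 := by ring
  have hk' : k * (u ^ 12) ^ 2 ≤ 4 * u ^ 32 := by
    calc k * (u ^ 12) ^ 2 ≤ (4 * u ^ 6) * (u ^ 12) ^ 2 := by gcongr
      _ = 4 * u ^ 30 := by ring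
      _ ≤ _ := by linarith
  have hK' : 4 * K₀ * (u ^ 12) ^ 2 ≤ 8 * u ^ 32 := by
    calc 4 * K₀ * (u ^ 12) ^ 2 ≤ 4 * (2 * u ^ 8) * (u ^ 12) ^ 2 := by gcongr
      _ = 8 * u ^ 32 := by ring
  have hin : 4 * K₀ * (u ^ 12) ^ 2 + G ≤ u ^ 4 * (1536000 * T + 8000000 * u ^ 28) := by
    have : u ^ 4 * u ^ 28 = u ^ 32 := by ring
    nlinarith
  have hs : √(2 * (u ^ 12) ^ 2 * (4 * K₀ * (u ^ 12) ^ 2 + G)) ≤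
      √(u ^ 28 * (3072000 * T + 16000000 * u ^ 28)) := by
    apply Real.sqrt_le_sqrt
    calc 2 * (u ^ 12) ^ 2 * (4 * K₀ * (u ^ 12) ^ 2 + G)
        ≤ 2 * (u ^ 12) ^ 2 * (u ^ 4 * (1536000 * T + 8000000 * u ^ 28)) := by gcongr
      _ = _ := by ring
  by_contra! hlt
  have h1 : u ^ 28 * (3072000 * T + 16000000 * u ^ 28) ≤ (0.6 * T) ^ 2 := by nlinarith
  have h2 := Real.sqrt_le_iff.2 ⟨by positivity, h1⟩
  have h3 : (u ^ 12) ^ 2 ≤ u ^ 28 := by rw [← pow_mul]; exact h24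
  linarith

theorem rich_threshold (N : ℕ) : 2 ≤ 2 * (Nat.sqrt N + 1) ∧ 4 * N ≤ (2 * (Nat.sqrt N + 1)) ^ 2 := by
  refine ⟨by omega, ?_⟩
  have := Nat.lt_succ_sqrt N
  have : N ≤ (Nat.sqrt N + 1) * (Nat.sqrt N + 1) := this.le
  nlinarith

theorem card_triangles_le_rpow [Infinite K] {p : ℕ} [CharP K p] (X : Finset (K × K))
    (hp : #X ^ 3 ≤ p ^ 4) :
    (#(triangles X) : ℝ) ≤ 2 * 10 ^ 7 * (#X : ℝ) ^ (7 / 3 : ℝ) := by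
  classical
  rcases X.eq_empty_or_nonempty with rfl | hne
  · simp [triangles]
  have hN : (1 : ℝ) ≤ #X := by exact_mod_cast hne.card_pos
  set u : ℝ := (#X : ℝ) ^ (1 / 12 : ℝ) with hu
  have hpow : ∀ n : ℕ, u ^ n = (#X : ℝ) ^ ((n : ℝ) / 12) := fun n => by
    rw [hu, ← Real.rpow_natCast, ← Real.rpow_mul (by positivity)]
    congr 1; ring
  have hu1 : 1 ≤ u := Real.one_le_rpow hN (by norm_num)
  have h12 : u ^ 12 = #X := by rw [hpow]; norm_num
  have h28 : (#X : ℝ) ^ (7 / 3 : ℝ) = u ^ 28 := by rw [hpow]; norm_num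
  have h6 : u ^ 6 = √(#X) := by rw [hpow, Real.sqrt_eq_rpow]; norm_num
  set K₀ := ⌈u ^ 8⌉₊ with hK₀
  have hK1 : u ^ 8 ≤ K₀ := Nat.le_ceil _
  have h8 : 1 ≤ u ^ 8 := one_le_pow₀ hu1
  have hK2 : (K₀ : ℝ) ≤ 2 * u ^ 8 := by
    have := (Nat.ceil_lt_add_one (by positivity : 0 ≤ u ^ 8)).le
    linarith
  obtain ⟨X', hX', hl1, hl2, hpr⟩ := exists_prune X K₀
  have hN' : (#X' : ℝ) ≤ u ^ 12 := by rw [h12]; exact_mod_cast Finset.card_le_card hX'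
  obtain ⟨hk2, hk⟩ := rich_threshold #X'
  set k := 2 * (Nat.sqrt #X' + 1) with hkdef
  have hp' : #X' ^ 3 ≤ p ^ 4 := (Nat.pow_le_pow_left (Finset.card_le_card hX') 3).trans hp
  have hG := GoodRel.card_segAdj_total_le (p := p) (by omega) (goodRel_not_richPair X' k) hp'
  have hT := card_triangles_le X' hk2 hk hl1 hl2
  set G : ℝ := (#{q ∈ (X' ×ˢ X') ×ˢ (X' ×ˢ X') |
    SegAdj (fun y z => Noniso y z ∧ ¬ RichPair X' k y z) q.1 q.2 ∧ sep q.1.2 q.1.1 ≠ 0} : ℝ)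
  have hG0 : 0 ≤ G := Nat.cast_nonneg _
  have hkR : (k : ℝ) ≤ 4 * u ^ 6 := by
    rw [hkdef, h6]
    have h1 : ((Nat.sqrt #X' : ℕ) : ℝ) ≤ √(#X') := Real.nat_sqrt_le_real_sqrt
    have h2 : √(#X' : ℝ) ≤ √(#X) := Real.sqrt_le_sqrt (by rw [← h12]; exact hN')
    have h3 : 1 ≤ √(#X : ℝ) := Real.one_le_sqrt.2 hN
    push_cast
    linarith
  have main : (#(triangles X') : ℝ) ≤ 10 ^ 7 * u ^ 28 := by
    refine le_of_isosceles_recursion (G := G) (K₀ := K₀) (k := k) hu1 (Nat.cast_nonneg _)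
      (hT.trans ?_) (hG.trans ?_) hkR hK2
    · gcongr
    · gcongr
  rw [h28]
  have hprR : (K₀ : ℝ) * #(triangles X) ≤ K₀ * #(triangles X') + 6 * (u ^ 12) ^ 3 := by
    rw [h12]; exact_mod_cast hpr
  have hK0 : (0 : ℝ) < K₀ := by linarith
  have h36 : (u ^ 12) ^ 3 ≤ K₀ * u ^ 28 := by
    calc (u ^ 12) ^ 3 = u ^ 8 * u ^ 28 := by ring
      _ ≤ K₀ * u ^ 28 := by gcongr
  have : (K₀ : ℝ) * #(triangles X) ≤ K₀ * (#(triangles X') + 6 * u ^ 28) := by linarith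
  have := le_of_mul_le_mul_left this hK0
  have : 0 ≤ u ^ 28 := by positivity
  linarith

open Classical in
/-- The points of `V` on the bisector of `π.1` and `π.2` at nonzero distance from both. -/
noncomputable def openBis (V : Finset (K × K)) (π : (K × K) × (K × K)) : Finset (K × K) :=
  {x ∈ V | sep x π.1 = sep x π.2 ∧ sep x π.1 ≠ 0}

theorem openBis_swap (V : Finset (K × K)) (π : (K × K) × (K × K)) :
    openBis V π.swap = openBis V π := by
  classical
  refine Finset.filter_congr fun x _ => ?_
  simp only [Prod.fst_swap, Prod.snd_swap]
  constructor
  · rintro ⟨h1, h2⟩; exact ⟨h1.symm, h1 ▸ h2⟩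
  · rintro ⟨h1, h2⟩; exact ⟨h1.symm, h1 ▸ h2⟩

open Classical in
/-- The balanced indicator function of `openBis V π`. -/
noncomputable def dev (V : Finset (K × K)) (p : ℕ) (π : (K × K) × (K × K)) (x : K × K) : ℝ :=
  (if x ∈ openBis V π then 1 else 0) - 1 / p

/-- Correlation of two balanced indicator functions. -/
noncomputable def corr (V : Finset (K × K)) (p : ℕ) (π π' : (K × K) × (K × K)) : ℝ :=
  ∑ x ∈ V, dev V p π x * dev V p π' x

theorem dev_swap (V : Finset (K × K)) (p : ℕ) (π : (K × K) × (K × K)) (x : K × K) :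
    dev V p π.swap x = dev V p π x := by
  have h := openBis_swap V π
  unfold dev
  rw [h]

theorem corr_swap_left (V : Finset (K × K)) (p : ℕ) (π π' : (K × K) × (K × K)) :
    corr V p π.swap π' = corr V p π π' := by
  simp only [corr, dev_swap]

theorem corr_swap_right (V : Finset (K × K)) (p : ℕ) (π π' : (K × K) × (K × K)) :
    corr V p π π'.swap = corr V p π π' := by
  simp only [corr, dev_swap]

theorem corr_self_nonneg (V : Finset (K × K)) (p : ℕ) (π : (K × K) × (K × K)) :
    0 ≤ corr V p π π := Finset.sum_nonneg fun _ _ => mul_self_nonneg _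

theorem sum_ite_mem_subset {α : Type*} [DecidableEq α] (V S : Finset α) (hS : S ⊆ V) :
    ∑ x ∈ V, (if x ∈ S then (1 : ℝ) else 0) = #S := by
  rw [Finset.sum_ite_mem, Finset.inter_eq_right.2 hS, Finset.sum_const, nsmul_eq_mul, mul_one]

open Classical in
theorem corr_eq {V : Finset (K × K)} {p : ℕ} (hp : 0 < p) (hV : #V = p ^ 2)
    (π π' : (K × K) × (K × K)) :
    corr V p π π' = #(openBis V π ∩ openBis V π') - (#(openBis V π) + #(openBis V π') : ℝ) / p + 1 := by
  have h1 : ∀ x ∈ V, dev V p π x * dev V p π' x =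
      (if x ∈ openBis V π ∩ openBis V π' then 1 else 0) - (if x ∈ openBis V π then 1 else 0) / p -
        (if x ∈ openBis V π' then 1 else 0) / p + 1 / p ^ 2 := by
    intro x _
    simp only [dev, Finset.mem_inter]
    by_cases h1 : x ∈ openBis V π <;> by_cases h2 : x ∈ openBis V π' <;>
      simp only [h1, h2, if_true, if_false, and_true, and_false] <;> ring
  have hs : ∀ π, openBis V π ⊆ V := fun π => Finset.filter_subset _ _
  rw [corr, Finset.sum_congr rfl h1, Finset.sum_add_distrib, Finset.sum_sub_distrib,
    Finset.sum_sub_distrib, ← Finset.sum_div, ← Finset.sum_div, sum_ite_mem_subset V _ (hs π),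
    sum_ite_mem_subset V _ (hs π'), sum_ite_mem_subset V _ (Finset.inter_subset_left.trans (hs π)),
    Finset.sum_const, hV, nsmul_eq_mul]
  have : (p : ℝ) ≠ 0 := by positivity
  push_cast
  field_simp
  ring

open Classical in
theorem corr_le {V : Finset (K × K)} {p : ℕ} (hp : 0 < p) (hV : #V = p ^ 2)
    {π π' : (K × K) × (K × K)} (h : p ≤ #(openBis V π) + 2) (h' : p ≤ #(openBis V π') + 2) :
    corr V p π π' ≤ #(openBis V π ∩ openBis V π') - 1 + 4 / p := by
  rw [corr_eq hp hV]
  have h1 : (p : ℝ) ≤ #(openBis V π) + 2 := by exact_mod_cast h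
  have h2 : (p : ℝ) ≤ #(openBis V π') + 2 := by exact_mod_cast h'
  have h3 : (2 * p - 4 : ℝ) / p ≤ (#(openBis V π) + #(openBis V π') : ℝ) / p := by
    gcongr; linarith
  have : (2 * p - 4 : ℝ) / p = 2 - 4 / p := by
    have : (p : ℝ) ≠ 0 := by positivity
    field_simp
  linarith

open Classical in
theorem card_openBis_inter_le {V : Finset (K × K)} {π π' : (K × K) × (K × K)}
    (h : Noniso π.1 π.2) (h' : Noniso π'.1 π'.2) (hb : bis π.1 π.2 ≠ bis π'.1 π'.2) :
    #(openBis V π ∩ openBis V π') ≤ 1 := by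
  refine Finset.card_le_one.2 fun x hx y hy => ?_
  simp only [openBis, Finset.mem_inter, Finset.mem_filter, sep_eq_iff_mem_bis h,
    sep_eq_iff_mem_bis h'] at hx hy
  obtain ⟨⟨-, e1, -⟩, -, e2, -⟩ := hx
  obtain ⟨⟨-, e3, -⟩, -, e4, -⟩ := hy
  by_contra hne
  have h2 : x.2 - y.2 ≠ 0 := fun h0 => by
    have h0 := sub_eq_zero.1 h0
    exact hne (Prod.ext (by rw [e1, e3, h0]) h0)
  have e5 : (bis π.1 π.2).1 = (bis π'.1 π'.2).1 := by
    apply mul_right_cancel₀ h2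
    linear_combination e2 - e4 - e1 + e3
  refine hb (Prod.ext e5 ?_)
  rw [e5] at e1
  linear_combination e2 - e1

open Classical in
theorem corr_le_of_card_le {V : Finset (K × K)} {p : ℕ} (hp : 0 < p) (hV : #V = p ^ 2)
    {π π' : (K × K) × (K × K)} (hn : Noniso π.1 π.2) (hn' : Noniso π'.1 π'.2)
    (h : p ≤ #(openBis V π) + 2 ∧ #(openBis V π) ≤ p) (h' : p ≤ #(openBis V π') + 2) :
    corr V p π π' ≤ (if bis π.1 π.2 = bis π'.1 π'.2 then (p : ℝ) else 0) + 4 / p := by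
  have h1 := corr_le hp hV h.1 h'
  split_ifs with hb
  · have : (#(openBis V π ∩ openBis V π') : ℝ) ≤ p := by
      exact_mod_cast (Finset.card_le_card Finset.inter_subset_left).trans h.2
    linarith
  · have : (#(openBis V π ∩ openBis V π') : ℝ) ≤ 1 := by
      exact_mod_cast card_openBis_inter_le hn hn' hb
    linarith

theorem ite_or_le {a b c d e : Prop} [Decidable a] [Decidable b] [Decidable c] [Decidable d]
    [Decidable e] {w : ℝ} (he : e ↔ a ∨ b ∨ c ∨ d)
    (h : 0 ≤ w ∨ ¬ (a ∧ d) ∧ ¬ (b ∧ c) ∧ ¬ (a ∧ b) ∧ ¬ (a ∧ c) ∧ ¬ (b ∧ d) ∧ ¬ (c ∧ d)) :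
    (if e then w else 0) ≤ (if a then w else 0) + (if b then w else 0) +
      (if c then w else 0) + (if d then w else 0) := by
  by_cases ha : a <;> by_cases hb : b <;> by_cases hc : c <;> by_cases hd : d <;>
    simp [he, ha, hb, hc, hd] at h ⊢ <;> linarith

open Classical in
/-- Two adjacent pairs have only one common corner, unless they agree up to order. -/
theorem ite_cornerAdj_mul_corr_le (V : Finset (K × K)) (p : ℕ) {π π' : (K × K) × (K × K)}
    (hn : Noniso π.1 π.2) (hn' : Noniso π'.1 π'.2) :
    (if CornerAdj π π' then corr V p π π' else 0) ≤
      (if corner π = corner π' then corr V p π π' else 0) +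
      (if corner π = corner π'.swap then corr V p π π'.swap else 0) +
      (if corner π.swap = corner π' then corr V p π.swap π' else 0) +
      (if corner π.swap = corner π'.swap then corr V p π.swap π'.swap else 0) := by
  rw [corr_swap_left, corr_swap_left, corr_swap_right]
  by_cases hw : 0 ≤ corr V p π π'
  · exact ite_or_le Iff.rfl (Or.inl hw)
  · have hne : π ≠ π' := by
      rintro rfl; exact hw (corr_self_nonneg _ _ _)
    have hne' : π ≠ π'.swap := by
      rintro rfl
      rw [corr_swap_left] at hw
      exact hw (corr_self_nonneg _ _ _)
    have q1 : corner π = corner π' → corner π.swap ≠ corner π'.swap := by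
      intro h1 h2
      simp only [corner, Prod.mk.injEq, Prod.fst_swap, Prod.snd_swap] at h1 h2
      exact hne (Prod.ext (Prod.ext h2.1 h1.2) (Prod.ext h1.1 h2.2))
    have q2 : corner π = corner π'.swap → corner π.swap ≠ corner π' := by
      intro h1 h2
      simp only [corner, Prod.mk.injEq, Prod.fst_swap, Prod.snd_swap] at h1 h2
      exact hne' (Prod.ext (Prod.ext h2.1 h1.2) (Prod.ext h1.1 h2.2))
    have q3 : corner π = corner π' → corner π ≠ corner π'.swap := by
      intro h1 h2
      simp only [corner, Prod.mk.injEq, Prod.fst_swap, Prod.snd_swap] at h1 h2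
      exact hn'.1 (h2.1.symm.trans h1.1)
    have q4 : corner π = corner π' → corner π.swap ≠ corner π' := by
      intro h1 h2
      simp only [corner, Prod.mk.injEq, Prod.fst_swap, Prod.snd_swap] at h1 h2
      exact hn.1 (h2.1.trans h1.1.symm)
    have q5 : corner π = corner π'.swap → corner π.swap ≠ corner π'.swap := by
      intro h1 h2
      simp only [corner, Prod.mk.injEq, Prod.fst_swap, Prod.snd_swap] at h1 h2
      exact hn.1 (h2.1.trans h1.1.symm)
    have q6 : corner π.swap = corner π' → corner π.swap ≠ corner π'.swap := by
      intro h1 h2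
      simp only [corner, Prod.mk.injEq, Prod.fst_swap, Prod.snd_swap] at h1 h2
      exact hn'.1 (h2.1.symm.trans h1.1)
    exact ite_or_le Iff.rfl (Or.inr ⟨fun h => q1 h.1 h.2, fun h => q2 h.1 h.2, fun h => q3 h.1 h.2,
      fun h => q4 h.1 h.2, fun h => q5 h.1 h.2, fun h => q6 h.1 h.2⟩)

theorem goodPairs_swap {X : Finset (K × K)} {k : ℕ} {π : (K × K) × (K × K)}
    (h : π ∈ goodPairs X k) : π.swap ∈ goodPairs X k := by
  classical
  simp only [goodPairs, Finset.mem_filter, Finset.mem_product, Prod.fst_swap, Prod.snd_swap] at h ⊢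
  exact ⟨⟨h.1.2, h.1.1⟩, h.2.1.symm, fun ⟨S, hS, h1, h2⟩ => h.2.2 ⟨S, hS, h2, h1⟩⟩

theorem sum_goodPairs_swap (X : Finset (K × K)) (k : ℕ) (f : (K × K) × (K × K) → ℝ) :
    ∑ π ∈ goodPairs X k, f π.swap = ∑ π ∈ goodPairs X k, f π :=
  Finset.sum_bij' (fun π _ => π.swap) (fun π _ => π.swap) (fun _ h => goodPairs_swap h)
    (fun _ h => goodPairs_swap h) (fun _ _ => Prod.swap_swap _) (fun _ _ => Prod.swap_swap _)
    fun _ _ => rfl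

open Classical in
/-- Sum of the correlations over pairs with a common corner. -/
noncomputable def cornerSum (V : Finset (K × K)) (p : ℕ) (P : Finset ((K × K) × (K × K))) : ℝ :=
  ∑ π ∈ P, ∑ π' ∈ P, if corner π = corner π' then corr V p π π' else 0

open Classical in
theorem sum_sq_dev_le {V X : Finset (K × K)} {p : ℕ} (hp : 0 < p) (hV : #V = p ^ 2) (k : ℕ)
    (hX : ∀ y ∈ X, ∀ z ∈ X, Noniso y z → p ≤ #(openBis V (y, z)) + 2 ∧ #(openBis V (y, z)) ≤ p) :
    ∑ x ∈ V, (∑ π ∈ goodPairs X k, dev V p π x) ^ 2 ≤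
      p * #{q ∈ (X ×ˢ X) ×ˢ (X ×ˢ X) | SegAdj (fun y z => Noniso y z ∧ ¬ RichPair X k y z) q.1 q.2 ∧
      sep q.1.2 q.1.1 ≠ 0} + 4 * (#X : ℝ) ^ 4 / p + 4 * cornerSum V p (goodPairs X k) := by
  set P := goodPairs X k with hP
  have hPm : ∀ π ∈ P, Noniso π.1 π.2 ∧ (p ≤ #(openBis V π) + 2 ∧ #(openBis V π) ≤ p) := by
    intro π hπ
    simp only [hP, goodPairs, Finset.mem_filter, Finset.mem_product] at hπ
    exact ⟨hπ.2.1, hX _ hπ.1.1 _ hπ.1.2 hπ.2.1⟩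
  have hexp : ∑ x ∈ V, (∑ π ∈ P, dev V p π x) ^ 2 = ∑ π ∈ P, ∑ π' ∈ P, corr V p π π' := by
    simp only [sq, Finset.sum_mul_sum, corr]
    rw [Finset.sum_comm]
    exact Finset.sum_congr rfl fun π _ => Finset.sum_comm
  have hpt : ∀ π ∈ P, ∀ π' ∈ P, corr V p π π' ≤
      (p * (if bis π.1 π.2 = bis π'.1 π'.2 ∧ ¬ CornerAdj π π' then (1 : ℝ) else 0) + 4 / p) +
      ((if corner π = corner π' then corr V p π π' else 0) +
      (if corner π = corner π'.swap then corr V p π π'.swap else 0) +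
      (if corner π.swap = corner π' then corr V p π.swap π' else 0) +
      (if corner π.swap = corner π'.swap then corr V p π.swap π'.swap else 0)) := by
    intro π hπ π' hπ'
    obtain ⟨h1, h2⟩ := hPm π hπ
    obtain ⟨h1', h2'⟩ := hPm π' hπ'
    have e1 := ite_cornerAdj_mul_corr_le V p h1 h1'
    have e2 := corr_le_of_card_le hp hV h1 h1' h2 h2'.1
    have e3 : (0 : ℝ) ≤ 4 / p := by positivity
    have e4 : (0 : ℝ) ≤ p := by positivity
    by_cases hc : CornerAdj π π'
    · rw [if_pos hc] at e1
      simp only [hc, not_true, and_false, if_false]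
      linarith
    · rw [if_neg hc] at e1
      simp only [hc, not_false_eq_true, and_true]
      by_cases hb : bis π.1 π.2 = bis π'.1 π'.2
      · simp only [hb, if_true] at e2 ⊢
        linarith
      · simp only [hb, if_false] at e2 ⊢
        linarith
  rw [hexp]
  refine (Finset.sum_le_sum fun π hπ => Finset.sum_le_sum fun π' hπ' => hpt π hπ π' hπ').trans ?_
  simp only [Finset.sum_add_distrib, ← Finset.mul_sum]
  have s2 : ∑ π ∈ P, ∑ π' ∈ P, (if corner π = corner π'.swap then corr V p π π'.swap else 0) =
      cornerSum V p P :=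
    Finset.sum_congr rfl fun π _ => sum_goodPairs_swap X k
      fun π' => if corner π = corner π' then corr V p π π' else 0
  have s3 : ∑ π ∈ P, ∑ π' ∈ P, (if corner π.swap = corner π' then corr V p π.swap π' else 0) =
      cornerSum V p P :=
    sum_goodPairs_swap X k
      fun π => ∑ π' ∈ P, if corner π = corner π' then corr V p π π' else 0
  have s4 : ∑ π ∈ P, ∑ π' ∈ P, (if corner π.swap = corner π'.swap then
      corr V p π.swap π'.swap else 0) = cornerSum V p P := by
    rw [← s2]
    exact sum_goodPairs_swap X k
      fun π => ∑ π' ∈ P, if corner π = corner π'.swap then corr V p π π'.swap else 0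
  rw [s2, s3, s4]
  have s1 : ∑ π ∈ P, ∑ π' ∈ P, (if corner π = corner π' then corr V p π π' else 0) =
      cornerSum V p P := rfl
  rw [s1]
  have c1 : ∑ π ∈ P, ∑ π' ∈ P,
      (if bis π.1 π.2 = bis π'.1 π'.2 ∧ ¬ CornerAdj π π' then (1 : ℝ) else 0) ≤
      (#{q ∈ (X ×ˢ X) ×ˢ (X ×ˢ X) | SegAdj (fun y z => Noniso y z ∧ ¬ RichPair X k y z) q.1 q.2 ∧
      sep q.1.2 q.1.1 ≠ 0} : ℝ) := by
    have := card_bis_eq_not_cornerAdj_le X k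
    refine le_trans (le_of_eq ?_) (Nat.cast_le (α := ℝ).2 this)
    rw [Finset.card_filter, Finset.sum_product]
    push_cast
    rfl
  have c2 : ∑ π ∈ P, ∑ π' ∈ P, (4 / p : ℝ) ≤ 4 * (#X : ℝ) ^ 4 / p := by
    simp only [Finset.sum_const, nsmul_eq_mul]
    have hPc : (#P : ℝ) ≤ (#X : ℝ) ^ 2 := by
      have : #P ≤ #X ^ 2 := by
        rw [sq, ← Finset.card_product]
        exact Finset.card_filter_le _ _
      exact_mod_cast this
    calc (#P : ℝ) * (#P * (4 / p)) ≤ (#X : ℝ) ^ 2 * ((#X : ℝ) ^ 2 * (4 / p)) := by gcongr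
      _ = _ := by ring
  have c3 := mul_le_mul_of_nonneg_left c1 (Nat.cast_nonneg (α := ℝ) p)
  linarith

open Classical in
theorem card_triangles_le_main_add {V X : Finset (K × K)} {p : ℕ} (hp : 0 < p)
    (hV : #V = p ^ 2) (hXV : X ⊆ V) {k : ℕ} (hk2 : 2 ≤ k) (hk : 4 * #X ≤ k ^ 2)
    (hX : ∀ y ∈ X, ∀ z ∈ X, Noniso y z → p ≤ #(openBis V (y, z)) + 2 ∧ #(openBis V (y, z)) ≤ p) :
    (#(triangles X) : ℝ) ≤ (#X : ℝ) ^ 3 / p + 8 * (#X : ℝ) ^ 2 + √(#X * (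
      p * #{q ∈ (X ×ˢ X) ×ˢ (X ×ˢ X) | SegAdj (fun y z => Noniso y z ∧ ¬ RichPair X k y z) q.1 q.2 ∧
      sep q.1.2 q.1.1 ≠ 0} + 4 * (#X : ℝ) ^ 4 / p + 4 * cornerSum V p (goodPairs X k))) := by
  have hsum := sum_sq_dev_le hp hV k hX
  set P := goodPairs X k with hP
  have hPc : #P ≤ #X ^ 2 := by
    rw [sq, ← Finset.card_product]
    exact Finset.card_filter_le _ _
  have hT := card_triangles_le_rich_add X hk2 hk
  rw [← hP] at hT
  have h1 : ∀ π ∈ P, (#{x ∈ X | sep x π.1 = sep x π.2} : ℝ) ≤ 2 + 1 / p * #X +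
      ∑ x ∈ X, dev V p π x := by
    intro π hπ
    simp only [hP, goodPairs, Finset.mem_filter, Finset.mem_product] at hπ
    have hsub : {x ∈ X | sep x π.1 = sep x π.2} ⊆
        {(π.1.1, π.2.2), (π.2.1, π.1.2)} ∪ {x ∈ X | x ∈ openBis V π} := by
      intro x hx
      obtain ⟨hx, hs⟩ := Finset.mem_filter.1 hx
      rw [Finset.mem_union]
      by_cases h0 : sep x π.1 = 0
      · left
        rw [h0] at hs
        replace hs := hs.symm
        simp only [sep, mul_eq_zero, sub_eq_zero] at h0 hs
        have h3 := hπ.2.1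
        simp only [Finset.mem_insert, Finset.mem_singleton]
        rcases h0 with h0 | h0 <;> rcases hs with h' | h'
        · exact absurd (h0.symm.trans h') h3.1
        · exact Or.inl (Prod.ext h0 h')
        · exact Or.inr (Prod.ext h' h0)
        · exact absurd (h0.symm.trans h') h3.2
      · right
        exact Finset.mem_filter.2 ⟨hx, Finset.mem_filter.2 ⟨hXV hx, hs, h0⟩⟩
    have hc := (Finset.card_le_card hsub).trans ((Finset.card_union_le _ _).trans
      (Nat.add_le_add_right Finset.card_le_two _))
    have hd : ∑ x ∈ X, dev V p π x = #{x ∈ X | x ∈ openBis V π} - 1 / p * #X := by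
      simp only [dev, Finset.sum_sub_distrib, Finset.sum_const, nsmul_eq_mul]
      rw [← Finset.sum_filter, Finset.sum_const, nsmul_eq_mul]
      ring
    rw [hd]
    have : (#{x ∈ X | sep x π.1 = sep x π.2} : ℝ) ≤ 2 + #{x ∈ X | x ∈ openBis V π} := by
      exact_mod_cast hc
    linarith
  have h2 : (∑ π ∈ P, #{x ∈ X | sep x π.1 = sep x π.2} : ℝ) ≤
      2 * (#X : ℝ) ^ 2 + (#X : ℝ) ^ 3 / p + ∑ x ∈ X, ∑ π ∈ P, dev V p π x := by
    refine (Finset.sum_le_sum h1).trans ?_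
    rw [Finset.sum_add_distrib, Finset.sum_comm (s := P), Finset.sum_const, nsmul_eq_mul]
    have : (#P : ℝ) ≤ (#X : ℝ) ^ 2 := by exact_mod_cast hPc
    have : (#P : ℝ) * (2 + 1 / p * #X) ≤ (#X : ℝ) ^ 2 * (2 + 1 / p * #X) := by gcongr
    have e : (#X : ℝ) ^ 2 * (2 + 1 / p * #X) = 2 * (#X : ℝ) ^ 2 + (#X : ℝ) ^ 3 / p := by ring
    linarith
  have h3 : ∑ x ∈ X, ∑ π ∈ P, dev V p π x ≤ √(#X * ∑ x ∈ V, (∑ π ∈ P, dev V p π x) ^ 2) := by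
    apply Real.le_sqrt_of_sq_le
    refine sq_sum_le_card_mul_sum_sq.trans (mul_le_mul_of_nonneg_left ?_ (Nat.cast_nonneg _))
    exact Finset.sum_le_sum_of_subset_of_nonneg hXV fun _ _ _ => sq_nonneg _
  have h4 := h3.trans (Real.sqrt_le_sqrt (mul_le_mul_of_nonneg_left hsum (Nat.cast_nonneg #X)))
  have hTR : (#(triangles X) : ℝ) ≤ 6 * (#X : ℝ) ^ 2 +
      (∑ π ∈ P, #{x ∈ X | sep x π.1 = sep x π.2} : ℝ) := by exact_mod_cast hT
  linarith

open Classical in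
theorem cornerSum_eq_sum_sq (V : Finset (K × K)) (p : ℕ) (P : Finset ((K × K) × (K × K)))
    (C : Finset (K × K)) (hC : ∀ π ∈ P, corner π ∈ C) :
    cornerSum V p P =
      ∑ x ∈ V, ∑ c ∈ C, (∑ π ∈ P, if corner π = c then dev V p π x else 0) ^ 2 := by
  have h1 : ∀ π ∈ P, ∀ π' ∈ P, (if corner π = corner π' then corr V p π π' else 0) =
      ∑ x ∈ V, ∑ c ∈ C, (if corner π = c then dev V p π x else 0) *
        (if corner π' = c then dev V p π' x else 0) := by
    intro π hπ π' hπ'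
    have h2 : ∀ x ∈ V, ∑ c ∈ C, (if corner π = c then dev V p π x else 0) *
        (if corner π' = c then dev V p π' x else 0) =
        if corner π = corner π' then dev V p π x * dev V p π' x else 0 := by
      intro x _
      rw [Finset.sum_eq_single (corner π)]
      · simp [eq_comm]
      · intro c _ hc
        rw [if_neg hc.symm, zero_mul]
      · exact fun h => absurd (hC π hπ) h
    rw [Finset.sum_congr rfl h2]
    by_cases h : corner π = corner π'
    · simp only [h, if_true, corr]
    · simp only [h, if_false, Finset.sum_const_zero]
  rw [cornerSum, Finset.sum_congr rfl fun π hπ => Finset.sum_congr rfl (h1 π hπ)]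
  simp only [sq, Finset.sum_mul_sum]
  calc _ = ∑ π ∈ P, ∑ x ∈ V, ∑ π' ∈ P, ∑ c ∈ C, (if corner π = c then dev V p π x else 0) *
        (if corner π' = c then dev V p π' x else 0) :=
      Finset.sum_congr rfl fun π _ => Finset.sum_comm
    _ = ∑ x ∈ V, ∑ π ∈ P, ∑ π' ∈ P, ∑ c ∈ C, (if corner π = c then dev V p π x else 0) *
        (if corner π' = c then dev V p π' x else 0) := Finset.sum_comm
    _ = ∑ x ∈ V, ∑ π ∈ P, ∑ c ∈ C, ∑ π' ∈ P, (if corner π = c then dev V p π x else 0) *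
        (if corner π' = c then dev V p π' x else 0) :=
      Finset.sum_congr rfl fun x _ => Finset.sum_congr rfl fun π _ => Finset.sum_comm
    _ = _ := Finset.sum_congr rfl fun x _ => Finset.sum_comm

open Classical in
theorem cornerSum_sdiff_le (V : Finset (K × K)) (p : ℕ) {P R : Finset ((K × K) × (K × K))}
    (hR : R ⊆ P) : cornerSum V p (P \ R) ≤ 2 * cornerSum V p P + 2 * cornerSum V p R := by
  have hC : ∀ π ∈ P, corner π ∈ P.image corner := fun π hπ => Finset.mem_image_of_mem _ hπ
  rw [cornerSum_eq_sum_sq V p P _ hC, cornerSum_eq_sum_sq V p R _ fun π hπ => hC π (hR hπ),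
    cornerSum_eq_sum_sq V p (P \ R) _ fun π hπ => hC π (Finset.sdiff_subset hπ)]
  simp only [Finset.mul_sum, ← Finset.sum_add_distrib]
  refine Finset.sum_le_sum fun x _ => Finset.sum_le_sum fun c _ => ?_
  rw [← Finset.sum_sdiff hR (f := fun π => if corner π = c then dev V p π x else 0)]
  set u := ∑ π ∈ P \ R, if corner π = c then dev V p π x else 0
  set v := ∑ π ∈ R, if corner π = c then dev V p π x else 0
  nlinarith [sq_nonneg (u + 2 * v)]

open Classical in
theorem card_corner_eq_le {α : Type*} {V X : Finset (α × α)} {p K₀ : ℕ} (hXV : X ⊆ V)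
    (hsnd : ∀ b, #{x ∈ X | x.2 = b} ≤ K₀) (vfst : ∀ a, #{x ∈ V | x.1 = a} ≤ p) (c : α × α) :
    #{π ∈ X ×ˢ X | c = corner π} ≤ K₀ * p := by
  calc #{π ∈ X ×ˢ X | c = corner π}
      ≤ #({x ∈ X | x.2 = c.2} ×ˢ {x ∈ V | x.1 = c.1}) := by
        refine Finset.card_le_card fun π hπ => ?_
        simp only [Finset.mem_filter, Finset.mem_product] at hπ ⊢
        obtain ⟨⟨h1, h2⟩, rfl⟩ := hπ
        exact ⟨⟨h1, rfl⟩, hXV h2, rfl⟩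
    _ ≤ K₀ * p := by
        rw [Finset.card_product]
        exact Nat.mul_le_mul (hsnd _) (vfst _)

open Classical in
theorem card_corner_eq_bis_eq_le {X : Finset (K × K)} {K₀ : ℕ}
    (hsnd : ∀ b, #{x ∈ X | x.2 = b} ≤ K₀) (c l : K × K) :
    #{π ∈ X ×ˢ X | Noniso π.1 π.2 ∧ c = corner π ∧ l = bis π.1 π.2} ≤ K₀ := by
  refine (Finset.card_le_card_of_injOn Prod.fst (t := {x ∈ X | x.2 = c.2}) ?_ ?_).trans (hsnd c.2)
  · intro π hπ
    simp only [Finset.coe_filter, Finset.mem_product, Set.mem_ofPred_eq] at hπ ⊢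
    exact ⟨hπ.1.1, by rw [hπ.2.2.1]; rfl⟩
  · intro π hπ π' hπ' h
    simp only [Finset.coe_filter, Finset.mem_product, Set.mem_ofPred_eq] at hπ hπ'
    refine Prod.ext h (eq_of_bis_eq hπ.2.1.symm (z := π.1) ?_ ?_)
    · rw [h]; exact hπ'.2.1.symm
    · rw [bis_comm, ← hπ.2.2.2, h, bis_comm, ← hπ'.2.2.2]

open Classical in
/-- The pairs excluded from `goodPairs X k`. -/
noncomputable def richPairs (X : Finset (K × K)) (k : ℕ) : Finset ((K × K) × (K × K)) :=
  {π ∈ X ×ˢ X | Noniso π.1 π.2 ∧ RichPair X k π.1 π.2}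

open Classical in
theorem card_richPairs_le {V X : Finset (K × K)} {p k : ℕ} (hXV : X ⊆ V)
    (hk : 4 * #X ≤ k ^ 2) (hVc : #(V.image Prod.snd) ≤ p) : #(richPairs X k) ≤ 2 * #X * p := by
  have h1 : richPairs X k ⊆ (richSets X k).biUnion fun S => S ×ˢ S := by
    intro π hπ
    obtain ⟨-, -, S, hS, h1, h2⟩ := Finset.mem_filter.1 hπ
    exact Finset.mem_biUnion.2 ⟨S, hS, Finset.mem_product.2 ⟨h1, h2⟩⟩
  have h2 : ∀ S ∈ richSets X k, #(S ×ˢ S) ≤ #S * p := by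
    intro S hS
    obtain ⟨hSX, -, A, B, C, D, hd, hc, -⟩ := mem_richSets hS
    rw [Finset.card_product]
    refine Nat.mul_le_mul_left _ ?_
    rw [← Finset.card_image_of_injOn (f := Prod.snd) (s := S)]
    · exact (Finset.card_le_card (Finset.image_subset_image (hSX.trans hXV))).trans hVc
    · exact fun x hx y hy h => OnCurve.eq_of_snd_eq hd (hc x hx) (hc y hy) h
  calc #(richPairs X k) ≤ ∑ S ∈ richSets X k, #S * p :=
      (Finset.card_le_card h1).trans (Finset.card_biUnion_le.trans (Finset.sum_le_sum h2))
    _ ≤ _ := by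
      rw [← Finset.sum_mul]
      exact Nat.mul_le_mul_right _ (sum_card_richSets_le X hk)

open Classical in
theorem cornerSum_richPairs_le {V X : Finset (K × K)} {p k K₀ : ℕ} (hp : 0 < p)
    (hV : #V = p ^ 2) (hXV : X ⊆ V) (hk : 4 * #X ≤ k ^ 2)
    (hX : ∀ y ∈ X, ∀ z ∈ X, Noniso y z → p ≤ #(openBis V (y, z)) + 2 ∧ #(openBis V (y, z)) ≤ p)
    (hsnd : ∀ b, #{x ∈ X | x.2 = b} ≤ K₀) (vfst : ∀ a, #{x ∈ V | x.1 = a} ≤ p)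
    (hVc : #(V.image Prod.snd) ≤ p) :
    cornerSum V p (richPairs X k) ≤ 10 * p ^ 2 * #X * K₀ := by
  have hp1 : (1 : ℝ) ≤ p := by exact_mod_cast hp
  have hm : ∀ π ∈ richPairs X k, Noniso π.1 π.2 ∧ p ≤ #(openBis V π) + 2 ∧ #(openBis V π) ≤ p := by
    intro π hπ
    simp only [richPairs, Finset.mem_filter, Finset.mem_product] at hπ
    exact ⟨hπ.2.1, hX _ hπ.1.1 _ hπ.1.2 hπ.2.1⟩
  have h1 : ∀ π ∈ richPairs X k, ∑ π' ∈ richPairs X k,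
      (if corner π = corner π' then corr V p π π' else 0) ≤ 5 * p * K₀ := by
    intro π hπ
    have h2 : ∀ π' ∈ richPairs X k, (if corner π = corner π' then corr V p π π' else 0) ≤
        p * (if Noniso π'.1 π'.2 ∧ corner π = corner π' ∧ bis π.1 π.2 = bis π'.1 π'.2 then 1 else 0) +
        4 / p * (if corner π = corner π' then 1 else 0) := by
      intro π' hπ'
      have := corr_le_of_card_le hp hV (hm π hπ).1 (hm π' hπ').1 (hm π hπ).2 (hm π' hπ').2.1
      by_cases hc : corner π = corner π'
      · simp only [hc, (hm π' hπ').1, true_and, if_true]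
        by_cases hb : bis π.1 π.2 = bis π'.1 π'.2
        · simp only [hb, if_true] at this ⊢
          linarith
        · simp only [hb, if_false] at this ⊢
          linarith
      · simp [hc]
    refine (Finset.sum_le_sum h2).trans ?_
    have hsub : richPairs X k ⊆ X ×ˢ X := Finset.filter_subset _ _
    rw [Finset.sum_add_distrib, ← Finset.mul_sum, ← Finset.mul_sum, Finset.sum_boole,
      Finset.sum_boole]
    have c1 : (#{π' ∈ richPairs X k | Noniso π'.1 π'.2 ∧ corner π = corner π' ∧
        bis π.1 π.2 = bis π'.1 π'.2} : ℝ) ≤ K₀ := by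
      exact_mod_cast (Finset.card_le_card (Finset.filter_subset_filter _ hsub)).trans
        (card_corner_eq_bis_eq_le hsnd (corner π) (bis π.1 π.2))
    have c2 : (#{π' ∈ richPairs X k | corner π = corner π'} : ℝ) ≤ K₀ * p := by
      exact_mod_cast (Finset.card_le_card (Finset.filter_subset_filter _ hsub)).trans
        (card_corner_eq_le hXV hsnd vfst (corner π))
    calc _ ≤ (p : ℝ) * K₀ + 4 / p * (K₀ * p) := by gcongr
      _ = p * K₀ + 4 * K₀ := by field_simp
      _ ≤ _ := by nlinarith [Nat.cast_nonneg (α := ℝ) K₀]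
  calc cornerSum V p (richPairs X k) ≤ ∑ π ∈ richPairs X k, 5 * (p : ℝ) * K₀ :=
      Finset.sum_le_sum h1
    _ = #(richPairs X k) * (5 * (p : ℝ) * K₀) := by rw [Finset.sum_const, nsmul_eq_mul]
    _ ≤ (2 * #X * p : ℕ) * (5 * (p : ℝ) * K₀) := by
      gcongr
      exact card_richPairs_le hXV hk hVc
    _ = _ := by push_cast; ring

open Classical in
theorem goodPairs_eq_sdiff (X : Finset (K × K)) (k : ℕ) :
    goodPairs X k = {π ∈ X ×ˢ X | Noniso π.1 π.2} \ richPairs X k := by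
  ext π
  simp only [goodPairs, richPairs, Finset.mem_filter, Finset.mem_sdiff]
  tauto

/-- If no isotropic line contains two points of `V`, a pair is determined by its corner. -/
theorem cornerSum_goodPairs_le_of_injOn {V X : Finset (K × K)} {p k : ℕ} (hp : 0 < p)
    (hV : #V = p ^ 2) (hXV : X ⊆ V)
    (hX : ∀ y ∈ X, ∀ z ∈ X, Noniso y z → p ≤ #(openBis V (y, z)) + 2 ∧ #(openBis V (y, z)) ≤ p)
    (h1 : ∀ x ∈ V, ∀ y ∈ V, x.1 = y.1 → x = y) (h2 : ∀ x ∈ V, ∀ y ∈ V, x.2 = y.2 → x = y) :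
    cornerSum V p (goodPairs X k) ≤ 5 * p * #X ^ 2 := by
  classical
  have hp1 : (1 : ℝ) ≤ p := by exact_mod_cast hp
  have hle : ∀ π ∈ goodPairs X k, ∑ π' ∈ goodPairs X k,
      (if corner π = corner π' then corr V p π π' else 0) ≤ 5 * (p : ℝ) := by
    intro π hπ
    have hm := hπ
    simp only [goodPairs, Finset.mem_filter, Finset.mem_product] at hm
    rw [Finset.sum_eq_single π]
    · have hb := hX _ hm.1.1 _ hm.1.2 hm.2.1
      have := corr_le_of_card_le hp hV hm.2.1 hm.2.1 hb hb.1
      simp only [if_true] at this ⊢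
      have : (4 : ℝ) / p ≤ 4 := div_le_self (by norm_num) hp1
      linarith
    · intro π' hπ' hne
      simp only [goodPairs, Finset.mem_filter, Finset.mem_product] at hπ'
      refine if_neg fun h => hne ?_
      simp only [corner, Prod.mk.injEq] at h
      exact Prod.ext (h2 _ (hXV hπ'.1.1) _ (hXV hm.1.1) h.2.symm)
        (h1 _ (hXV hπ'.1.2) _ (hXV hm.1.2) h.1.symm)
    · exact fun h => absurd hπ h
  have hc : #(goodPairs X k) ≤ #X ^ 2 := by
    rw [sq, ← Finset.card_product]
    exact Finset.card_filter_le _ _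
  calc cornerSum V p (goodPairs X k) ≤ ∑ π ∈ goodPairs X k, 5 * (p : ℝ) := Finset.sum_le_sum hle
    _ = #(goodPairs X k) * (5 * (p : ℝ)) := by rw [Finset.sum_const, nsmul_eq_mul]
    _ ≤ (#X ^ 2 : ℕ) * (5 * (p : ℝ)) := by gcongr
    _ = _ := by push_cast; ring

/-- `w` lies on the plane with normal vector `(q.1, q.2.1, 1)` at height `q.2.2`. -/
def Incident {F : Type*} [Field F] (q w : F × F × F) : Prop :=
  q.1 * w.1 + q.2.1 * w.2.1 + q.2.2 + w.2.2 = 0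

section Incidence

variable {F : Type*} [Field F] [Fintype F]

open Classical in
theorem card_incident (q : F × F × F) :
    #{w : F × F × F | Incident q w} = Fintype.card F ^ 2 := by
  rw [sq, ← Fintype.card_prod, ← Finset.card_univ]
  refine Finset.card_nbij' (fun w => (w.1, w.2.1))
    (fun v => (v.1, v.2, -(q.1 * v.1 + q.2.1 * v.2 + q.2.2))) ?_ ?_ ?_ ?_
  · exact fun _ _ => Finset.mem_coe.2 (Finset.mem_univ _)
  · intro v _
    simp only [Finset.mem_coe, Finset.mem_filter, Finset.mem_univ, true_and]
    simp only [Incident]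
    ring
  · intro w hw
    simp only [Finset.mem_coe, Finset.mem_filter, Finset.mem_univ, true_and] at hw
    simp only [Incident] at hw
    refine Prod.ext rfl (Prod.ext rfl ?_)
    simp only
    linear_combination -hw
  · exact fun _ _ => rfl

open Classical in
theorem card_incident_inter_le {q q' : F × F × F} (h : q ≠ q') :
    #{w : F × F × F | Incident q w ∧ Incident q' w} ≤ Fintype.card F := by
  rw [← Finset.card_univ]
  by_cases h1 : q.1 = q'.1
  · by_cases h2 : q.2.1 = q'.2.1
    · have h3 : q.2.2 ≠ q'.2.2 := fun h3 => h (Prod.ext h1 (Prod.ext h2 h3))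
      rw [Finset.card_eq_zero.2]
      · exact Nat.zero_le _
      · refine Finset.filter_eq_empty_iff.2 fun w _ hw => h3 ?_
        simp only [Incident] at hw
        rw [h1, h2] at hw
        linear_combination hw.1 - hw.2
    · refine Finset.card_le_card_of_injOn (fun w => w.1) (fun _ _ => Finset.mem_coe.2 (Finset.mem_univ _)) ?_
      intro w hw v hv he
      simp only [Finset.mem_coe, Finset.mem_filter, Finset.mem_univ, true_and] at hw hv he
      simp only [Incident] at hw hv he
      rw [he] at hw
      have e2 : w.2.1 = v.2.1 := by
        apply mul_left_cancel₀ (sub_ne_zero.2 h2)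
        linear_combination hw.1 - hw.2 - hv.1 + hv.2
      rw [e2] at hw
      exact Prod.ext he (Prod.ext e2 (by linear_combination hw.1 - hv.1))
  · refine Finset.card_le_card_of_injOn (fun w => w.2.1) (fun _ _ => Finset.mem_coe.2 (Finset.mem_univ _)) ?_
    intro w hw v hv he
    simp only [Finset.mem_coe, Finset.mem_filter, Finset.mem_univ, true_and] at hw hv he
    simp only [Incident] at hw hv he
    rw [he] at hw
    have e2 : w.1 = v.1 := by
      apply mul_left_cancel₀ (sub_ne_zero.2 h1)
      linear_combination hw.1 - hw.2 - hv.1 + hv.2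
    rw [e2] at hw
    exact Prod.ext e2 (Prod.ext he (by linear_combination hw.1 - hv.1))

open Classical in
/-- Second moment bound for point-plane incidences. -/
theorem sum_incident_sub_sq_le {p : ℕ} (hp : Fintype.card F = p) (Q : Finset (F × F × F)) :
    ∑ w : F × F × F, (∑ q ∈ Q, ((if Incident q w then (1 : ℝ) else 0) - 1 / p)) ^ 2 ≤
      p ^ 2 * #Q := by
  have hp0 : (0 : ℝ) < p := by rw [← hp]; exact_mod_cast Fintype.card_pos
  have hpair : ∀ q q' : F × F × F, ∑ w : F × F × F, ((if Incident q w then (1 : ℝ) else 0) - 1 / p) *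
      ((if Incident q' w then (1 : ℝ) else 0) - 1 / p) ≤ if q = q' then (p : ℝ) ^ 2 else 0 := by
    intro q q'
    have e : ∀ w : F × F × F, ((if Incident q w then (1 : ℝ) else 0) - 1 / p) *
        ((if Incident q' w then (1 : ℝ) else 0) - 1 / p) =
        (if Incident q w ∧ Incident q' w then 1 else 0) - (if Incident q w then 1 else 0) / p -
        (if Incident q' w then 1 else 0) / p + 1 / p ^ 2 := by
      intro w
      by_cases h1 : Incident q w <;> by_cases h2 : Incident q' w <;>
        simp only [h1, h2, if_true, if_false, and_true, and_false] <;> ring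
    have hc : (Fintype.card (F × F × F) : ℝ) = p ^ 3 := by
      rw [Fintype.card_prod, Fintype.card_prod, hp]; push_cast; ring
    have e2 : ∑ w : F × F × F, ((if Incident q w then (1 : ℝ) else 0) - 1 / p) *
        ((if Incident q' w then (1 : ℝ) else 0) - 1 / p) =
        #{w : F × F × F | Incident q w ∧ Incident q' w} - p := by
      rw [Finset.sum_congr rfl fun w _ => e w, Finset.sum_add_distrib, Finset.sum_sub_distrib,
        Finset.sum_sub_distrib, ← Finset.sum_div, ← Finset.sum_div, Finset.sum_boole,
        Finset.sum_boole, Finset.sum_boole, card_incident, card_incident, Finset.sum_const,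
        Finset.card_univ, nsmul_eq_mul, hc, hp]
      push_cast
      field_simp
      ring
    rw [e2]
    split_ifs with h
    · subst h
      simp only [and_self, card_incident, hp]
      push_cast
      linarith
    · have : (#{w : F × F × F | Incident q w ∧ Incident q' w} : ℝ) ≤ p := by
        exact_mod_cast hp ▸ card_incident_inter_le h
      linarith
  simp only [sq (∑ q ∈ Q, _), Finset.sum_mul_sum]
  rw [Finset.sum_comm]
  calc _ = ∑ q ∈ Q, ∑ q' ∈ Q, ∑ w : F × F × F, ((if Incident q w then (1 : ℝ) else 0) - 1 / p) *
        ((if Incident q' w then (1 : ℝ) else 0) - 1 / p) :=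
        Finset.sum_congr rfl fun q _ => Finset.sum_comm
    _ ≤ ∑ q ∈ Q, ∑ q' ∈ Q, if q = q' then (p : ℝ) ^ 2 else 0 :=
        Finset.sum_le_sum fun q _ => Finset.sum_le_sum fun q' _ => hpair q q'
    _ = ∑ q ∈ Q, (p : ℝ) ^ 2 :=
        Finset.sum_congr rfl fun q hq => by rw [Finset.sum_ite_eq, if_pos hq]
    _ = _ := by rw [Finset.sum_const, nsmul_eq_mul, mul_comm]

open Classical in
theorem sum_incident_sub_le {p : ℕ} (hp : Fintype.card F = p) {α β : Type*} (Q : Finset α)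
    (W : Finset β) (f : α → F × F × F) (g : β → F × F × F) (hf : Set.InjOn f Q)
    (hg : Set.InjOn g W) :
    ∑ w ∈ W, ∑ q ∈ Q, ((if Incident (f q) (g w) then (1 : ℝ) else 0) - 1 / p) ≤
      p * √(#Q * #W) := by
  set D : F × F × F → ℝ := fun w =>
    ∑ q ∈ Q.image f, ((if Incident q w then (1 : ℝ) else 0) - 1 / p) with hD
  have h1 : ∑ w ∈ W, ∑ q ∈ Q, ((if Incident (f q) (g w) then (1 : ℝ) else 0) - 1 / p) =
      ∑ w ∈ W.image g, D w := by
    rw [Finset.sum_image hg]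
    exact Finset.sum_congr rfl fun w _ => by simp only [hD]; rw [Finset.sum_image hf]
  have h2 : (∑ w ∈ W.image g, D w) ^ 2 ≤ #W * (p ^ 2 * #Q) := by
    refine sq_sum_le_card_mul_sum_sq.trans ?_
    rw [Finset.card_image_of_injOn hg, ← Finset.card_image_of_injOn hf]
    refine mul_le_mul_of_nonneg_left ?_ (Nat.cast_nonneg _)
    exact (Finset.sum_le_sum_of_subset_of_nonneg (Finset.subset_univ _)
      fun _ _ _ => sq_nonneg _).trans (sum_incident_sub_sq_le hp (Q.image f))
  rw [h1]
  have h3 := Real.le_sqrt_of_sq_le h2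
  have h4 : (#W : ℝ) * (p ^ 2 * #Q) = p ^ 2 * (#Q * #W) := by ring
  rwa [h4, Real.sqrt_mul (by positivity), Real.sqrt_sq (Nat.cast_nonneg _)] at h3

end Incidence

theorem bis_eq_iff_of_corner_eq {y z y' z' : K × K} (h : Noniso y z) (h' : Noniso y' z')
    (h2 : y.2 = y'.2) (h1 : z.1 = z'.1) :
    bis y z = bis y' z' ↔ (y.1 - z.1) * (y'.2 - z'.2) = (y'.1 - z'.1) * (y.2 - z.2) := by
  have n1 : y.2 - z.2 ≠ 0 := sub_ne_zero.2 h.2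
  have n2 : y'.2 - z'.2 ≠ 0 := sub_ne_zero.2 h'.2
  have e : (bis y z).1 = (bis y' z').1 ↔
      (y.1 - z.1) * (y'.2 - z'.2) = (y'.1 - z'.1) * (y.2 - z.2) := by
    simp only [bis]
    rw [div_eq_div_iff n1 n2]
    constructor <;> intro h <;> linear_combination -h
  rw [← e]
  refine ⟨fun h => congrArg Prod.fst h, fun h3 => Prod.ext h3 ?_⟩
  have e1 := fst_eq_bis' h
  have e2 := fst_eq_bis' h'
  rw [← h3, ← h2, ← h1] at e2
  linear_combination e2 - e1

open Classical in
theorem openBis_inter_eq_empty {V : Finset (K × K)} {π π' : (K × K) × (K × K)}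
    (h : Noniso π.1 π.2) (h' : Noniso π'.1 π'.2) (hc : corner π = corner π')
    (hb : bis π.1 π.2 ≠ bis π'.1 π'.2) : openBis V π ∩ openBis V π' = ∅ := by
  refine Finset.eq_empty_of_forall_notMem fun x hx => ?_
  simp only [openBis, Finset.mem_inter, Finset.mem_filter, sep_eq_iff_mem_bis h,
    sep_eq_iff_mem_bis h'] at hx
  obtain ⟨⟨-, e1, hs⟩, -, e2, -⟩ := hx
  simp only [corner, Prod.mk.injEq] at hc
  have e3 := fst_eq_bis' h
  have e4 := fst_eq_bis' h'
  rw [← hc.1, ← hc.2] at e4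
  have n : x.2 - π.1.2 ≠ 0 := fun h0 => hs (by rw [sep, h0, mul_zero])
  have e5 : (bis π.1 π.2).1 = (bis π'.1 π'.2).1 := by
    apply mul_right_cancel₀ n
    linear_combination e2 - e1 + e3 - e4
  refine hb (Prod.ext e5 ?_)
  rw [e5] at e1
  linear_combination e2 - e1

open Classical in
/-- Ordered pairs of distinct points of `X` on a line `x.2 = b`. -/
noncomputable def rowPairs {α : Type*} (X : Finset (α × α)) : Finset ((α × α) × (α × α)) :=
  {r ∈ X ×ˢ X | r.1.2 = r.2.2 ∧ r.1.1 ≠ r.2.1}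

open Classical in
/-- Ordered pairs of distinct points of `X` on a line `x.1 = a`. -/
noncomputable def colPairs {α : Type*} (X : Finset (α × α)) : Finset ((α × α) × (α × α)) :=
  {s ∈ X ×ˢ X | s.1.1 = s.2.1 ∧ s.1.2 ≠ s.2.2}

open Classical in
theorem card_rowPairs_le {α : Type*} {X : Finset (α × α)} {K₀ : ℕ} (hsnd : ∀ b, #{x ∈ X | x.2 = b} ≤ K₀) :
    #(rowPairs X) ≤ #X * K₀ := by
  rw [rowPairs, Finset.card_filter, Finset.sum_product, ← smul_eq_mul, ← Finset.sum_const]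
  refine Finset.sum_le_sum fun y _ => ?_
  rw [← Finset.card_filter]
  refine (Finset.card_le_card fun z hz => ?_).trans (hsnd y.2)
  rw [Finset.mem_filter] at hz ⊢
  exact ⟨hz.1, hz.2.1.symm⟩

open Classical in
theorem card_colPairs_le {α : Type*} {X : Finset (α × α)} {K₀ : ℕ} (hfst : ∀ a, #{x ∈ X | x.1 = a} ≤ K₀) :
    #(colPairs X) ≤ #X * K₀ := by
  rw [colPairs, Finset.card_filter, Finset.sum_product, ← smul_eq_mul, ← Finset.sum_const]
  refine Finset.sum_le_sum fun y _ => ?_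
  rw [← Finset.card_filter]
  refine (Finset.card_le_card fun z hz => ?_).trans (hfst y.1)
  rw [Finset.mem_filter] at hz ⊢
  exact ⟨hz.1, hz.2.1.symm⟩

open Classical in
theorem card_rowPairs_filter_le {α : Type*} {V X : Finset (α × α)} {p : ℕ} (hXV : X ⊆ V)
    (vsnd : ∀ b, #{x ∈ V | x.2 = b} ≤ p) (b : α) : #{r ∈ rowPairs X | r.1.2 = b} ≤ p ^ 2 := by
  calc #{r ∈ rowPairs X | r.1.2 = b} ≤ #({x ∈ V | x.2 = b} ×ˢ {x ∈ V | x.2 = b}) := by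
        refine Finset.card_le_card fun r hr => ?_
        simp only [rowPairs, Finset.mem_filter, Finset.mem_product] at hr ⊢
        exact ⟨⟨hXV hr.1.1.1, hr.2⟩, hXV hr.1.1.2, hr.1.2.1 ▸ hr.2⟩
    _ ≤ p ^ 2 := by
        rw [Finset.card_product, sq]
        exact Nat.mul_le_mul (vsnd b) (vsnd b)

open Classical in
theorem card_colPairs_filter_le {α : Type*} {V X : Finset (α × α)} {p : ℕ} (hXV : X ⊆ V)
    (vfst : ∀ a, #{x ∈ V | x.1 = a} ≤ p) (a : α) : #{s ∈ colPairs X | s.1.1 = a} ≤ p ^ 2 := by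
  calc #{s ∈ colPairs X | s.1.1 = a} ≤ #({x ∈ V | x.1 = a} ×ˢ {x ∈ V | x.1 = a}) := by
        refine Finset.card_le_card fun r hr => ?_
        simp only [colPairs, Finset.mem_filter, Finset.mem_product] at hr ⊢
        exact ⟨⟨hXV hr.1.1.1, hr.2⟩, hXV hr.1.1.2, hr.1.2.1 ▸ hr.2⟩
    _ ≤ p ^ 2 := by
        rw [Finset.card_product, sq]
        exact Nat.mul_le_mul (vfst a) (vfst a)

open Classical in
theorem card_rowPairs_colPairs_iso_le {α : Type*} {V X : Finset (α × α)} {p K₀ : ℕ} (hXV : X ⊆ V)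
    (hfst : ∀ a, #{x ∈ X | x.1 = a} ≤ K₀) (hsnd : ∀ b, #{x ∈ X | x.2 = b} ≤ K₀)
    (vfst : ∀ a, #{x ∈ V | x.1 = a} ≤ p) (vsnd : ∀ b, #{x ∈ V | x.2 = b} ≤ p) :
    #{t ∈ rowPairs X ×ˢ colPairs X | ¬ (Noniso t.1.1 t.2.1 ∧ Noniso t.1.2 t.2.2)} ≤
      4 * p ^ 2 * #X * K₀ := by
  have h1 : ∀ f : (α × α) × (α × α) → α, #{t ∈ rowPairs X ×ˢ colPairs X | t.2.1.1 = f t.1} ≤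
      p ^ 2 * #X * K₀ := by
    intro f
    rw [Finset.card_filter, Finset.sum_product]
    calc _ ≤ ∑ r ∈ rowPairs X, p ^ 2 := Finset.sum_le_sum fun r _ => by
          rw [← Finset.card_filter]; exact card_colPairs_filter_le hXV vfst (f r)
      _ = #(rowPairs X) * p ^ 2 := by rw [Finset.sum_const, smul_eq_mul]
      _ ≤ (#X * K₀) * p ^ 2 := Nat.mul_le_mul_right _ (card_rowPairs_le hsnd)
      _ = _ := by ring
  have h2 : ∀ f : (α × α) × (α × α) → α, #{t ∈ rowPairs X ×ˢ colPairs X | t.1.1.2 = f t.2} ≤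
      p ^ 2 * #X * K₀ := by
    intro f
    rw [Finset.card_filter, Finset.sum_product_right]
    calc _ ≤ ∑ r ∈ colPairs X, p ^ 2 := Finset.sum_le_sum fun r _ => by
          rw [← Finset.card_filter]; exact card_rowPairs_filter_le hXV vsnd (f r)
      _ = #(colPairs X) * p ^ 2 := by rw [Finset.sum_const, smul_eq_mul]
      _ ≤ (#X * K₀) * p ^ 2 := Nat.mul_le_mul_right _ (card_colPairs_le hfst)
      _ = _ := by ring
  have hsub : {t ∈ rowPairs X ×ˢ colPairs X | ¬ (Noniso t.1.1 t.2.1 ∧ Noniso t.1.2 t.2.2)} ⊆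
      ({t ∈ rowPairs X ×ˢ colPairs X | t.2.1.1 = t.1.1.1} ∪
        {t ∈ rowPairs X ×ˢ colPairs X | t.2.1.1 = t.1.2.1}) ∪
      ({t ∈ rowPairs X ×ˢ colPairs X | t.1.1.2 = t.2.1.2} ∪
        {t ∈ rowPairs X ×ˢ colPairs X | t.1.1.2 = t.2.2.2}) := by
    intro t ht
    rw [Finset.mem_filter] at ht
    obtain ⟨htm, hn⟩ := ht
    simp only [Finset.mem_union, Finset.mem_filter, htm, true_and]
    have hq := (Finset.mem_filter.1 (Finset.mem_product.1 htm).1).2.1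
    have hw := (Finset.mem_filter.1 (Finset.mem_product.1 htm).2).2.1
    by_contra! hcon
    exact hn ⟨⟨hcon.1.1.symm, hcon.2.1⟩, fun e => hcon.1.2 (hw.trans e.symm),
      fun e => hcon.2.2 (hq.trans e)⟩
  have := Finset.card_le_card hsub
  have e1 := Finset.card_union_le ({t ∈ rowPairs X ×ˢ colPairs X | t.2.1.1 = t.1.1.1} ∪
        {t ∈ rowPairs X ×ˢ colPairs X | t.2.1.1 = t.1.2.1})
      ({t ∈ rowPairs X ×ˢ colPairs X | t.1.1.2 = t.2.1.2} ∪
        {t ∈ rowPairs X ×ˢ colPairs X | t.1.1.2 = t.2.2.2})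
  have e2 := Finset.card_union_le {t ∈ rowPairs X ×ˢ colPairs X | t.2.1.1 = t.1.1.1}
        {t ∈ rowPairs X ×ˢ colPairs X | t.2.1.1 = t.1.2.1}
  have e3 := Finset.card_union_le {t ∈ rowPairs X ×ˢ colPairs X | t.1.1.2 = t.2.1.2}
        {t ∈ rowPairs X ×ˢ colPairs X | t.1.1.2 = t.2.2.2}
  have f1 := h1 fun r => r.1.1
  have f2 := h1 fun r => r.2.1
  have f3 := h2 fun r => r.1.2
  have f4 := h2 fun r => r.2.2
  have e5 : 4 * p ^ 2 * #X * K₀ = 4 * (p ^ 2 * #X * K₀) := by ring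
  rw [e5]
  omega

open Classical in
/-- Balanced count of the pairs of non-isotropic pairs with the same corner and bisector. -/
theorem sum_bis_eq_sub_le {F : Type*} [Field F] [Fintype F] {p : ℕ} (hF : Fintype.card F = p)
    (ι : F →+* K) (ψ : K → F) {V X : Finset (K × K)} {K₀ : ℕ} (hXV : X ⊆ V)
    (hψ : ∀ x ∈ V, ι (ψ x.1) = x.1 ∧ ι (ψ x.2) = x.2)
    (hfst : ∀ a, #{x ∈ X | x.1 = a} ≤ K₀) (hsnd : ∀ b, #{x ∈ X | x.2 = b} ≤ K₀)
    (vfst : ∀ a, #{x ∈ V | x.1 = a} ≤ p) (vsnd : ∀ b, #{x ∈ V | x.2 = b} ≤ p) :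
    ∑ t ∈ rowPairs X ×ˢ colPairs X with Noniso t.1.1 t.2.1 ∧ Noniso t.1.2 t.2.2,
      ((if bis t.1.1 t.2.1 = bis t.1.2 t.2.2 then (1 : ℝ) else 0) - 1 / p) ≤ 5 * p * #X * K₀ := by
  have hp0 : (0 : ℝ) < p := by rw [← hF]; exact_mod_cast Fintype.card_pos
  set f : (K × K) × (K × K) → F × F × F := fun r =>
    (ψ r.1.1, ψ r.2.1, (ψ r.2.1 - ψ r.1.1) * ψ r.1.2) with hf
  set g : (K × K) × (K × K) → F × F × F := fun s =>
    (ψ s.2.2, -ψ s.1.2, ψ s.1.1 * (ψ s.1.2 - ψ s.2.2)) with hg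
  have ψ1 : ∀ x ∈ X, ∀ y ∈ X, ψ x.1 = ψ y.1 → x.1 = y.1 := fun x hx y hy h => by
    rw [← (hψ x (hXV hx)).1, h, (hψ y (hXV hy)).1]
  have ψ2 : ∀ x ∈ X, ∀ y ∈ X, ψ x.2 = ψ y.2 → x.2 = y.2 := fun x hx y hy h => by
    rw [← (hψ x (hXV hx)).2, h, (hψ y (hXV hy)).2]
  have hfi : Set.InjOn f (rowPairs X) := by
    intro r hr r' hr' h
    simp only [rowPairs, Finset.mem_coe, Finset.mem_filter, Finset.mem_product] at hr hr'
    simp only [hf, Prod.mk.injEq] at h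
    obtain ⟨h1, h2, h3⟩ := h
    rw [h1, h2] at h3
    have n : ψ r'.2.1 - ψ r'.1.1 ≠ 0 := sub_ne_zero.2 fun e =>
      hr'.2.2 (ψ1 _ hr'.1.2 _ hr'.1.1 e).symm
    have h4 := ψ2 _ hr.1.1 _ hr'.1.1 (mul_left_cancel₀ n h3)
    exact Prod.ext (Prod.ext (ψ1 _ hr.1.1 _ hr'.1.1 h1) h4)
      (Prod.ext (ψ1 _ hr.1.2 _ hr'.1.2 h2) (hr.2.1.symm.trans (h4.trans hr'.2.1)))
  have hgi : Set.InjOn g (colPairs X) := by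
    intro r hr r' hr' h
    simp only [colPairs, Finset.mem_coe, Finset.mem_filter, Finset.mem_product] at hr hr'
    simp only [hg, Prod.mk.injEq, neg_inj] at h
    obtain ⟨h1, h2, h3⟩ := h
    rw [h1, h2] at h3
    have n : ψ r'.1.2 - ψ r'.2.2 ≠ 0 := sub_ne_zero.2 fun e =>
      hr'.2.2 (ψ2 _ hr'.1.1 _ hr'.1.2 e)
    have h4 := ψ1 _ hr.1.1 _ hr'.1.1 (mul_right_cancel₀ n h3)
    exact Prod.ext (Prod.ext h4 (ψ2 _ hr.1.1 _ hr'.1.1 h2))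
      (Prod.ext (hr.2.1.symm.trans (h4.trans hr'.2.1)) (ψ2 _ hr.1.2 _ hr'.1.2 h1))
  have hinc : ∀ t ∈ rowPairs X ×ˢ colPairs X, Noniso t.1.1 t.2.1 ∧ Noniso t.1.2 t.2.2 →
      (bis t.1.1 t.2.1 = bis t.1.2 t.2.2 ↔ Incident (f t.1) (g t.2)) := by
    intro t ht hn
    obtain ⟨hr, hs⟩ := Finset.mem_product.1 ht
    simp only [rowPairs, colPairs, Finset.mem_filter, Finset.mem_product] at hr hs
    rw [bis_eq_iff_of_corner_eq hn.1 hn.2 hr.2.1 hs.2.1, Incident,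
      ← map_eq_zero_iff ι ι.injective]
    simp only [hf, hg, map_add, map_mul, map_sub, map_neg, (hψ _ (hXV hr.1.1)).1,
      (hψ _ (hXV hr.1.1)).2, (hψ _ (hXV hr.1.2)).1, (hψ _ (hXV hs.1.1)).1, (hψ _ (hXV hs.1.1)).2,
      (hψ _ (hXV hs.1.2)).2]
    rw [← hr.2.1, ← hs.2.1]
    constructor <;> intro h <;> linear_combination -h
  have hsplit := Finset.sum_filter_add_sum_filter_not (rowPairs X ×ˢ colPairs X)
    (fun t => Noniso t.1.1 t.2.1 ∧ Noniso t.1.2 t.2.2)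
    (fun t => (if Incident (f t.1) (g t.2) then (1 : ℝ) else 0) - 1 / p)
  have hviol : -(4 * p * #X * K₀ : ℝ) ≤ ∑ t ∈ rowPairs X ×ˢ colPairs X with
      ¬ (Noniso t.1.1 t.2.1 ∧ Noniso t.1.2 t.2.2),
      ((if Incident (f t.1) (g t.2) then (1 : ℝ) else 0) - 1 / p) := by
    have hc := card_rowPairs_colPairs_iso_le hXV hfst hsnd vfst vsnd
    have hc' : (#{t ∈ rowPairs X ×ˢ colPairs X | ¬ (Noniso t.1.1 t.2.1 ∧ Noniso t.1.2 t.2.2)} : ℝ) ≤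
      4 * p ^ 2 * #X * K₀ := by exact_mod_cast hc
    calc -(4 * p * #X * K₀ : ℝ) = (4 * p ^ 2 * #X * K₀ : ℝ) * (-(1 / p)) := by
          field_simp
      _ ≤ #{t ∈ rowPairs X ×ˢ colPairs X | ¬ (Noniso t.1.1 t.2.1 ∧ Noniso t.1.2 t.2.2)} *
          (-(1 / p) : ℝ) := by
          apply mul_le_mul_of_nonpos_right hc'
          have : (0 : ℝ) ≤ 1 / p := by positivity
          linarith
      _ = ∑ t ∈ rowPairs X ×ˢ colPairs X with ¬ (Noniso t.1.1 t.2.1 ∧ Noniso t.1.2 t.2.2),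
          (-(1 / p) : ℝ) := by rw [Finset.sum_const, nsmul_eq_mul]
      _ ≤ _ := Finset.sum_le_sum fun t _ => by
          split_ifs
          · linarith
          · linarith
  have htot : ∑ t ∈ rowPairs X ×ˢ colPairs X,
      ((if Incident (f t.1) (g t.2) then (1 : ℝ) else 0) - 1 / p) ≤ p * (#X * K₀) := by
    rw [Finset.sum_product_right]
    refine (sum_incident_sub_le hF _ _ f g hfi hgi).trans ?_
    refine mul_le_mul_of_nonneg_left ?_ hp0.le
    rw [← Real.sqrt_mul_self (by positivity : (0 : ℝ) ≤ #X * K₀)]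
    apply Real.sqrt_le_sqrt
    have q1 : (#(rowPairs X) : ℝ) ≤ #X * K₀ := by exact_mod_cast card_rowPairs_le hsnd
    have q2 : (#(colPairs X) : ℝ) ≤ #X * K₀ := by exact_mod_cast card_colPairs_le hfst
    gcongr
  calc _ = ∑ t ∈ rowPairs X ×ˢ colPairs X with Noniso t.1.1 t.2.1 ∧ Noniso t.1.2 t.2.2,
      ((if Incident (f t.1) (g t.2) then (1 : ℝ) else 0) - 1 / p) := by
        refine Finset.sum_congr rfl fun t ht => ?_
        obtain ⟨ht, hn⟩ := Finset.mem_filter.1 ht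
        simp only [hinc t ht hn]
    _ ≤ _ := by linarith

open Classical in
theorem ite_corner_mul_corr_le {V : Finset (K × K)} {p : ℕ} (hp : 0 < p) (hV : #V = p ^ 2)
    {π π' : (K × K) × (K × K)} (hn : Noniso π.1 π.2) (hn' : Noniso π'.1 π'.2)
    (h : p ≤ #(openBis V π) + 2 ∧ #(openBis V π) ≤ p) (h' : p ≤ #(openBis V π') + 2) :
    (if corner π = corner π' then corr V p π π' else 0) ≤
      p * (if π = π' then 1 else 0) + 4 / p * (if corner π = corner π' then 1 else 0) +
      p * (if corner π = corner π' ∧ π.1.1 ≠ π'.1.1 ∧ π.2.2 ≠ π'.2.2 then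
        (if bis π.1 π.2 = bis π'.1 π'.2 then (1 : ℝ) else 0) - 1 / p else 0) := by
  have hp0 : (0 : ℝ) < p := by exact_mod_cast hp
  by_cases hc : corner π = corner π'
  · have h1 := corr_le hp hV h.1 h'
    have hc' := hc
    simp only [corner, Prod.mk.injEq] at hc'
    have h2 : (#(openBis V π ∩ openBis V π') : ℝ) ≤
        p * (if bis π.1 π.2 = bis π'.1 π'.2 then (1 : ℝ) else 0) := by
      split_ifs with hb
      · rw [mul_one]
        exact_mod_cast (Finset.card_le_card Finset.inter_subset_left).trans h.2
      · rw [openBis_inter_eq_empty hn hn' hc hb]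
        simp
    simp only [hc, true_and, if_true]
    by_cases hD : π.1.1 ≠ π'.1.1 ∧ π.2.2 ≠ π'.2.2
    · rw [if_pos hD, mul_sub, mul_one_div_cancel hp0.ne']
      have : (0 : ℝ) ≤ p * (if π = π' then 1 else 0) := by positivity
      linarith
    · rw [if_neg hD]
      by_cases hb : bis π.1 π.2 = bis π'.1 π'.2
      · have he : π = π' := by
          by_cases h3 : π.1.1 = π'.1.1
          · have h4 : π.1 = π'.1 := Prod.ext h3 hc'.2
            refine Prod.ext h4 (eq_of_bis_eq (z := π.1) hn.symm (h4 ▸ hn'.symm) ?_)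
            rw [bis_comm, hb, bis_comm, h4]
          · have h5 : π.2.2 = π'.2.2 := by
              by_contra h5; exact hD ⟨h3, h5⟩
            have h4 : π.2 = π'.2 := Prod.ext hc'.1 h5
            refine Prod.ext (eq_of_bis_eq (z := π.2) hn (h4 ▸ hn') ?_) h4
            rw [hb, h4]
        rw [if_pos hb] at h2
        rw [if_pos he]
        linarith
      · rw [if_neg hb] at h2
        have : (0 : ℝ) ≤ p * (if π = π' then 1 else 0) := by positivity
        linarith
  · simp only [hc, false_and, if_false]
    have : (0 : ℝ) ≤ p * (if π = π' then 1 else 0) := by positivity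
    linarith

open Classical in
theorem cornerSum_noniso_le {F : Type*} [Field F] [Fintype F] {p : ℕ} (hF : Fintype.card F = p)
    (ι : F →+* K) (ψ : K → F) {V X : Finset (K × K)} {K₀ : ℕ} (hV : #V = p ^ 2) (hXV : X ⊆ V)
    (hX : ∀ y ∈ X, ∀ z ∈ X, Noniso y z → p ≤ #(openBis V (y, z)) + 2 ∧ #(openBis V (y, z)) ≤ p)
    (hψ : ∀ x ∈ V, ι (ψ x.1) = x.1 ∧ ι (ψ x.2) = x.2)
    (hfst : ∀ a, #{x ∈ X | x.1 = a} ≤ K₀) (hsnd : ∀ b, #{x ∈ X | x.2 = b} ≤ K₀)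
    (vfst : ∀ a, #{x ∈ V | x.1 = a} ≤ p) (vsnd : ∀ b, #{x ∈ V | x.2 = b} ≤ p) :
    cornerSum V p {π ∈ X ×ˢ X | Noniso π.1 π.2} ≤ p * #X ^ 2 + 9 * p ^ 2 * #X * K₀ := by
  have hp : 0 < p := by rw [← hF]; exact Fintype.card_pos
  have hp0 : (0 : ℝ) < p := by exact_mod_cast hp
  set P : Finset ((K × K) × (K × K)) := {π ∈ X ×ˢ X | Noniso π.1 π.2} with hP
  have hm : ∀ π ∈ P, Noniso π.1 π.2 ∧ p ≤ #(openBis V π) + 2 ∧ #(openBis V π) ≤ p := by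
    intro π hπ
    simp only [hP, Finset.mem_filter, Finset.mem_product] at hπ
    exact ⟨hπ.2, hX _ hπ.1.1 _ hπ.1.2 hπ.2⟩
  have hPc : (#P : ℝ) ≤ (#X : ℝ) ^ 2 := by
    have : #P ≤ #X ^ 2 := by
      rw [sq, ← Finset.card_product]
      exact Finset.card_filter_le _ _
    exact_mod_cast this
  have hN : (#X : ℝ) ≤ p ^ 2 := by exact_mod_cast hV ▸ Finset.card_le_card hXV
  have s1 : ∑ π ∈ P, ∑ π' ∈ P, (if π = π' then (1 : ℝ) else 0) = #P := by
    rw [Finset.sum_congr rfl fun π hπ => by rw [Finset.sum_ite_eq, if_pos hπ], Finset.sum_const,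
      nsmul_eq_mul, mul_one]
  have s2 : ∑ π ∈ P, ∑ π' ∈ P, (if corner π = corner π' then (1 : ℝ) else 0) ≤ #P * (K₀ * p) := by
    rw [← nsmul_eq_mul, ← Finset.sum_const]
    refine Finset.sum_le_sum fun π _ => ?_
    rw [Finset.sum_boole]
    exact_mod_cast (Finset.card_le_card (Finset.filter_subset_filter _
      (Finset.filter_subset _ _))).trans (card_corner_eq_le hXV hsnd vfst (corner π))
  have s3 : ∑ π ∈ P, ∑ π' ∈ P, (if corner π = corner π' ∧ π.1.1 ≠ π'.1.1 ∧ π.2.2 ≠ π'.2.2 then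
      (if bis π.1 π.2 = bis π'.1 π'.2 then (1 : ℝ) else 0) - 1 / p else 0) =
      ∑ t ∈ rowPairs X ×ˢ colPairs X with Noniso t.1.1 t.2.1 ∧ Noniso t.1.2 t.2.2,
      ((if bis t.1.1 t.2.1 = bis t.1.2 t.2.2 then (1 : ℝ) else 0) - 1 / p) := by
    rw [← Finset.sum_product', ← Finset.sum_filter]
    refine Finset.sum_bij' (fun q _ => ((q.1.1, q.2.1), (q.1.2, q.2.2)))
      (fun t _ => ((t.1.1, t.2.1), (t.1.2, t.2.2))) ?_ ?_ (fun _ _ => rfl) (fun _ _ => rfl)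
      (fun _ _ => rfl)
    · intro q hq
      simp only [hP, rowPairs, colPairs, corner, Finset.mem_filter, Finset.mem_product,
        Prod.mk.injEq] at hq ⊢
      tauto
    · intro q hq
      simp only [hP, rowPairs, colPairs, corner, Finset.mem_filter, Finset.mem_product,
        Prod.mk.injEq] at hq ⊢
      tauto
  have s4 := sum_bis_eq_sub_le hF ι ψ hXV hψ hfst hsnd vfst vsnd
  rw [← s3] at s4
  calc cornerSum V p P ≤ ∑ π ∈ P, ∑ π' ∈ P, (p * (if π = π' then 1 else 0) +
        4 / p * (if corner π = corner π' then 1 else 0) +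
        p * (if corner π = corner π' ∧ π.1.1 ≠ π'.1.1 ∧ π.2.2 ≠ π'.2.2 then
          (if bis π.1 π.2 = bis π'.1 π'.2 then (1 : ℝ) else 0) - 1 / p else 0)) :=
        Finset.sum_le_sum fun π hπ => Finset.sum_le_sum fun π' hπ' =>
          ite_corner_mul_corr_le hp hV (hm π hπ).1 (hm π' hπ').1 (hm π hπ).2 (hm π' hπ').2.1
    _ ≤ p * #P + 4 / p * (#P * (K₀ * p)) + p * (5 * p * #X * K₀) := by
        simp only [Finset.sum_add_distrib, ← Finset.mul_sum]
        rw [s1]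
        gcongr
    _ = p * #P + 4 * K₀ * #P + 5 * p ^ 2 * #X * K₀ := by field_simp
    _ ≤ p * #X ^ 2 + 4 * K₀ * (p ^ 2 * #X) + 5 * p ^ 2 * #X * K₀ := by
        have : (#P : ℝ) ≤ p ^ 2 * #X := hPc.trans (by rw [sq]; gcongr)
        gcongr
    _ = _ := by ring

theorem cornerSum_goodPairs_le {F : Type*} [Field F] [Fintype F] {p k : ℕ}
    (hF : Fintype.card F = p) (ι : F →+* K) (ψ : K → F) {V X : Finset (K × K)} {K₀ : ℕ}
    (hV : #V = p ^ 2) (hXV : X ⊆ V) (hk : 4 * #X ≤ k ^ 2)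
    (hX : ∀ y ∈ X, ∀ z ∈ X, Noniso y z → p ≤ #(openBis V (y, z)) + 2 ∧ #(openBis V (y, z)) ≤ p)
    (hψ : ∀ x ∈ V, ι (ψ x.1) = x.1 ∧ ι (ψ x.2) = x.2) [DecidableEq K]
    (hfst : ∀ a, #{x ∈ X | x.1 = a} ≤ K₀) (hsnd : ∀ b, #{x ∈ X | x.2 = b} ≤ K₀) :
    cornerSum V p (goodPairs X k) ≤ 2 * p * #X ^ 2 + 38 * p ^ 2 * #X * K₀ := by
  have hp : 0 < p := by rw [← hF]; exact Fintype.card_pos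
  have hψ1 : ∀ x ∈ V, ∀ y ∈ V, ψ x.1 = ψ y.1 → x.1 = y.1 := fun x hx y hy h => by
    rw [← (hψ x hx).1, h, (hψ y hy).1]
  have hψ2 : ∀ x ∈ V, ∀ y ∈ V, ψ x.2 = ψ y.2 → x.2 = y.2 := fun x hx y hy h => by
    rw [← (hψ x hx).2, h, (hψ y hy).2]
  have vfst : ∀ a, #{x ∈ V | x.1 = a} ≤ p := by
    intro a
    rw [← hF, ← Finset.card_univ]
    refine Finset.card_le_card_of_injOn (fun x => ψ x.2) (fun _ _ => Finset.mem_coe.2 (Finset.mem_univ _)) ?_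
    intro x hx y hy h
    rw [Finset.mem_coe, Finset.mem_filter] at hx hy
    exact Prod.ext (hx.2.trans hy.2.symm) (hψ2 x hx.1 y hy.1 h)
  have vsnd : ∀ b, #{x ∈ V | x.2 = b} ≤ p := by
    intro b
    rw [← hF, ← Finset.card_univ]
    refine Finset.card_le_card_of_injOn (fun x => ψ x.1) (fun _ _ => Finset.mem_coe.2 (Finset.mem_univ _)) ?_
    intro x hx y hy h
    rw [Finset.mem_coe, Finset.mem_filter] at hx hy
    exact Prod.ext (hψ1 x hx.1 y hy.1 h) (hx.2.trans hy.2.symm)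
  have hVc : #(V.image Prod.snd) ≤ p := by
    rw [← hF, ← Finset.card_univ]
    refine Finset.card_le_card_of_injOn ψ (fun _ _ => Finset.mem_coe.2 (Finset.mem_univ _)) ?_
    intro b hb b' hb' h
    obtain ⟨x, hx, rfl⟩ := Finset.mem_image.1 hb
    obtain ⟨y, hy, rfl⟩ := Finset.mem_image.1 hb'
    exact hψ2 x hx y hy h
  have h1 := cornerSum_noniso_le hF ι ψ hV hXV hX hψ
    (fun a => by convert hfst a) (fun a => by convert hsnd a) (fun a => by convert vfst a)
    (fun a => by convert vsnd a)
  have h2 := cornerSum_richPairs_le (K₀ := K₀) hp hV hXV hk hX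
    (fun a => by convert hsnd a) (fun a => by convert vfst a) (by convert hVc)
  have h3 := goodPairs_eq_sdiff X k
  rw [h3]
  refine (cornerSum_sdiff_le V p ?_).trans ?_
  · intro π hπ
    simp only [richPairs, Finset.mem_filter] at hπ ⊢
    exact ⟨hπ.1, hπ.2.1⟩
  · linarith

theorem le_of_balanced_recursion {u v T G S K₀ k : ℝ} (hv : 1 ≤ v) (hvu : v ≤ u)
    (huv : u ^ 36 ≤ v ^ 48)
    (hT : T ≤ (u ^ 12) ^ 3 / v ^ 12 + 8 * (u ^ 12) ^ 2 +
      √(u ^ 12 * (v ^ 12 * G + 4 * (u ^ 12) ^ 4 / v ^ 12 + 4 * S)))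
    (hG : G ≤ 1536000 * (√((u ^ 12) ^ 3 * (T + (u ^ 12) ^ 2)) + k * (u ^ 12) ^ 2))
    (hS : S ≤ 40 * (v ^ 12 * (u ^ 12) ^ 2 + (v ^ 12) ^ 2 * u ^ 12 * K₀))
    (hk : k ≤ 4 * u ^ 6) (hK : K₀ * v ^ 8 ≤ 2 * u ^ 16) :
    T ≤ (u ^ 12) ^ 3 / v ^ 12 + 10 ^ 8 * (v ^ 8 * u ^ 20 + v ^ 3 * u ^ 24) := by
  have hv0 : 0 < v := by linarith
  have hu0 : 0 < u := by linarith
  set E := v ^ 8 * u ^ 20 + v ^ 3 * u ^ 24 with hE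
  set M := (u ^ 12) ^ 3 / v ^ 12 with hM
  set a := v ^ 8 * u ^ 20 with ha
  set b := v ^ 3 * u ^ 24 with hb
  have ha0 : 0 < a := by positivity
  have hb0 : 0 < b := by positivity
  have hE0 : 0 < E := by positivity
  have hM0 : 0 < M := by positivity
  have hMv : M * v ^ 12 = u ^ 36 := by rw [hM]; field_simp
  have h24 : u ^ 24 ≤ E := by
    have : 1 ≤ v ^ 3 := one_le_pow₀ hv
    nlinarith [pow_pos hu0 24]
  by_contra! hlt
  set D := T - M with hD
  have hDE : 10 ^ 8 * E < D := by linarith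
  have hD0 : 0 < D := by linarith
  have hTD : T = M + D := by ring
  have haE : a ≤ E := by linarith
  have hbE : b ≤ E := by linarith
  have hcross : v ^ 11 * u ^ 44 ≤ E ^ 2 := by
    calc v ^ 11 * u ^ 44 = a * b := by ring
      _ ≤ E * E := by gcongr
      _ = E ^ 2 := by ring
  have hroot : u ^ 12 * v ^ 12 * √((u ^ 12) ^ 3 * (T + (u ^ 12) ^ 2)) ≤ 2 * E * D := by
    have h0 : 0 ≤ u ^ 12 * v ^ 12 := by positivity
    rw [← Real.sqrt_sq h0, ← Real.sqrt_mul (sq_nonneg _)]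
    apply Real.sqrt_le_iff.2 ⟨by positivity, ?_⟩
    have h1 : u ^ 60 * v ^ 24 * M = b ^ 4 := by
      calc u ^ 60 * v ^ 24 * M = u ^ 60 * v ^ 12 * (M * v ^ 12) := by ring
        _ = _ := by rw [hMv, hb]; ring
    have h2 : u ^ 60 * v ^ 24 = a ^ 3 := by rw [ha]; ring
    calc (u ^ 12 * v ^ 12) ^ 2 * ((u ^ 12) ^ 3 * (T + (u ^ 12) ^ 2))
        = u ^ 60 * v ^ 24 * M + u ^ 60 * v ^ 24 * (D + u ^ 24) := by rw [hTD]; ring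
      _ = b ^ 4 + a ^ 3 * (D + u ^ 24) := by rw [h1, h2]
      _ ≤ E ^ 4 + E ^ 3 * (D + E) := by gcongr
      _ = E ^ 2 * (2 * E * E + E * D) := by ring
      _ ≤ E ^ 2 * (2 * D * D + D * D) := by gcongr <;> linarith
      _ ≤ (2 * E * D) ^ 2 := by nlinarith [mul_pos (pow_pos hE0 2) (pow_pos hD0 2)]
  have hkt : u ^ 12 * v ^ 12 * (k * (u ^ 12) ^ 2) ≤ 4 * E ^ 2 := by
    calc u ^ 12 * v ^ 12 * (k * (u ^ 12) ^ 2) ≤ u ^ 12 * v ^ 12 * (4 * u ^ 6 * (u ^ 12) ^ 2) := by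
          gcongr
      _ = 4 * (v ^ 11 * (v * u ^ 42)) := by ring
      _ ≤ 4 * (v ^ 11 * (u ^ 2 * u ^ 42)) := by
          gcongr; nlinarith
      _ = 4 * (v ^ 11 * u ^ 44) := by ring
      _ ≤ _ := by gcongr
  have hGt : u ^ 12 * (v ^ 12 * G) ≤ 1536000 * (2 * E * D + 4 * E ^ 2) := by
    calc u ^ 12 * (v ^ 12 * G) ≤ u ^ 12 * (v ^ 12 *
          (1536000 * (√((u ^ 12) ^ 3 * (T + (u ^ 12) ^ 2)) + k * (u ^ 12) ^ 2))) := by gcongr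
      _ = 1536000 * (u ^ 12 * v ^ 12 * √((u ^ 12) ^ 3 * (T + (u ^ 12) ^ 2)) +
          u ^ 12 * v ^ 12 * (k * (u ^ 12) ^ 2)) := by ring
      _ ≤ _ := by gcongr
  have hMt : u ^ 12 * (4 * (u ^ 12) ^ 4 / v ^ 12) ≤ 4 * E ^ 2 := by
    rw [mul_div_assoc', div_le_iff₀ (by positivity)]
    have hb2 : b ^ 2 ≤ E ^ 2 := by gcongr
    have huv' : u ^ 12 ≤ v ^ 16 := by
      by_contra! h
      have : (v ^ 16) ^ 3 < (u ^ 12) ^ 3 := by gcongr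
      rw [← pow_mul, ← pow_mul] at this
      norm_num at this
      exact huv.not_gt this
    calc u ^ 12 * (4 * (u ^ 12) ^ 4) = 4 * (u ^ 48 * u ^ 12) := by ring
      _ ≤ 4 * (u ^ 48 * v ^ 18) := by
          gcongr
          exact huv'.trans (pow_le_pow_right₀ hv (by norm_num))
      _ = 4 * b ^ 2 * v ^ 12 := by rw [hb]; ring
      _ ≤ _ := by gcongr
  have hSt : u ^ 12 * (4 * S) ≤ 480 * E ^ 2 := by
    have h1 : v ^ 12 * u ^ 36 ≤ E ^ 2 := by
      refine le_trans ?_ hcross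
      calc v ^ 12 * u ^ 36 = v ^ 11 * (v * u ^ 36) := by ring
        _ ≤ v ^ 11 * (u ^ 8 * u ^ 36) := by
            gcongr
            exact hvu.trans (le_self_pow₀ (hv.trans hvu) (by norm_num))
        _ = _ := by ring
    have h2 : v ^ 16 * u ^ 40 ≤ E ^ 2 := by
      calc v ^ 16 * u ^ 40 = a ^ 2 := by rw [ha]; ring
        _ ≤ _ := by gcongr
    calc u ^ 12 * (4 * S)
        ≤ u ^ 12 * (4 * (40 * (v ^ 12 * (u ^ 12) ^ 2 + (v ^ 12) ^ 2 * u ^ 12 * K₀))) := by gcongr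
      _ = 160 * (v ^ 12 * u ^ 36) + 160 * (v ^ 16 * u ^ 24 * (K₀ * v ^ 8)) := by ring
      _ ≤ 160 * (v ^ 12 * u ^ 36) + 160 * (v ^ 16 * u ^ 24 * (2 * u ^ 16)) := by gcongr
      _ = 160 * (v ^ 12 * u ^ 36) + 320 * (v ^ 16 * u ^ 40) := by ring
      _ ≤ _ := by linarith
  have hs : √(u ^ 12 * (v ^ 12 * G + 4 * (u ^ 12) ^ 4 / v ^ 12 + 4 * S)) ≤ D / 2 := by
    apply Real.sqrt_le_iff.2 ⟨by positivity, ?_⟩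
    have hED : 10 ^ 8 * (E * D) ≤ D ^ 2 := by
      rw [sq, ← mul_assoc]; gcongr
    have hEE : E ^ 2 ≤ E * D := by
      rw [sq]; gcongr; linarith
    rw [mul_add, mul_add]
    generalize u ^ 12 * (v ^ 12 * G) = A at *
    generalize u ^ 12 * (4 * (u ^ 12) ^ 4 / v ^ 12) = B at *
    generalize u ^ 12 * (4 * S) = F at *
    have hED0 : 0 < E * D := mul_pos hE0 hD0
    calc A + B + F ≤ 1536000 * (2 * E * D + 4 * E ^ 2) + 4 * E ^ 2 + 480 * E ^ 2 :=
          add_le_add (add_le_add hGt hMt) hSt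
      _ = 3072000 * (E * D) + 6144484 * E ^ 2 := by ring
      _ ≤ 3072000 * (E * D) + 6144484 * (E * D) := by gcongr
      _ = 9216484 * (E * D) := by ring
      _ ≤ 1 / 4 * (10 ^ 8 * (E * D)) := by linarith
      _ ≤ 1 / 4 * D ^ 2 := by gcongr
      _ = _ := by ring
  have h24' : (u ^ 12) ^ 2 ≤ E := by rw [← pow_mul]; exact h24
  linarith

set_option maxHeartbeats 1000000 in
open Classical in
theorem card_triangles_le_of_cornerSum [Infinite K] {p : ℕ} [CharP K p] (hp : 0 < p)
    {V X : Finset (K × K)} (hV : #V = p ^ 2) (hXV : X ⊆ V) (hXp : #X ^ 3 ≤ p ^ 4)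
    (hX : ∀ y ∈ X, ∀ z ∈ X, Noniso y z → p ≤ #(openBis V (y, z)) + 2 ∧ #(openBis V (y, z)) ≤ p)
    (hS : ∀ X' ⊆ X, ∀ k K₀ : ℕ, 4 * #X' ≤ k ^ 2 → (∀ a, #{x ∈ X' | x.1 = a} ≤ K₀) →
      (∀ b, #{x ∈ X' | x.2 = b} ≤ K₀) → cornerSum V p (goodPairs X' k) ≤
        40 * (p * (#X' : ℝ) ^ 2 + (p : ℝ) ^ 2 * #X' * K₀)) :
    (#(triangles X) : ℝ) ≤ (#X : ℝ) ^ 3 / p +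
      2 * 10 ^ 8 * ((p : ℝ) ^ (2 / 3 : ℝ) * (#X : ℝ) ^ (5 / 3 : ℝ) +
        (p : ℝ) ^ (1 / 4 : ℝ) * (#X : ℝ) ^ 2) := by
  rcases X.eq_empty_or_nonempty with rfl | hne
  · simp [triangles]
  have hN : (1 : ℝ) ≤ #X := by exact_mod_cast hne.card_pos
  have hpR : (1 : ℝ) ≤ p := by exact_mod_cast hp
  set u : ℝ := (#X : ℝ) ^ (1 / 12 : ℝ) with hu
  set v : ℝ := (p : ℝ) ^ (1 / 12 : ℝ) with hv
  have hpow : ∀ n : ℕ, u ^ n = (#X : ℝ) ^ ((n : ℝ) / 12) := fun n => by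
    rw [hu, ← Real.rpow_natCast, ← Real.rpow_mul (by positivity)]
    congr 1; ring
  have hpow' : ∀ n : ℕ, v ^ n = (p : ℝ) ^ ((n : ℝ) / 12) := fun n => by
    rw [hv, ← Real.rpow_natCast, ← Real.rpow_mul (by positivity)]
    congr 1; ring
  have hu1 : 1 ≤ u := Real.one_le_rpow hN (by norm_num)
  have hv1 : 1 ≤ v := Real.one_le_rpow hpR (by norm_num)
  have h12 : u ^ 12 = #X := by rw [hpow]; norm_num
  have h12' : v ^ 12 = p := by rw [hpow']; norm_num
  have h28 : (#X : ℝ) ^ (7 / 3 : ℝ) = u ^ 28 := by rw [hpow]; norm_num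
  have h20 : (#X : ℝ) ^ (5 / 3 : ℝ) = u ^ 20 := by rw [hpow]; norm_num
  have h24 : (#X : ℝ) ^ 2 = u ^ 24 := by rw [← h12, ← pow_mul]
  have h8' : (p : ℝ) ^ (2 / 3 : ℝ) = v ^ 8 := by rw [hpow']; norm_num
  have h3' : (p : ℝ) ^ (1 / 4 : ℝ) = v ^ 3 := by rw [hpow']; norm_num
  have h6 : u ^ 6 = √(#X) := by rw [hpow, Real.sqrt_eq_rpow]; norm_num
  have hu0 : 0 < u := by linarith
  have hv0 : 0 < v := by linarith
  rcases lt_or_ge u v with huv | hvu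
  · have h := card_triangles_le_rpow (p := p) X hXp
    rw [h28] at h
    have h1 : u ^ 28 ≤ v ^ 8 * u ^ 20 := by
      calc u ^ 28 = u ^ 8 * u ^ 20 := by ring
        _ ≤ _ := by gcongr
    have h2 : 0 ≤ (#X : ℝ) ^ 3 / p := by positivity
    have h3 : 0 ≤ v ^ 3 * u ^ 24 := by positivity
    have h4 : 0 ≤ v ^ 8 * u ^ 20 := by positivity
    rw [h20, h24, h8', h3']
    linarith
  set K₀ := ⌈u ^ 16 / v ^ 8⌉₊ with hK₀
  have hq1 : 1 ≤ u ^ 16 / v ^ 8 := by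
    rw [one_le_div (by positivity)]
    calc v ^ 8 ≤ u ^ 8 := by gcongr
      _ ≤ u ^ 16 := pow_le_pow_right₀ hu1 (by norm_num)
  have hK1 : u ^ 16 / v ^ 8 ≤ K₀ := Nat.le_ceil _
  have hK2 : (K₀ : ℝ) * v ^ 8 ≤ 2 * u ^ 16 := by
    have := (Nat.ceil_lt_add_one (by positivity : 0 ≤ u ^ 16 / v ^ 8)).le
    rw [← le_div_iff₀ (by positivity), mul_div_assoc]
    linarith
  obtain ⟨X', hX', hl1, hl2, hpr⟩ := exists_prune X K₀
  have hN' : (#X' : ℝ) ≤ u ^ 12 := by rw [h12]; exact_mod_cast Finset.card_le_card hX'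
  obtain ⟨hk2, hk⟩ := rich_threshold #X'
  set k := 2 * (Nat.sqrt #X' + 1) with hkdef
  have hp' : #X' ^ 3 ≤ p ^ 4 := (Nat.pow_le_pow_left (Finset.card_le_card hX') 3).trans hXp
  have hG := GoodRel.card_segAdj_total_le (p := p) (by omega) (goodRel_not_richPair X' k) hp'
  have hT := card_triangles_le_main_add hp hV (hX'.trans hXV) hk2 hk
    (fun y hy z hz => hX y (hX' hy) z (hX' hz))
  have hSX := hS X' hX' k K₀ hk hl1 hl2
  set G : ℝ := (#{q ∈ (X' ×ˢ X') ×ˢ (X' ×ˢ X') |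
    SegAdj (fun y z => Noniso y z ∧ ¬ RichPair X' k y z) q.1 q.2 ∧ sep q.1.2 q.1.1 ≠ 0} : ℝ)
    with hGdef
  have hG0 : 0 ≤ G := Nat.cast_nonneg _
  set S := cornerSum V p (goodPairs X' k)
  have hkR : (k : ℝ) ≤ 4 * u ^ 6 := by
    rw [hkdef, h6]
    have h1 : ((Nat.sqrt #X' : ℕ) : ℝ) ≤ √(#X') := Real.nat_sqrt_le_real_sqrt
    have h2 : √(#X' : ℝ) ≤ √(#X) := Real.sqrt_le_sqrt (by rw [← h12]; exact hN')
    have h3 : 1 ≤ √(#X : ℝ) := Real.one_le_sqrt.2 hN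
    push_cast
    linarith
  have huv : u ^ 36 ≤ v ^ 48 := by
    have : (#X : ℝ) ^ 3 ≤ (p : ℝ) ^ 4 := by exact_mod_cast hXp
    rwa [← h12, ← h12', ← pow_mul, ← pow_mul] at this
  have main : (#(triangles X') : ℝ) ≤
      (u ^ 12) ^ 3 / v ^ 12 + 10 ^ 8 * (v ^ 8 * u ^ 20 + v ^ 3 * u ^ 24) := by
    set S' := max S 0 with hS'
    refine le_of_balanced_recursion (G := G) (S := S') (K₀ := K₀) (k := k) hv1 hvu huv
      (hT.trans ?_) (hG.trans ?_) (max_le (hSX.trans ?_) (by positivity)) hkR hK2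
    · rw [h12']
      have : S ≤ S' := le_max_left _ _
      have : 0 ≤ S' := le_max_right _ _
      have hin : p * G + 4 * (#X' : ℝ) ^ 4 / p + 4 * S ≤
          p * G + 4 * (u ^ 12) ^ 4 / p + 4 * S' := by gcongr
      have hin' : #X' * (p * G + 4 * (#X' : ℝ) ^ 4 / p + 4 * S) ≤
          u ^ 12 * (p * G + 4 * (u ^ 12) ^ 4 / p + 4 * S') :=
        (mul_le_mul_of_nonneg_left hin (Nat.cast_nonneg _)).trans
          (mul_le_mul_of_nonneg_right hN' (by positivity))
      have := Real.sqrt_le_sqrt hin'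
      have h3 : (#X' : ℝ) ^ 3 / p ≤ (u ^ 12) ^ 3 / p := by gcongr
      have h4 : 8 * (#X' : ℝ) ^ 2 ≤ 8 * (u ^ 12) ^ 2 := by gcongr
      linarith
    · gcongr
    · rw [h12']
      gcongr
  have hprR : (K₀ : ℝ) * #(triangles X) ≤ K₀ * #(triangles X') + 6 * (u ^ 12) ^ 3 := by
    rw [h12]; exact_mod_cast hpr
  have hK0 : (0 : ℝ) < K₀ := (zero_lt_one.trans_le hq1).trans_le hK1
  have h36 : (u ^ 12) ^ 3 ≤ K₀ * (v ^ 8 * u ^ 20) := by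
    calc (u ^ 12) ^ 3 = (u ^ 16 / v ^ 8) * (v ^ 8 * u ^ 20) := by field_simp
      _ ≤ _ := by gcongr
  have h1 : (K₀ : ℝ) * #(triangles X) ≤ K₀ * (#(triangles X') + 6 * (v ^ 8 * u ^ 20)) := by
    linarith only [hprR, h36]
  have h2 := le_of_mul_le_mul_left h1 hK0
  have h3 : 0 ≤ v ^ 3 * u ^ 24 := by positivity
  have h4 : 0 ≤ v ^ 8 * u ^ 20 := by positivity
  rw [h20, h24, h8', h3', ← h12, ← h12']
  linarith only [h2, h3, h4, main]

/-- The points of `F²` in the isotropic coordinates `x₀ ± i x₁`, where `i² = -1`. -/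
def isoCoord {F : Type*} [Field F] (ι : F →+* K) (i : K) (x : Fin 2 → F) : K × K :=
  (ι (x 0) + i * ι (x 1), ι (x 0) - i * ι (x 1))

section IsoCoord

variable {F : Type*} [Field F] {ι : F →+* K} {i : K}

theorem sep_isoCoord (hi : i ^ 2 = -1) (x y : Fin 2 → F) :
    sep (isoCoord ι i x) (isoCoord ι i y) = ι (nrm (x - y)) := by
  simp only [sep, isoCoord, nrm, Fin.sum_univ_two, Pi.sub_apply, map_add, map_mul, map_sub]
  linear_combination (-(ι (x 1) - ι (y 1)) ^ 2) * hi

theorem noniso_isoCoord_iff (hi : i ^ 2 = -1) (x y : Fin 2 → F) :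
    Noniso (isoCoord ι i x) (isoCoord ι i y) ↔ nrm (x - y) ≠ 0 := by
  rw [← sep_ne_zero_iff, sep_isoCoord hi, Ne, map_eq_zero]

theorem isoCoord_injective (hi : i ^ 2 = -1) (h2 : (2 : F) ≠ 0) :
    Function.Injective (isoCoord ι i) := by
  intro x y h
  have hi0 : i ≠ 0 := by rintro rfl; norm_num at hi
  have h2' : (2 : K) ≠ 0 := by
    have := (map_ne_zero ι).2 h2
    rwa [map_ofNat] at this
  obtain ⟨h1, h3⟩ := Prod.ext_iff.1 h
  simp only [isoCoord] at h1 h3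
  have e0 : ι (x 0) = ι (y 0) := mul_left_cancel₀ h2' (by linear_combination h1 + h3)
  have e1 : ι (x 1) = ι (y 1) := by
    refine mul_left_cancel₀ (mul_ne_zero h2' hi0) ?_
    linear_combination h1 - h3
  ext j
  fin_cases j
  · exact ι.injective e0
  · exact ι.injective e1

/-- The parametrised perpendicular bisector of `y` and `z`. -/
def bisPoint (y z : Fin 2 → F) (t : F) : Fin 2 → F :=
  ![2⁻¹ * (y 0 + z 0) - t * (z 1 - y 1), 2⁻¹ * (y 1 + z 1) + t * (z 0 - y 0)]

theorem nrm_bisPoint_sub_left (h2 : (2 : F) ≠ 0) (y z : Fin 2 → F) (t : F) :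
    nrm (bisPoint y z t - y) = nrm (y - z) * (t ^ 2 + 2⁻¹ ^ 2) := by
  have h : (2 : F) * 2⁻¹ = 1 := mul_inv_cancel₀ h2
  generalize hc : (2 : F)⁻¹ = c at *
  simp only [nrm, bisPoint, Fin.sum_univ_two, Pi.sub_apply, Matrix.cons_val_zero,
    Matrix.cons_val_one, hc]
  linear_combination (2 * (c * (z 0 - y 0) - t * (z 1 - y 1)) * y 0 + (2 * c - 1) * y 0 ^ 2 +
    2 * (c * (z 1 - y 1) + t * (z 0 - y 0)) * y 1 + (2 * c - 1) * y 1 ^ 2) * h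

theorem nrm_bisPoint_sub_right (h2 : (2 : F) ≠ 0) (y z : Fin 2 → F) (t : F) :
    nrm (bisPoint y z t - z) = nrm (y - z) * (t ^ 2 + 2⁻¹ ^ 2) := by
  have h : (2 : F) * 2⁻¹ = 1 := mul_inv_cancel₀ h2
  generalize hc : (2 : F)⁻¹ = c at *
  simp only [nrm, bisPoint, Fin.sum_univ_two, Pi.sub_apply, Matrix.cons_val_zero,
    Matrix.cons_val_one, hc]
  linear_combination (2 * (-c * (z 0 - y 0) - t * (z 1 - y 1)) * z 0 + (2 * c - 1) * z 0 ^ 2 +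
    2 * (-c * (z 1 - y 1) + t * (z 0 - y 0)) * z 1 + (2 * c - 1) * z 1 ^ 2) * h

theorem bisPoint_injective {y z : Fin 2 → F} (h : nrm (y - z) ≠ 0) :
    Function.Injective (bisPoint y z) := by
  intro s t hst
  have h0 := congrFun hst 0
  have h1 := congrFun hst 1
  simp only [bisPoint, Matrix.cons_val_zero, Matrix.cons_val_one] at h0 h1
  refine mul_left_cancel₀ h ?_
  simp only [nrm, Fin.sum_univ_two, Pi.sub_apply]
  linear_combination (z 0 - y 0) * h1 - (z 1 - y 1) * h0

theorem exists_eq_bisPoint (h2 : (2 : F) ≠ 0) {x y z : Fin 2 → F} (h : nrm (y - z) ≠ 0)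
    (hx : nrm (x - y) = nrm (x - z)) : ∃ t, bisPoint y z t = x := by
  have hc' : (2 : F) * 2⁻¹ = 1 := mul_inv_cancel₀ h2
  generalize hc : (2 : F)⁻¹ = c at *
  simp only [nrm, Fin.sum_univ_two, Pi.sub_apply] at hx
  have hab : (x 0 - c * (y 0 + z 0)) * (z 0 - y 0) + (x 1 - c * (y 1 + z 1)) * (z 1 - y 1) = 0 := by
    linear_combination c * hx - (x 0 * (z 0 - y 0) + x 1 * (z 1 - y 1)) * hc'
  have hn : nrm (y - z) = (z 0 - y 0) ^ 2 + (z 1 - y 1) ^ 2 := by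
    simp only [nrm, Fin.sum_univ_two, Pi.sub_apply]
    ring
  refine ⟨((x 1 - c * (y 1 + z 1)) * (z 0 - y 0) - (x 0 - c * (y 0 + z 0)) * (z 1 - y 1)) /
    nrm (y - z), ?_⟩
  generalize nrm (y - z) = n at *
  ext j
  fin_cases j
  · simp only [bisPoint, hc, Fin.zero_eta, Matrix.cons_val_zero]
    field_simp
    linear_combination (c * (y 0 + z 0) - x 0) * hn - (z 0 - y 0) * hab
  · simp only [bisPoint, hc, Fin.mk_one, Matrix.cons_val_one, Matrix.cons_val_fin_one]
    field_simp
    linear_combination (c * (y 1 + z 1) - x 1) * hn - (z 1 - y 1) * hab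

open Classical in
theorem card_openBis_isoCoord [Fintype F] (hi : i ^ 2 = -1) (h2 : (2 : F) ≠ 0) {y z : Fin 2 → F}
    (h : nrm (y - z) ≠ 0) :
    Fintype.card F ≤
      #(openBis (univ.image (isoCoord ι i)) (isoCoord ι i y, isoCoord ι i z)) + 2 ∧
    #(openBis (univ.image (isoCoord ι i)) (isoCoord ι i y, isoCoord ι i z)) ≤ Fintype.card F := by
  have key : openBis (univ.image (isoCoord ι i)) (isoCoord ι i y, isoCoord ι i z) =
      ({t : F | ¬ t ^ 2 + 2⁻¹ ^ 2 = 0} : Finset F).image (fun t => isoCoord ι i (bisPoint y z t)) := by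
    ext w
    simp only [openBis, Finset.mem_filter, Finset.mem_image, Finset.mem_univ, true_and]
    constructor
    · rintro ⟨⟨x, rfl⟩, h1, h3⟩
      rw [sep_isoCoord hi, sep_isoCoord hi] at h1
      rw [sep_isoCoord hi, Ne, map_eq_zero] at h3
      obtain ⟨t, rfl⟩ := exists_eq_bisPoint h2 h (ι.injective h1)
      refine ⟨t, fun h0 => h3 ?_, rfl⟩
      rw [nrm_bisPoint_sub_left h2, h0, mul_zero]
    · rintro ⟨t, ht, rfl⟩
      refine ⟨⟨_, rfl⟩, ?_, ?_⟩
      · simp only [sep_isoCoord hi, nrm_bisPoint_sub_left h2, nrm_bisPoint_sub_right h2]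
      · simp only [sep_isoCoord hi, nrm_bisPoint_sub_left h2, Ne, map_eq_zero]
        exact mul_ne_zero h ht
  have hroots : #({t : F | t ^ 2 + 2⁻¹ ^ 2 = 0} : Finset F) ≤ 2 := by
    rcases Finset.eq_empty_or_nonempty ({t : F | t ^ 2 + 2⁻¹ ^ 2 = 0} : Finset F) with he | ⟨s, hs⟩
    · rw [he, Finset.card_empty]; exact Nat.zero_le 2
    · refine (Finset.card_le_card (t := {s, -s}) fun t ht => ?_).trans Finset.card_le_two
      simp only [Finset.mem_filter, Finset.mem_univ, true_and] at hs ht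
      rw [Finset.mem_insert, Finset.mem_singleton, ← sq_eq_sq_iff_eq_or_eq_neg]
      linear_combination ht - hs
  have hsum := Finset.card_filter_add_card_filter_not (s := (univ : Finset F))
    (fun t => t ^ 2 + 2⁻¹ ^ 2 = 0)
  rw [Finset.card_univ] at hsum
  have hinj : Function.Injective fun t => isoCoord ι i (bisPoint y z t) :=
    (isoCoord_injective hi h2).comp (bisPoint_injective h)
  rw [key, Finset.card_image_of_injective _ hinj]
  omega

theorem eq_of_nrm_sub_eq_zero (hsq : ¬ IsSquare (-1 : F)) {x y : Fin 2 → F}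
    (h : nrm (x - y) = 0) : x = y := by
  simp only [nrm, Fin.sum_univ_two, Pi.sub_apply] at h
  have h1 : x 1 - y 1 = 0 := by
    by_contra h0
    refine hsq ⟨(x 0 - y 0) / (x 1 - y 1), ?_⟩
    field_simp
    linear_combination -h
  have h0 : x 0 - y 0 = 0 := by
    rw [h1, mul_zero, add_zero] at h
    exact mul_self_eq_zero.1 h
  ext j
  fin_cases j
  · exact sub_eq_zero.1 h0
  · exact sub_eq_zero.1 h1

theorem eq_of_isoCoord_fst_eq (hi : i ^ 2 = -1) (hsq : ¬ IsSquare (-1 : F)) {x y : Fin 2 → F}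
    (h : (isoCoord ι i x).1 = (isoCoord ι i y).1) : x = y := by
  refine eq_of_nrm_sub_eq_zero hsq ?_
  rw [← map_eq_zero ι, ← sep_isoCoord hi, sep, h, sub_self, zero_mul]

theorem eq_of_isoCoord_snd_eq (hi : i ^ 2 = -1) (hsq : ¬ IsSquare (-1 : F)) {x y : Fin 2 → F}
    (h : (isoCoord ι i x).2 = (isoCoord ι i y).2) : x = y := by
  refine eq_of_nrm_sub_eq_zero hsq ?_
  rw [← map_eq_zero ι, ← sep_isoCoord hi, sep, h, sub_self, mul_zero]

open Classical in
theorem card_filter_isosceles_le (hi : i ^ 2 = -1) (h2 : (2 : F) ≠ 0) [DecidableEq F]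
    (X : Finset (Fin 2 → F)) :
    #{t ∈ X ×ˢ X ×ˢ X | nrm (t.1 - t.2.1) = nrm (t.1 - t.2.2) ∧ nrm (t.2.1 - t.2.2) ≠ 0} ≤
      #(triangles (X.image (isoCoord ι i))) := by
  have hinj := isoCoord_injective (ι := ι) hi h2
  refine Finset.card_le_card_of_injOn
    (fun t => (isoCoord ι i t.1, isoCoord ι i t.2.1, isoCoord ι i t.2.2)) ?_ ?_
  · rintro ⟨x, y, z⟩ h
    simp only [Finset.coe_filter, Finset.mem_product, Set.mem_ofPred_eq] at h
    obtain ⟨⟨hx, hy, hz⟩, h1, h3⟩ := h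
    simp only [Finset.mem_coe, mem_triangles, noniso_isoCoord_iff hi, sep_isoCoord hi, h1]
    exact ⟨⟨Finset.mem_image_of_mem _ hx, Finset.mem_image_of_mem _ hy,
      Finset.mem_image_of_mem _ hz⟩, h3, trivial⟩
  · rintro ⟨x, y, z⟩ - ⟨x', y', z'⟩ - h
    simp only [Prod.mk.injEq] at h ⊢
    exact ⟨hinj h.1, hinj h.2.1, hinj h.2.2⟩

end IsoCoord

theorem exists_sq_eq_neg_one_of_isSquare {F : Type*} [Field F] [IsAlgClosed K] (ι : F →+* K) :
    ∃ i : K, i ^ 2 = -1 ∧ (IsSquare (-1 : F) → ∃ j, ι j = i) := by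
  by_cases h : IsSquare (-1 : F)
  · obtain ⟨j, hj⟩ := h
    exact ⟨ι j, by rw [← map_pow, sq, ← hj, map_neg, map_one], fun _ => ⟨j, rfl⟩⟩
  · obtain ⟨i, hi⟩ := IsAlgClosed.exists_pow_nat_eq (-1 : K) two_pos
    exact ⟨i, hi, fun h' => absurd h' h⟩

open Classical in
theorem cornerSum_isoCoord_le {F : Type*} [Field F] [Fintype F] {ι : F →+* K} {i : K}
    (hi : i ^ 2 = -1) (h2 : (2 : F) ≠ 0) (hsq : IsSquare (-1 : F) → ∃ j, ι j = i) {p : ℕ}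
    (hF : Fintype.card F = p) {X : Finset (K × K)} (hXV : X ⊆ univ.image (isoCoord ι i))
    (hX : ∀ y ∈ X, ∀ z ∈ X, Noniso y z →
      p ≤ #(openBis (univ.image (isoCoord ι i)) (y, z)) + 2 ∧
        #(openBis (univ.image (isoCoord ι i)) (y, z)) ≤ p)
    {k K₀ : ℕ} (hk : 4 * #X ≤ k ^ 2) (hfst : ∀ a, #{x ∈ X | x.1 = a} ≤ K₀)
    (hsnd : ∀ b, #{x ∈ X | x.2 = b} ≤ K₀) :
    cornerSum (univ.image (isoCoord ι i)) p (goodPairs X k) ≤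
      40 * (p * (#X : ℝ) ^ 2 + (p : ℝ) ^ 2 * #X * K₀) := by
  have hp : 0 < p := hF ▸ Fintype.card_pos
  have hV : #(univ.image (isoCoord ι i)) = p ^ 2 := by
    rw [Finset.card_image_of_injective _ (isoCoord_injective hi h2)]
    simp [hF]
  have e1 : 0 ≤ (p : ℝ) * (#X : ℝ) ^ 2 := by positivity
  have e2 : 0 ≤ (p : ℝ) ^ 2 * #X * K₀ := by positivity
  by_cases h : IsSquare (-1 : F)
  · obtain ⟨j, rfl⟩ := hsq h
    have := cornerSum_goodPairs_le hF ι (Function.invFun ι) hV hXV hk hX ?_ hfst hsnd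
    · linarith
    · intro x hx
      obtain ⟨w, -, rfl⟩ := Finset.mem_image.1 hx
      exact ⟨Function.invFun_eq ⟨w 0 + j * w 1, by simp [isoCoord]⟩,
        Function.invFun_eq ⟨w 0 - j * w 1, by simp [isoCoord]⟩⟩
  · have := cornerSum_goodPairs_le_of_injOn hp hV hXV (k := k) hX ?_ ?_
    · linarith
    all_goals
      intro x hx y hy hxy
      obtain ⟨w, -, rfl⟩ := Finset.mem_image.1 hx
      obtain ⟨w', -, rfl⟩ := Finset.mem_image.1 hy
    · rw [eq_of_isoCoord_fst_eq hi h hxy]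
    · rw [eq_of_isoCoord_snd_eq hi h hxy]

end

/-- non-degenerate isosceles triangles in the plane: there is an
absolute constant `C > 0` such that for every odd prime `p` and `X ⊆ 𝔽_p²` with
`|X| ≤ p^{4/3}`, the number `T*(X)` of triples `(x,y,z) ∈ X³` with
`‖x-y‖ = ‖x-z‖` and `‖y-z‖ ≠ 0` satisfies
`T*(X) ≤ |X|³/p + C · min{p^{2/3}|X|^{5/3} + p^{1/4}|X|², |X|^{7/3}}`. -/
theorem stmt10 :
    ∃ C : ℝ, 0 < C ∧
      ∀ (p : ℕ), p.Prime → Odd p →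
      ∀ X : Finset (Fin 2 → ZMod p),
        (X.card : ℝ) ≤ (p : ℝ) ^ ((4 : ℝ) / 3) →
        ((((X ×ˢ X ×ˢ X).filter fun t =>
            nrm (t.1 - t.2.1) = nrm (t.1 - t.2.2) ∧ nrm (t.2.1 - t.2.2) ≠ 0).card : ℝ)) ≤
          (X.card : ℝ) ^ 3 / (p : ℝ) +
            C * min ((p : ℝ) ^ ((2 : ℝ) / 3) * (X.card : ℝ) ^ ((5 : ℝ) / 3) +
                      (p : ℝ) ^ ((1 : ℝ) / 4) * (X.card : ℝ) ^ 2)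
                    ((X.card : ℝ) ^ ((7 : ℝ) / 3)) := by
  refine ⟨2 * 10 ^ 8, by norm_num, fun p hp hodd X hX => ?_⟩
  classical
  have : Fact p.Prime := ⟨hp⟩
  have h2 : (2 : ZMod p) ≠ 0 := by
    intro h
    have h' : ((2 : ℕ) : ZMod p) = 0 := by exact_mod_cast h
    rw [ZMod.natCast_eq_zero_iff, Nat.prime_dvd_prime_iff_eq hp Nat.prime_two] at h'
    rw [h'] at hodd
    exact absurd hodd (by decide)
  have hXp : #X ^ 3 ≤ p ^ 4 := by
    have h : (#X : ℝ) ^ 3 ≤ ((p : ℝ) ^ ((4 : ℝ) / 3)) ^ 3 := by gcongr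
    rw [← Real.rpow_mul_natCast (Nat.cast_nonneg p)] at h
    norm_num at h
    exact_mod_cast h
  set K := AlgebraicClosure (ZMod p)
  set ι : ZMod p →+* K := algebraMap (ZMod p) K
  have : CharP K p := charP_of_injective_algebraMap ι.injective p
  have : Infinite K := IsAlgClosed.instInfinite
  obtain ⟨i, hi, hsq⟩ := exists_sq_eq_neg_one_of_isSquare ι
  set V := univ.image (isoCoord ι i)
  set Y := X.image (isoCoord ι i)
  have hinj := isoCoord_injective (ι := ι) hi h2
  have hV : #V = p ^ 2 := by
    rw [Finset.card_image_of_injective _ hinj]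
    simp [ZMod.card]
  have hY : #Y = #X := Finset.card_image_of_injective _ hinj
  have hYV : Y ⊆ V := Finset.image_subset_image (Finset.subset_univ _)
  have hT := card_filter_isosceles_le (ι := ι) hi h2 X
  have hbis : ∀ y ∈ Y, ∀ z ∈ Y, Noniso y z →
      p ≤ #(openBis V (y, z)) + 2 ∧ #(openBis V (y, z)) ≤ p := by
    intro y hy z hz hyz
    obtain ⟨y, -, rfl⟩ := Finset.mem_image.1 hy
    obtain ⟨z, -, rfl⟩ := Finset.mem_image.1 hz
    have := card_openBis_isoCoord (ι := ι) hi h2 ((noniso_isoCoord_iff hi y z).1 hyz)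
    rwa [ZMod.card] at this
  have hYp : #Y ^ 3 ≤ p ^ 4 := hY ▸ hXp
  have hsmall := card_triangles_le_rpow (p := p) Y hYp
  have hlarge := card_triangles_le_of_cornerSum hp.pos hV hYV hYp hbis
    fun X' hX' k K₀ hk h1 h3 => cornerSum_isoCoord_le hi h2 hsq (ZMod.card p) (hX'.trans hYV)
      (fun y hy z hz => hbis y (hX' hy) z (hX' hz)) hk h1 h3
  rw [hY] at hsmall hlarge
  have hT' : (#{t ∈ X ×ˢ X ×ˢ X | nrm (t.1 - t.2.1) = nrm (t.1 - t.2.2) ∧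
      nrm (t.2.1 - t.2.2) ≠ 0} : ℝ) ≤ #(triangles Y) := by exact_mod_cast hT
  have h0 : 0 ≤ (#X : ℝ) ^ 3 / p := by positivity
  have h1 : 0 ≤ (#X : ℝ) ^ (7 / 3 : ℝ) := by positivity
  refine hT'.trans ?_
  rw [mul_min_of_nonneg _ _ (by norm_num), ← min_add_add_left]
  exact le_min hlarge (by linarith)
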